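/- arXiv:0810.4996 — 3 statements merged into one kernel-verified Lean document; each statement's English description precedes it below -/
import Mathlib

section
/- For all convex bodies Δ₀, …, Δ_m ⊂ ℝ^l × ℝ^m and every linear functional γ on ℝ^l, the support function of the mixed fiber body MF(Δ₀, …, Δ_m) at γ equals the mixed shadow volume MS(Γ_{Δ₀}(γ), …, Γ_{Δ_m}(γ)). -/
open MeasureTheory

/-- The value at `γ` of the support function of the Minkowski integral `∫ Δ`. -/
noncomputable def minkowskiIntegralSupport (l m : ℕ)
    (Δ : ConvexBody ((Fin l → ℝ) × (Fin m → ℝ))) (γ : (Fin l → ℝ) →ₗ[ℝ] ℝ) : ℝ :=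
  ∫ a in Prod.snd '' (Δ : Set ((Fin l → ℝ) × (Fin m → ℝ))),
    sSup ((fun x => γ x) '' {x : Fin l → ℝ | (x, a) ∈ (Δ : Set ((Fin l → ℝ) × (Fin m → ℝ)))})

/-- The shadow volume of a convex body `B ⊂ ℝ × ℝ^m`. -/
noncomputable def shadowVolume (m : ℕ) (B : Set (ℝ × (Fin m → ℝ))) : ℝ :=
  ∫ a in Prod.snd '' B, sSup {t : ℝ | (t, a) ∈ B}

/-- The linear map `(x, y) ↦ (γ(x), y)` from `ℝ^l × ℝ^m` to `ℝ × ℝ^m`. -/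
noncomputable def gammaMap (l m : ℕ) (γ : (Fin l → ℝ) →ₗ[ℝ] ℝ) :
    ((Fin l → ℝ) × (Fin m → ℝ)) →ₗ[ℝ] (ℝ × (Fin m → ℝ)) :=
  (γ.comp (LinearMap.fst ℝ (Fin l → ℝ) (Fin m → ℝ))).prod
    (LinearMap.snd ℝ (Fin l → ℝ) (Fin m → ℝ))

/-- `Γ_Δ(γ)`: the image of a convex body `Δ ⊂ ℝ^l × ℝ^m` under `(x, y) ↦ (γ(x), y)`. -/
noncomputable def gammaBody (l m : ℕ) (Δ : ConvexBody ((Fin l → ℝ) × (Fin m → ℝ)))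
    (γ : (Fin l → ℝ) →ₗ[ℝ] ℝ) : ConvexBody (ℝ × (Fin m → ℝ)) where
  carrier := gammaMap l m γ '' (Δ : Set ((Fin l → ℝ) × (Fin m → ℝ)))
  convex' := Δ.convex.linear_image (gammaMap l m γ)
  isCompact' := Δ.isCompact.image (gammaMap l m γ).continuous_of_finiteDimensional
  nonempty' := Δ.nonempty.image _

/-- A symmetric multilinear map that vanishes on the diagonal is zero. -/
theorem MultilinearMap.apply_eq_zero_of_symm_of_diag {ι M A : Type*} [Fintype ι]
    [AddCommMonoid M] [AddCommGroup A] [IsAddTorsionFree A]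
    (f : MultilinearMap ℕ (fun _ : ι => M) A)
    (f_symm : ∀ (x : ι → M) (σ : Equiv.Perm ι), f (x ∘ σ) = f x)
    (f_diag : ∀ a : M, f (fun _ => a) = 0) (x : ι → M) : f x = 0 := by
  classical
  let avoiding : ι → Finset (ι → ι) := fun i => {r | ∀ k, r k ≠ i}
  have sum_avoiding (t : Finset ι) : ∑ r ∈ t.inf avoiding, f (fun k => x (r k)) = 0 := by
    have h : t.inf avoiding = Fintype.piFinset (fun _ : ι => tᶜ) := by
      ext r
      simp only [Finset.mem_inf, avoiding, Finset.mem_filter_univ, Fintype.mem_piFinset,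
        Finset.mem_compl]
      exact ⟨fun h k hk => h _ hk k rfl, fun h i hi k hk => h k (hk ▸ hi)⟩
    rw [h, ← f.map_sum_finset (fun _ j => x j) (fun _ => tᶜ)]
    exact f_diag _
  have key := Finset.inclusion_exclusion_sum_inf_compl Finset.univ avoiding
    (fun r => f (fun k => x (r k)))
  simp only [sum_avoiding, smul_zero, Finset.sum_const_zero] at key
  have surjective_of_mem (r : ι → ι) (hr : r ∈ Finset.univ.inf fun i => (avoiding i)ᶜ) :
      Function.Surjective r := by
    intro i
    simpa [avoiding] using (Finset.mem_inf.mp hr) i (Finset.mem_univ i)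
  have apply_eq (r : ι → ι) (hr : r ∈ Finset.univ.inf fun i => (avoiding i)ᶜ) :
      f (fun k => x (r k)) = f x :=
    f_symm x (Equiv.ofBijective r (surjective_of_mem r hr).bijective_of_finite)
  rw [Finset.sum_congr rfl apply_eq, Finset.sum_const] at key
  refine (smul_eq_zero_iff_right (Finset.card_ne_zero_of_mem (a := id) ?_)).mp key
  simp [Finset.mem_inf, avoiding]

/-- A function that is additive in each argument, with values in a group, as an `ℕ`-multilinear
map. -/
def MultilinearMap.ofUpdateAdd {n : ℕ} {M A : Type*} [AddCommMonoid M] [AddCommGroup A]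
    (F : (Fin n → M) → A)
    (F_add : ∀ (x : Fin n → M) (i : Fin n) (a b : M),
      F (Function.update x i (a + b)) = F (Function.update x i a) + F (Function.update x i b)) :
    MultilinearMap ℕ (fun _ : Fin n => M) A :=
  .mk' F F_add fun x i c a =>
    map_nsmul (⟨⟨fun b => F (Function.update x i b),
      by simpa using F_add x i 0 0⟩, F_add x i⟩ : M →+ A) c a

/-- A symmetric function that is additive in each argument is determined by its diagonal. -/
theorem eq_of_symm_of_update_add_of_diag {n : ℕ} {M A : Type*} [AddCommMonoid M] [AddCommGroup A]
    [IsAddTorsionFree A] {F G : (Fin n → M) → A}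
    (F_symm : ∀ (x : Fin n → M) (σ : Equiv.Perm (Fin n)), F (x ∘ σ) = F x)
    (F_add : ∀ (x : Fin n → M) (i : Fin n) (a b : M),
      F (Function.update x i (a + b)) = F (Function.update x i a) + F (Function.update x i b))
    (G_symm : ∀ (x : Fin n → M) (σ : Equiv.Perm (Fin n)), G (x ∘ σ) = G x)
    (G_add : ∀ (x : Fin n → M) (i : Fin n) (a b : M),
      G (Function.update x i (a + b)) = G (Function.update x i a) + G (Function.update x i b))
    (diag : ∀ a : M, F (fun _ => a) = G (fun _ => a)) (x : Fin n → M) : F x = G x := by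
  refine sub_eq_zero.mp <| MultilinearMap.apply_eq_zero_of_symm_of_diag
    (.ofUpdateAdd F F_add - .ofUpdateAdd G G_add) (fun x σ => ?_) (fun a => ?_) x
  · change F (x ∘ σ) - G (x ∘ σ) = F x - G x
    rw [F_symm, G_symm]
  · exact sub_eq_zero.mpr (diag a)

/-- The support function of a convex body is additive with respect to Minkowski sum. -/
theorem ConvexBody.sSup_image_add {n : ℕ} (K L : ConvexBody (Fin n → ℝ))
    (γ : (Fin n → ℝ) →ₗ[ℝ] ℝ) :
    sSup ((fun x => γ x) '' ((K + L : ConvexBody (Fin n → ℝ)) : Set (Fin n → ℝ)))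
      = sSup ((fun x => γ x) '' (K : Set (Fin n → ℝ)))
        + sSup ((fun x => γ x) '' (L : Set (Fin n → ℝ))) := by
  have hγ : Continuous γ := γ.continuous_of_finiteDimensional
  rw [ConvexBody.coe_add]
  refine (congrArg sSup (Set.image_add γ)).trans ?_
  exact csSup_add (K.nonempty.image _) (K.isCompact.image hγ).bddAbove
    (L.nonempty.image _) (L.isCompact.image hγ).bddAbove

theorem gammaBody_add (l m : ℕ) (K L : ConvexBody ((Fin l → ℝ) × (Fin m → ℝ)))
    (γ : (Fin l → ℝ) →ₗ[ℝ] ℝ) :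
    gammaBody l m (K + L) γ = gammaBody l m K γ + gammaBody l m L γ :=
  ConvexBody.ext <|
    (congrArg (gammaMap l m γ '' ·) (ConvexBody.coe_add K L)).trans (Set.image_add (gammaMap l m γ))

theorem shadowVolume_gammaBody (l m : ℕ) (Δ : ConvexBody ((Fin l → ℝ) × (Fin m → ℝ)))
    (γ : (Fin l → ℝ) →ₗ[ℝ] ℝ) :
    shadowVolume m (gammaBody l m Δ γ : Set (ℝ × (Fin m → ℝ)))
      = minkowskiIntegralSupport l m Δ γ := by
  have coe_gammaBody : (gammaBody l m Δ γ : Set (ℝ × (Fin m → ℝ))) = gammaMap l m γ '' Δ := rfl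
  have image_snd : Prod.snd '' (gammaMap l m γ '' (Δ : Set ((Fin l → ℝ) × (Fin m → ℝ))))
      = Prod.snd '' (Δ : Set ((Fin l → ℝ) × (Fin m → ℝ))) := Set.image_image _ _ _
  have fiber (a : Fin m → ℝ) :
      {t : ℝ | (t, a) ∈ gammaMap l m γ '' (Δ : Set ((Fin l → ℝ) × (Fin m → ℝ)))}
        = (fun x => γ x) '' {x | (x, a) ∈ (Δ : Set ((Fin l → ℝ) × (Fin m → ℝ)))} := by
    ext t
    simp [gammaMap, and_comm]
  simp only [shadowVolume, minkowskiIntegralSupport, coe_gammaBody, image_snd, fiber]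

/-- The support function of the mixed fiber body `MF(Δ₀, …, Δ_m)` at `γ` equals the mixed
shadow volume `MS(Γ_{Δ₀}(γ), …, Γ_{Δ_m}(γ))`. -/
theorem support_mixed_fiber_body_eq_mixed_shadow_volume (l m : ℕ)
    (MF : (Fin (m + 1) → ConvexBody ((Fin l → ℝ) × (Fin m → ℝ))) → ConvexBody (Fin l → ℝ))
    (MF_symm : ∀ (Δ : Fin (m + 1) → ConvexBody ((Fin l → ℝ) × (Fin m → ℝ)))
      (σ : Equiv.Perm (Fin (m + 1))), MF (Δ ∘ σ) = MF Δ)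
    (MF_add : ∀ (Δ : Fin (m + 1) → ConvexBody ((Fin l → ℝ) × (Fin m → ℝ))) (i : Fin (m + 1))
      (K K' : ConvexBody ((Fin l → ℝ) × (Fin m → ℝ))),
      MF (Function.update Δ i (K + K'))
        = MF (Function.update Δ i K) + MF (Function.update Δ i K'))
    (MF_diag : ∀ (Δ : ConvexBody ((Fin l → ℝ) × (Fin m → ℝ))) (γ : (Fin l → ℝ) →ₗ[ℝ] ℝ),
      sSup ((fun x => γ x) '' ((MF fun _ => Δ) : Set (Fin l → ℝ)))
        = minkowskiIntegralSupport l m Δ γ)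
    (MS : (Fin (m + 1) → ConvexBody (ℝ × (Fin m → ℝ))) → ℝ)
    (MS_symm : ∀ (Δ : Fin (m + 1) → ConvexBody (ℝ × (Fin m → ℝ)))
      (σ : Equiv.Perm (Fin (m + 1))), MS (Δ ∘ σ) = MS Δ)
    (MS_add : ∀ (Δ : Fin (m + 1) → ConvexBody (ℝ × (Fin m → ℝ))) (i : Fin (m + 1))
      (K K' : ConvexBody (ℝ × (Fin m → ℝ))),
      MS (Function.update Δ i (K + K'))
        = MS (Function.update Δ i K) + MS (Function.update Δ i K'))
    (MS_diag : ∀ B : ConvexBody (ℝ × (Fin m → ℝ)),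
      MS (fun _ => B) = shadowVolume m (B : Set (ℝ × (Fin m → ℝ))))
    (Δ : Fin (m + 1) → ConvexBody ((Fin l → ℝ) × (Fin m → ℝ)))
    (γ : (Fin l → ℝ) →ₗ[ℝ] ℝ) :
    sSup ((fun x => γ x) '' ((MF Δ) : Set (Fin l → ℝ)))
      = MS (fun i => gammaBody l m (Δ i) γ) := by
  refine eq_of_symm_of_update_add_of_diag
    (F := fun Δ => sSup ((fun x => γ x) '' ((MF Δ) : Set (Fin l → ℝ))))
    (G := fun Δ => MS (fun i => gammaBody l m (Δ i) γ))
    (fun Δ σ => by simp only [MF_symm]) (fun Δ i K L => ?_)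
    (fun Δ σ => MS_symm (fun i => gammaBody l m (Δ i) γ) σ) (fun Δ i K L => ?_)
    (fun K => ?_) Δ
  · simp only [MF_add, ConvexBody.sSup_image_add]
  · have gammaBody_update (B : ConvexBody ((Fin l → ℝ) × (Fin m → ℝ))) :
        (fun j => gammaBody l m (Function.update Δ i B j) γ)
          = Function.update (fun j => gammaBody l m (Δ j) γ) i (gammaBody l m B γ) :=
      funext fun j => Function.apply_update (fun _ B => gammaBody l m B γ) Δ i B j
    simp only [gammaBody_update, gammaBody_add, MS_add]
  · simp only [MF_diag, MS_diag, shadowVolume_gammaBody]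
end

section
/- Let Δ₀, …, Δ_m and Δ'₀, …, Δ'_m be convex bodies in ℝ^l × ℝ^m such that Δ_i ⊆ Δ'_i and v(Δ_i) = v(Δ'_i) for every i = 0, …, m, where v : ℝ^l × ℝ^m → ℝ^m is the projection. Then MF(Δ₀, …, Δ_m) ⊆ MF(Δ'₀, …, Δ'_m). (Monotonicity of mixed fiber bodies.) -/
open MeasureTheory

open scoped Matrix

theorem sum_powerset_neg_one_pow_mul_ite_subset {ι : Type*} [DecidableEq ι] (T R : Finset ι) :
    ∑ S ∈ T.powerset, (-1 : ℝ) ^ (T \ S).card * (if R ⊆ S then 1 else 0)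
      = if R = T then 1 else 0 := by
  by_cases hRT : R ⊆ T
  · have h := Finset.prod_add (fun _ : ι => (1 : ℝ)) (fun i => if i ∈ R then 0 else -1) T
    have h2 : ∀ S ∈ T.powerset, (-1 : ℝ) ^ (T \ S).card * (if R ⊆ S then 1 else 0)
        = (∏ i ∈ S, (1 : ℝ)) * ∏ i ∈ T \ S, (if i ∈ R then 0 else -1) := by
      intro S hS
      split_ifs with hRS
      · rw [Finset.prod_congr (s₁ := T \ S) rfl (g := fun _ => (-1 : ℝ))]
        · simp
        · intro i hi
          rw [if_neg]
          exact fun hiR => (Finset.mem_sdiff.1 hi).2 (hRS hiR)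
      · obtain ⟨i, hiR, hiS⟩ := Finset.not_subset.1 hRS
        rw [Finset.prod_eq_zero (i := i) (Finset.mem_sdiff.2 ⟨hRT hiR, hiS⟩) (by simp [hiR])]
        simp
    rw [Finset.sum_congr rfl h2, ← h]
    split_ifs with hR
    · subst hR
      exact Finset.prod_eq_one fun i hi => by simp [hi]
    · obtain ⟨i, hiT, hiR⟩ := Finset.exists_of_ssubset (hRT.ssubset_of_ne hR)
      exact Finset.prod_eq_zero hiT (by simp [hiR])
  · rw [if_neg (fun h => hRT h.subset)]
    refine Finset.sum_eq_zero fun S hS => ?_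
    rw [if_neg (fun h => hRT (h.trans (Finset.mem_powerset.1 hS))), mul_zero]

/-- Alternating sums over subsets of the diagonal of a multilinear map, expanded. -/
theorem MultilinearMap.sum_powerset_diag {ι κ V R : Type*} [DecidableEq ι] [Fintype κ]
    [DecidableEq κ] {J : Type*} [Fintype J] [DecidableEq J] [Semiring R]
    [AddCommMonoid V] [Module R V] [Module R ℝ]
    (F : MultilinearMap R (fun _ : κ => V) ℝ) (b : J → Option ι) (x : κ → J → V) (T : Finset ι) :
    ∑ S ∈ T.powerset, (-1 : ℝ) ^ (T \ S).card *
        F (fun a => ∑ j with b j ∈ Finset.insertNone S, x a j)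
      = ∑ r : κ → J, (if Finset.eraseNone (Finset.univ.image (b ∘ r)) = T then 1 else 0) *
        F (fun a => x a (r a)) := by
  have h1 : ∀ S : Finset ι, F (fun a => ∑ j with b j ∈ Finset.insertNone S, x a j)
      = ∑ r : κ → J, (if Finset.eraseNone (Finset.univ.image (b ∘ r)) ⊆ S then 1 else 0) *
        F (fun a => x a (r a)) := by
    intro S
    simp_rw [F.map_sum_finset, ite_mul, one_mul, zero_mul]
    rw [← Finset.sum_filter]
    refine Finset.sum_congr ?_ fun _ _ => rfl
    ext r
    simp only [Finset.mem_filter_univ, Fintype.mem_piFinset, Finset.mem_insertNone,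
      Finset.subset_iff, Finset.mem_eraseNone, Finset.mem_image, Finset.mem_univ, true_and,
      Function.comp, Option.mem_def]
    exact ⟨fun h i ⟨a, ha⟩ => h a i ha, fun h a i hi => h ⟨a, hi⟩⟩
  simp_rw [h1, Finset.mul_sum]
  rw [Finset.sum_comm]
  refine Finset.sum_congr rfl fun r _ => ?_
  rw [← sum_powerset_neg_one_pow_mul_ite_subset T, Finset.sum_mul]
  exact Finset.sum_congr rfl fun S _ => by ring

theorem exists_polarization_of_symmetric {V : Type*} [AddCommMonoid V] (n : ℕ) :
    ∃ N : ℝ, 0 < N ∧ ∀ F : (Fin n → V) → ℝ,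
      (∀ x (σ : Equiv.Perm (Fin n)), F (x ∘ σ) = F x) →
      (∀ x i (y z : V), F (Function.update x i (y + z))
        = F (Function.update x i y) + F (Function.update x i z)) →
      ∀ (c : V) (x : Fin n → V),
        ∑ S : Finset (Fin n), (-1 : ℝ) ^ (Finset.univ \ S).card * F (fun _ => c + ∑ i ∈ S, x i)
          = N * F x := by
  refine ⟨∑ r : Fin n → Option (Fin n),
    (if Finset.eraseNone (Finset.univ.image (id ∘ r)) = Finset.univ then 1 else 0),
    ?_, fun F hsymm hadd c x => ?_⟩
  · refine Finset.sum_pos' (fun r _ => by positivity) ⟨some, Finset.mem_univ _, ?_⟩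
    rw [if_pos]
    · exact one_pos
    · ext i
      simp
  · let G : MultilinearMap ℕ (fun _ : Fin n => V) ℝ :=
      { toFun := F
        map_update_add' := by
          intro inst x i y z
          obtain rfl : inst = instDecidableEqFin n := Subsingleton.elim _ _
          exact hadd x i y z
        map_update_smul' := by
          intro inst x i k y
          obtain rfl : inst = instDecidableEqFin n := Subsingleton.elim _ _
          let g : V →+ ℝ := AddMonoidHom.mk' (M := V) (G := ℝ) (fun y => F (Function.update x i y))
            (fun y z => hadd x i y z)
          exact g.map_nsmul k y }
    have h := G.sum_powerset_diag id (fun _ o => o.elim c x) Finset.univ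
    rw [Finset.powerset_univ] at h
    have h2 : ∀ S : Finset (Fin n), ∑ j with id j ∈ Finset.insertNone S, j.elim c x
        = c + ∑ i ∈ S, x i := by
      intro S
      simp only [id, Finset.filter_univ_mem, Finset.sum_insertNone]
      rfl
    simp_rw [h2] at h
    refine h.trans ?_
    rw [Finset.sum_mul]
    refine Finset.sum_congr rfl fun r _ => ?_
    split_ifs with hr
    · have hs : ∀ i, ∃ a, r a = some i := by
        intro i
        have := hr.symm ▸ Finset.mem_univ i
        simpa using this
      choose τ hτ using hs
      have hinj : Function.Injective τ := fun i j hij => by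
        have := hτ i
        rw [hij, hτ j] at this
        exact (Option.some.inj this).symm
      let e := Equiv.ofBijective τ (Finite.injective_iff_bijective.1 hinj)
      have : (fun a => (r a).elim c x) = x ∘ e.symm := by
        funext a
        obtain ⟨i, rfl⟩ := e.surjective a
        simp only [Function.comp, Equiv.symm_apply_apply]
        change (r (τ i)).elim c x = _
        rw [hτ i]; rfl
      rw [this]
      congr 1
      exact hsymm x e.symm
    · simp

open scoped Matrix MatrixOrder Matrix.Norms.L2Operator in
/-- Mixed differences of the determinant along positive semidefinite directions are nonnegative. -/
theorem Matrix.PosSemidef.sum_powerset_det_nonneg {ι n : Type*} [DecidableEq ι] [Fintype ι]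
    [Fintype n] [DecidableEq n] (T : Finset ι) {B : Matrix n n ℝ} (hB : B.PosSemidef)
    {A : ι → Matrix n n ℝ} (hA : ∀ i, (A i).PosSemidef) :
    0 ≤ ∑ S ∈ T.powerset, (-1 : ℝ) ^ (T \ S).card * (B + ∑ i ∈ S, A i).det := by
  have hU : ∀ o : Option ι, ∃ U : Matrix n n ℝ, o.elim B A = Uᵀ * U := by
    intro o
    have : (o.elim B A).PosSemidef := by cases o <;> simp [hB, hA]
    obtain ⟨U, hU⟩ := CStarAlgebra.nonneg_iff_eq_star_mul_self.1 this.nonneg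
    exact ⟨U, by rwa [Matrix.star_eq_conjTranspose, Matrix.conjTranspose_eq_transpose_of_trivial] at hU⟩
  choose U hU using hU
  let w : Option ι × n → n → ℝ := fun j => U j.1 j.2
  let D : MultilinearMap ℝ (fun _ : n => (n → ℝ)) ℝ :=
    (Matrix.detRowAlternating (R := ℝ) (n := n)).toMultilinearMap
  have h := D.sum_powerset_diag Prod.fst (fun a j => w j a • w j) T
  have h1 : ∀ S : Finset ι, D (fun a => ∑ j with j.1 ∈ Finset.insertNone S, w j a • w j)
      = (B + ∑ i ∈ S, A i).det := by
    intro S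
    change Matrix.det (fun a => ∑ j with j.1 ∈ Finset.insertNone S, w j a • w j) = _
    congr 1
    have h2 : B + ∑ i ∈ S, A i = ∑ o ∈ Finset.insertNone S, o.elim B A := by
      rw [Finset.sum_insertNone]; rfl
    have h3 : (Finset.univ.filter fun j : Option ι × n => j.1 ∈ Finset.insertNone S)
        = Finset.insertNone S ×ˢ Finset.univ := by
      ext j; simp
    rw [h2, h3]
    ext a b
    rw [Finset.sum_product, Finset.sum_apply, Matrix.sum_apply]
    refine Finset.sum_congr rfl fun o _ => ?_
    rw [hU, Matrix.mul_apply, Finset.sum_apply]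
    rfl
  simp_rw [h1] at h
  rw [h]
  set φ : (n → Option ι × n) → ℝ := fun r =>
    (if Finset.eraseNone (Finset.univ.image (Prod.fst ∘ r)) = T then 1 else 0) *
      D (fun a => w (r a) a • w (r a)) with hφ
  have hsum : ∀ σ : Equiv.Perm n, ∑ r, φ (r ∘ σ) = ∑ r, φ r := fun σ =>
    (Equiv.arrowCongr σ.symm (Equiv.refl (Option ι × n))).sum_comp φ
  have hdet : ∀ r, ∑ σ : Equiv.Perm n, φ (r ∘ σ)
      = (if Finset.eraseNone (Finset.univ.image (Prod.fst ∘ r)) = T then 1 else 0) *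
        (Matrix.det fun a => w (r a)) ^ 2 := by
    intro r
    have h4 : ∀ σ : Equiv.Perm n, φ (r ∘ σ)
        = (if Finset.eraseNone (Finset.univ.image (Prod.fst ∘ r)) = T then 1 else 0) *
          ((((Equiv.Perm.sign σ : ℤ) : ℝ) * ∏ a, w (r (σ a)) a) *
            Matrix.det fun a => w (r a)) := by
      intro σ
      have h5 : Finset.univ.image (Prod.fst ∘ r ∘ σ) = Finset.univ.image (Prod.fst ∘ r) := by
        ext o
        simp only [Finset.mem_image, Finset.mem_univ, true_and, Function.comp]
        exact ⟨fun ⟨a, ha⟩ => ⟨σ a, ha⟩, fun ⟨a, ha⟩ => ⟨σ.symm a, by simpa using ha⟩⟩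
      have h6 : D (fun a => w (r (σ a)) a • w (r (σ a)))
          = (∏ a, w (r (σ a)) a) * D (fun a => w (r (σ a))) := by
        rw [D.map_smul_univ, smul_eq_mul]
      have h7 : D (fun a => w (r (σ a)))
          = ((Equiv.Perm.sign σ : ℤ) : ℝ) * Matrix.det fun a => w (r a) :=
        Matrix.det_permute σ (fun a => w (r a))
      simp only [hφ, h5, Function.comp_apply, h6, h7]
      ring
    simp_rw [h4]
    rw [← Finset.mul_sum, ← Finset.sum_mul, sq]
    congr 2
    exact (Matrix.det_apply' (Matrix.of fun a => w (r a))).symm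
  have hcard : (Fintype.card (Equiv.Perm n) : ℝ) * ∑ r, φ r = ∑ r, ∑ σ : Equiv.Perm n, φ (r ∘ σ) := by
    rw [Finset.sum_comm]
    simp [hsum]
  have hpos : (0 : ℝ) < Fintype.card (Equiv.Perm n) := by exact_mod_cast Fintype.card_pos
  refine nonneg_of_mul_nonneg_right ?_ hpos
  rw [hcard]
  refine Finset.sum_nonneg fun r _ => ?_
  rw [hdet]
  positivity

section Gradient

variable {m : ℕ}

/-- The gradient of `h`, as a coordinate vector. -/
noncomputable def piGradient (h : (Fin m → ℝ) → ℝ) (p : Fin m → ℝ) : Fin m → ℝ :=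
  fun i => fderiv ℝ h p (Pi.single i 1)

/-- The matrix of second partial derivatives of `h`. -/
noncomputable def piHessian (h : (Fin m → ℝ) → ℝ) (p : Fin m → ℝ) : Matrix (Fin m) (Fin m) ℝ :=
  Matrix.of fun i j => fderiv ℝ (fderiv ℝ h) p (Pi.single j 1) (Pi.single i 1)

theorem ContinuousLinearMap.apply_eq_dotProduct (f : (Fin m → ℝ) →L[ℝ] ℝ) (v : Fin m → ℝ) :
    f v = v ⬝ᵥ fun i => f (Pi.single i 1) := by
  conv_lhs => rw [pi_eq_sum_univ' v]
  rw [map_sum]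
  simp only [map_smul, smul_eq_mul]
  rfl

theorem fderiv_apply_eq_dotProduct_piGradient (h : (Fin m → ℝ) → ℝ) (p v : Fin m → ℝ) :
    fderiv ℝ h p v = v ⬝ᵥ piGradient h p :=
  (fderiv ℝ h p).apply_eq_dotProduct v

theorem ContDiff.hasFDerivAt_piGradient {h : (Fin m → ℝ) → ℝ} (hh : ContDiff ℝ 2 h)
    (p : Fin m → ℝ) :
    HasFDerivAt (piGradient h) (Matrix.toLin' (piHessian h p)).toContinuousLinearMap p := by
  have hd : DifferentiableAt ℝ (fderiv ℝ h) p :=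
    (hh.fderiv_right (m := 1) (by norm_num)).differentiable (by norm_num) p
  rw [hasFDerivAt_pi']
  intro i
  have h1 := (ContinuousLinearMap.apply ℝ ℝ (Pi.single i (1 : ℝ) : Fin m → ℝ)).hasFDerivAt.comp p
    hd.hasFDerivAt
  refine h1.congr_fderiv ?_
  ext v
  simp only [ContinuousLinearMap.comp_apply, ContinuousLinearMap.apply_apply,
    ContinuousLinearMap.proj_apply, LinearMap.coe_toContinuousLinearMap', Matrix.toLin'_apply]
  have h2 := ((ContinuousLinearMap.apply ℝ ℝ (Pi.single i (1 : ℝ) : Fin m → ℝ)).comp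
    (fderiv ℝ (fderiv ℝ h) p)).apply_eq_dotProduct v
  rw [dotProduct_comm] at h2
  exact h2

theorem continuous_piHessian {h : (Fin m → ℝ) → ℝ} (hh : ContDiff ℝ 2 h) :
    Continuous (piHessian h) := by
  have hc : Continuous (fderiv ℝ (fderiv ℝ h)) :=
    (hh.fderiv_right (m := 1) (by norm_num)).continuous_fderiv (by norm_num)
  refine continuous_matrix fun i j => ?_
  simp only [piHessian, Matrix.of_apply]
  fun_prop

theorem piHessian_add {h k : (Fin m → ℝ) → ℝ} (hh : ContDiff ℝ 2 h) (hk : ContDiff ℝ 2 k)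
    (p : Fin m → ℝ) : piHessian (h + k) p = piHessian h p + piHessian k p := by
  have h1 : fderiv ℝ (h + k) = fderiv ℝ h + fderiv ℝ k := by
    funext q
    exact fderiv_add (hh.differentiable (by norm_num) q) (hk.differentiable (by norm_num) q)
  ext i j
  have h2 : fderiv ℝ (fderiv ℝ h + fderiv ℝ k) p = _ := fderiv_add
    ((hh.fderiv_right (m := 1) (by norm_num)).differentiable (by norm_num) p)
    ((hk.fderiv_right (m := 1) (by norm_num)).differentiable (by norm_num) p)
  simp [piHessian, h1, h2]

theorem piHessian_zero (p : Fin m → ℝ) : piHessian (0 : (Fin m → ℝ) → ℝ) p = 0 := by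
  have h1 : fderiv ℝ (0 : (Fin m → ℝ) → ℝ) = 0 := by
    funext q
    exact fderiv_const_apply 0
  ext i j
  simp [piHessian, h1, fderiv_zero]

theorem piHessian_sum {ι : Type*} (S : Finset ι) {f : ι → (Fin m → ℝ) → ℝ}
    (hf : ∀ i, ContDiff ℝ 2 (f i)) (p : Fin m → ℝ) :
    piHessian (∑ i ∈ S, f i) p = ∑ i ∈ S, piHessian (f i) p := by
  classical
  induction S using Finset.induction_on with
  | empty => simp [piHessian_zero]
  | insert i S hi ih =>
    rw [Finset.sum_insert hi, Finset.sum_insert hi, piHessian_add (hf i) ?_, ih]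
    have : ContDiff ℝ 2 fun x => ∑ i ∈ S, f i x := ContDiff.sum fun i _ => hf i
    convert this using 1
    ext x
    simp

theorem ConvexOn.add_dotProduct_piGradient_le {h : (Fin m → ℝ) → ℝ} (hc : ConvexOn ℝ Set.univ h)
    (hd : Differentiable ℝ h) (p q : Fin m → ℝ) :
    h p + (q - p) ⬝ᵥ piGradient h p ≤ h q := by
  let L : ℝ →ᵃ[ℝ] (Fin m → ℝ) := AffineMap.lineMap p q
  have h1 : ConvexOn ℝ Set.univ (h ∘ L) := by simpa using hc.comp_affineMap L
  have h2 : HasDerivAt (h ∘ L) ((q - p) ⬝ᵥ piGradient h p) 0 := by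
    rw [← fderiv_apply_eq_dotProduct_piGradient]
    have h3 : HasDerivAt L (q - p) 0 := AffineMap.hasDerivAt_lineMap
    have h4 : L 0 = p := AffineMap.lineMap_apply_zero p q
    have h5 : HasFDerivAt h (fderiv ℝ h p) (L 0) := by rw [h4]; exact (hd p).hasFDerivAt
    exact h5.comp_hasDerivAt 0 h3
  have := h1.le_slope_of_hasDerivAt (Set.mem_univ 0) (Set.mem_univ 1) one_pos h2
  simp only [slope_def_field, L, Function.comp, AffineMap.lineMap_apply_one,
    AffineMap.lineMap_apply_zero, sub_zero, div_one] at this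
  linarith

theorem ConvexOn.posSemidef_piHessian {h : (Fin m → ℝ) → ℝ} (hc : ConvexOn ℝ Set.univ h)
    (hh : ContDiff ℝ 2 h) (p : Fin m → ℝ) : (piHessian h p).PosSemidef := by
  refine Matrix.PosSemidef.of_dotProduct_mulVec_nonneg ?_ fun v => ?_
  · ext i j
    have := hh.contDiffAt.isSymmSndFDerivAt (x := p) (by simp)
    simpa [piHessian] using this _ _
  · have hd : Differentiable ℝ h := hh.differentiable (by norm_num)
    have hmono : ∀ q r : Fin m → ℝ, 0 ≤ (q - r) ⬝ᵥ (piGradient h q - piGradient h r) := by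
      intro q r
      have h1 := hc.add_dotProduct_piGradient_le hd q r
      have h2 := hc.add_dotProduct_piGradient_le hd r q
      simp only [sub_dotProduct, dotProduct_sub] at *
      linarith
    let L : ℝ → (Fin m → ℝ) := fun t => p + t • v
    have hL : HasDerivAt L v 0 := by
      have := ((hasDerivAt_id (0 : ℝ)).smul_const v).const_add p
      rwa [one_smul] at this
    have hL0 : L 0 = p := by simp [L]
    have hg : HasDerivAt (piGradient h ∘ L) (piHessian h p *ᵥ v) 0 := by
      have h5 := hh.hasFDerivAt_piGradient p
      rw [← hL0] at h5
      have h6 := h5.comp_hasDerivAt 0 hL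
      simpa [hL0] using h6
    have hφ : HasDerivAt (fun t => v ⬝ᵥ piGradient h (L t)) (v ⬝ᵥ piHessian h p *ᵥ v) 0 := by
      simp only [dotProduct]
      exact HasDerivAt.fun_sum fun i _ => ((hasDerivAt_pi.1 hg i).const_mul (v i))
    have hm : Monotone fun t => v ⬝ᵥ piGradient h (L t) := by
      intro s t hst
      rcases hst.eq_or_lt with rfl | hlt
      · rfl
      have h7 := hmono (L t) (L s)
      have h8 : L t - L s = (t - s) • v := by simp [L, sub_smul]
      rw [h8, smul_dotProduct, smul_eq_mul] at h7
      have := nonneg_of_mul_nonneg_right h7 (sub_pos.2 hlt)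
      rw [dotProduct_sub] at this
      dsimp only
      linarith
    simpa using hφ.nonneg_of_monotone hm

theorem StrictConvexOn.injective_piGradient {h : (Fin m → ℝ) → ℝ}
    (hc : StrictConvexOn ℝ Set.univ h) (hd : Differentiable ℝ h) :
    Function.Injective (piGradient h) := by
  intro p q hpq
  by_contra hne
  have h1 := hc.convexOn.add_dotProduct_piGradient_le hd p q
  have h2 := hc.convexOn.add_dotProduct_piGradient_le hd q p
  have h3 := hc.convexOn.add_dotProduct_piGradient_le hd p ((1 / 2 : ℝ) • p + (1 / 2 : ℝ) • q)
  obtain ⟨-, hlt⟩ := hc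
  have h4 := hlt (Set.mem_univ p) (Set.mem_univ q) hne (one_half_pos (α := ℝ)) one_half_pos
    (add_halves 1)
  rw [← hpq] at h2
  simp only [sub_dotProduct, add_dotProduct, smul_dotProduct, smul_eq_mul] at *
  linarith

end Gradient

section ConcaveConj

variable {m : ℕ}

/-- The concave conjugate of `h`: the infimum of `h p - ⟨p, a⟩` over all `p`. -/
noncomputable def concaveConj (h : (Fin m → ℝ) → ℝ) (a : Fin m → ℝ) : ℝ :=
  ⨅ p, (h p - p ⬝ᵥ a)

/-- The convex function `h` has a concave conjugate with effective domain `D` which is bounded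
below on `D`. -/
structure HasConjDomain (D : Set (Fin m → ℝ)) (h : (Fin m → ℝ) → ℝ) : Prop where
  convexOn : ConvexOn ℝ Set.univ h
  exists_le : ∃ M, ∀ a ∈ D, ∀ p, p ⬝ᵥ a - M ≤ h p
  mem_of_le : ∀ a M, (∀ p, p ⬝ᵥ a - M ≤ h p) → a ∈ D

variable {D : Set (Fin m → ℝ)} {h k : (Fin m → ℝ) → ℝ}

theorem HasConjDomain.of_abs_sub_le (hD : HasConjDomain D h) (hk : ConvexOn ℝ Set.univ k) {c : ℝ}
    (hc : ∀ p, |k p - h p| ≤ c) : HasConjDomain D k where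
  convexOn := hk
  exists_le := by
    obtain ⟨M, hM⟩ := hD.exists_le
    refine ⟨M + c, fun a ha p => ?_⟩
    linarith [hM a ha p, (abs_le.1 (hc p)).1]
  mem_of_le a M hM := by
    refine hD.mem_of_le a (M + c) fun p => ?_
    linarith [hM p, (abs_le.1 (hc p)).2]

theorem HasConjDomain.bddBelow (hD : HasConjDomain D h) {a : Fin m → ℝ} (ha : a ∈ D) :
    BddBelow (Set.range fun p => h p - p ⬝ᵥ a) := by
  obtain ⟨M, hM⟩ := hD.exists_le
  refine ⟨-M, ?_⟩
  rintro _ ⟨p, rfl⟩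
  linarith [hM a ha p]

theorem HasConjDomain.concaveConj_le (hD : HasConjDomain D h) {a : Fin m → ℝ} (ha : a ∈ D)
    (p : Fin m → ℝ) : concaveConj h a ≤ h p - p ⬝ᵥ a :=
  ciInf_le (hD.bddBelow ha) p

theorem HasConjDomain.abs_concaveConj_sub_le (hD : HasConjDomain D h) (hk : HasConjDomain D k)
    {c : ℝ} (hc : ∀ p, |k p - h p| ≤ c) {a : Fin m → ℝ} (ha : a ∈ D) :
    |concaveConj k a - concaveConj h a| ≤ c := by
  rw [abs_le]
  constructor
  · have : concaveConj h a - c ≤ concaveConj k a := le_ciInf fun p => by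
      linarith [hD.concaveConj_le ha p, (abs_le.1 (hc p)).1]
    linarith
  · have : concaveConj k a - c ≤ concaveConj h a := le_ciInf fun p => by
      linarith [hk.concaveConj_le ha p, (abs_le.1 (hc p)).2]
    linarith

theorem HasConjDomain.piGradient_mem (hD : HasConjDomain D h) (hd : Differentiable ℝ h)
    (p : Fin m → ℝ) : piGradient h p ∈ D := by
  refine hD.mem_of_le _ (p ⬝ᵥ piGradient h p - h p) fun q => ?_
  have := hD.convexOn.add_dotProduct_piGradient_le hd p q
  rw [sub_dotProduct] at this
  linarith

theorem HasConjDomain.concaveConj_piGradient (hD : HasConjDomain D h) (hd : Differentiable ℝ h)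
    (p : Fin m → ℝ) : concaveConj h (piGradient h p) = h p - p ⬝ᵥ piGradient h p := by
  refine le_antisymm (hD.concaveConj_le (hD.piGradient_mem hd p) p) (le_ciInf fun q => ?_)
  have := hD.convexOn.add_dotProduct_piGradient_le hd p q
  rw [sub_dotProduct] at this
  linarith

theorem HasConjDomain.interior_subset_range_piGradient (hD : HasConjDomain D h)
    (hd : Differentiable ℝ h) : interior D ⊆ Set.range (piGradient h) := by
  intro a ha
  obtain ⟨M, hM⟩ := hD.exists_le
  obtain ⟨r, hr, hrD⟩ := Metric.nhds_basis_closedBall.mem_iff.1 (mem_interior_iff_mem_nhds.1 ha)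
  have hlow : ∀ p, r * ‖p‖ - M ≤ h p - p ⬝ᵥ a := by
    intro p
    let s : Fin m → ℝ := fun i => SignType.sign (p i)
    have hs : ‖r • s‖ ≤ r := by
      rw [norm_smul, Real.norm_of_nonneg hr.le]
      refine mul_le_of_le_one_right hr.le ((pi_norm_le_iff_of_nonneg zero_le_one).2 fun i => ?_)
      rcases lt_trichotomy (p i) 0 with hp | hp | hp <;> simp [s, hp]
    have h1 := hM (a + r • s) (hrD (by simpa [mem_closedBall_iff_norm] using hs)) p
    have h2 : ‖p‖ ≤ p ⬝ᵥ s := by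
      have h3 : p ⬝ᵥ s = ∑ i, |p i| := Finset.sum_congr rfl fun i _ => by
        simp [s]
      rw [h3, pi_norm_le_iff_of_nonneg (Finset.sum_nonneg fun i _ => abs_nonneg _)]
      exact fun i => Finset.single_le_sum (f := fun i => |p i|) (fun i _ => abs_nonneg _)
        (Finset.mem_univ i)
    rw [dotProduct_add, dotProduct_smul, smul_eq_mul] at h1
    linarith [mul_le_mul_of_nonneg_left h2 hr.le]
  let L : (Fin m → ℝ) →L[ℝ] ℝ := ((dotProductBilin ℝ ℝ).flip a).toContinuousLinearMap
  have hL : ∀ p, L p = p ⬝ᵥ a := fun p => rfl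
  have hlim : Filter.Tendsto (fun p => h p - L p) (Filter.cocompact _) Filter.atTop := by
    refine Filter.tendsto_atTop_mono hlow ?_
    exact Filter.tendsto_atTop_add_const_right _ _
      ((tendsto_norm_cocompact_atTop (E := Fin m → ℝ)).const_mul_atTop hr)
  obtain ⟨p, hp⟩ := (hd.continuous.sub L.continuous).exists_forall_le hlim
  have h1 : fderiv ℝ (fun p => h p - L p) p = 0 :=
    IsLocalMin.fderiv_eq_zero (Filter.Eventually.of_forall hp)
  rw [fderiv_fun_sub (hd p) L.differentiableAt, L.fderiv, sub_eq_zero] at h1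
  refine ⟨p, funext fun i => ?_⟩
  simp [piGradient, h1, hL]

theorem HasConjDomain.range_piGradient_ae_eq (hD : HasConjDomain D h) (hconv : Convex ℝ D)
    (hd : Differentiable ℝ h) : Set.range (piGradient h) =ᵐ[volume] D := by
  have h1 : interior D =ᵐ[volume] D := interior_ae_eq_of_null_frontier (hconv.addHaar_frontier _)
  refine Filter.EventuallyLE.antisymm ?_ ?_
  · exact (Set.range_subset_iff.2 (hD.piGradient_mem hd)).eventuallyLE
  · exact h1.symm.le.trans (hD.interior_subset_range_piGradient hd).eventuallyLE

theorem HasConjDomain.concaveOn_concaveConj (hD : HasConjDomain D h) (hconv : Convex ℝ D) :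
    ConcaveOn ℝ D (concaveConj h) := by
  refine ⟨hconv, fun a ha b hb s t hs ht hst => le_ciInf fun p => ?_⟩
  have h1 := mul_le_mul_of_nonneg_left (hD.concaveConj_le ha p) hs
  have h2 := mul_le_mul_of_nonneg_left (hD.concaveConj_le hb p) ht
  simp only [smul_eq_mul, dotProduct_add, dotProduct_smul]
  have h3 : h p = s * h p + t * h p := by rw [← add_mul, hst, one_mul]
  linarith

theorem HasConjDomain.integrableOn_concaveConj (hD : HasConjDomain D h) (hconv : Convex ℝ D)
    (hcomp : IsCompact D) : IntegrableOn (concaveConj h) D := by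
  have h1 : interior D =ᵐ[volume] D := interior_ae_eq_of_null_frontier (hconv.addHaar_frontier _)
  rw [← integrableOn_congr_set_ae h1]
  obtain ⟨M, hM⟩ := hD.exists_le
  refine IntegrableOn.of_bound (C := max |h 0| |M|) ?_ ?_ ?_
  · exact (measure_mono interior_subset).trans_lt hcomp.measure_lt_top
  · exact ((hD.concaveOn_concaveConj hconv).continuousOn_interior).aestronglyMeasurable
      isOpen_interior.measurableSet
  · refine (ae_restrict_mem isOpen_interior.measurableSet).mono fun a ha => ?_
    have ha := interior_subset ha
    rw [Real.norm_eq_abs, abs_le]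
    have h2 : -M ≤ concaveConj h a := le_ciInf fun p => by linarith [hM a ha p]
    have h3 := hD.concaveConj_le ha 0
    rw [zero_dotProduct, sub_zero] at h3
    exact ⟨by linarith [le_abs_self M, le_max_right |h 0| |M|],
      by linarith [le_abs_self (h 0), le_max_left |h 0| |M|]⟩

/-- Change of variables along the gradient map of a convex function. -/
theorem HasConjDomain.integrable_and_integral_comp_piGradient (hD : HasConjDomain D h)
    (hconv : Convex ℝ D) (hcomp : IsCompact D) (hh : ContDiff ℝ 2 h)
    (hinj : Function.Injective (piGradient h)) {g : (Fin m → ℝ) → ℝ} (hg : Continuous g) {M : ℝ}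
    (hM : ∀ p, |g p| ≤ M) :
    Integrable (fun p => (piHessian h p).det * g p) ∧
    IntegrableOn (fun a => g (Function.invFun (piGradient h) a)) D ∧
    ∫ a in D, g (Function.invFun (piGradient h) a) = ∫ p, (piHessian h p).det * g p := by
  have hd : Differentiable ℝ h := hh.differentiable (by norm_num)
  have hae := hD.range_piGradient_ae_eq hconv hd
  have hderiv : ∀ p ∈ Set.univ, HasFDerivWithinAt (piGradient h)
      (Matrix.toLin' (piHessian h p)).toContinuousLinearMap Set.univ p :=
    fun p _ => (hh.hasFDerivAt_piGradient p).hasFDerivWithinAt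
  have hdet : ∀ p, |(Matrix.toLin' (piHessian h p)).toContinuousLinearMap.det|
      = (piHessian h p).det := by
    intro p
    rw [ContinuousLinearMap.det, LinearMap.coe_toContinuousLinearMap, LinearMap.det_toLin',
      abs_of_nonneg (hD.convexOn.posSemidef_piHessian hh p).det_nonneg]
  have hcont : Continuous fun p => (piHessian h p).det := (continuous_piHessian hh).matrix_det
  have h_int1 : Integrable fun p => (piHessian h p).det := by
    have := (integrableOn_image_iff_integrableOn_abs_det_fderiv_smul volume MeasurableSet.univ
      hderiv hinj.injOn (fun _ => (1 : ℝ))).1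
    simp only [hdet, smul_eq_mul, mul_one, integrableOn_univ, Set.image_univ] at this
    refine this ?_
    rw [integrableOn_congr_set_ae hae]
    exact integrableOn_const hcomp.measure_lt_top.ne
  have h_int : Integrable fun p => (piHessian h p).det * g p :=
    h_int1.mul_bdd hg.aestronglyMeasurable (Filter.Eventually.of_forall hM)
  have hinv : ∀ p, Function.invFun (piGradient h) (piGradient h p) = p :=
    Function.leftInverse_invFun hinj
  refine ⟨h_int, ?_, ?_⟩
  · have := (integrableOn_image_iff_integrableOn_abs_det_fderiv_smul volume MeasurableSet.univ
      hderiv hinj.injOn (fun a => g (Function.invFun (piGradient h) a))).2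
    simp only [hdet, hinv, smul_eq_mul, integrableOn_univ, Set.image_univ] at this
    rw [← integrableOn_congr_set_ae hae]
    exact this h_int
  · have := integral_image_eq_integral_abs_det_fderiv_smul volume MeasurableSet.univ
      hderiv hinj.injOn (fun a => g (Function.invFun (piGradient h) a))
    simp only [hdet, hinv, smul_eq_mul, Set.image_univ, Measure.restrict_univ] at this
    rw [← this]
    exact setIntegral_congr_set hae.symm

/-- The first variation of the integral of the concave conjugate, estimated from above. -/
theorem HasConjDomain.integral_concaveConj_sub_le (hD : HasConjDomain D h)
    (hDk : HasConjDomain D k) (hconv : Convex ℝ D) (hcomp : IsCompact D) (hh : ContDiff ℝ 2 h)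
    (hk : Continuous k) (hinj : Function.Injective (piGradient h)) {M : ℝ}
    (hM : ∀ p, |k p - h p| ≤ M) :
    (∫ a in D, concaveConj k a) - ∫ a in D, concaveConj h a
      ≤ ∫ p, (piHessian h p).det * (k p - h p) := by
  have hd : Differentiable ℝ h := hh.differentiable (by norm_num)
  obtain ⟨-, h1, h2⟩ := hD.integrable_and_integral_comp_piGradient hconv hcomp hh hinj
    (hk.sub hh.continuous) hM
  simp only [Pi.sub_apply] at h1 h2
  rw [← h2, ← integral_sub (hDk.integrableOn_concaveConj hconv hcomp)
    (hD.integrableOn_concaveConj hconv hcomp)]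
  refine integral_mono_ae ((hDk.integrableOn_concaveConj hconv hcomp).sub
    (hD.integrableOn_concaveConj hconv hcomp)) h1 ?_
  have hae := hD.range_piGradient_ae_eq hconv hd
  filter_upwards [ae_restrict_mem hcomp.measurableSet, ae_restrict_of_ae hae.mem_iff]
    with a ha hiff
  obtain ⟨p, rfl⟩ := hiff.2 ha
  have h3 := hDk.concaveConj_le (hD.piGradient_mem hd p) p
  rw [Function.leftInverse_invFun hinj p, hD.concaveConj_piGradient hd p]
  linarith

end ConcaveConj

section Variation

theorem le_of_sub_ge_neg_mul_sub {Φ B : ℝ → ℝ}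
    (h : ∀ s ∈ Set.Icc (0 : ℝ) 1, ∀ t ∈ Set.Icc (0 : ℝ) 1, s ≤ t →
      -((t - s) * (B s - B t)) ≤ Φ t - Φ s) : Φ 0 ≤ Φ 1 := by
  have key : ∀ n : ℕ, (Φ 0 - Φ 1) * (n + 1 : ℕ) ≤ B 0 - B 1 := by
    intro n
    have hn : (0 : ℝ) < (n + 1 : ℕ) := by positivity
    have step : ∀ k : ℕ, k ≤ n + 1 →
        (Φ 0 - Φ (k / (n + 1 : ℕ))) * (n + 1 : ℕ) ≤ B 0 - B (k / (n + 1 : ℕ)) := by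
      intro k
      induction k with
      | zero => simp
      | succ k ih =>
        intro hk
        have hk' : ((k + 1 : ℕ) : ℝ) ≤ (n + 1 : ℕ) := by exact_mod_cast hk
        have hle : (k : ℝ) ≤ (k + 1 : ℕ) := by simp
        have h1 := h (k / (n + 1 : ℕ)) ⟨by positivity, (div_le_one hn).2 (hle.trans hk')⟩
          ((k + 1 : ℕ) / (n + 1 : ℕ)) ⟨by positivity, (div_le_one hn).2 hk'⟩ (by gcongr)
        have h2 : ((k + 1 : ℕ) : ℝ) / (n + 1 : ℕ) - k / (n + 1 : ℕ) = 1 / (n + 1 : ℕ) := by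
          push_cast; ring
        have h3 := ih (by omega)
        rw [h2] at h1
        have h4 := mul_le_mul_of_nonneg_right h1 hn.le
        rw [neg_mul, mul_right_comm, one_div, inv_mul_cancel₀ hn.ne', one_mul] at h4
        linarith
    have := step (n + 1) le_rfl
    rwa [div_self hn.ne'] at this
  by_contra! hlt
  obtain ⟨n, hn⟩ := exists_nat_gt ((B 0 - B 1) / (Φ 0 - Φ 1))
  rw [div_lt_iff₀ (sub_pos.2 hlt)] at hn
  have := key n
  push_cast at this
  linarith [mul_comm (n : ℝ) (Φ 0 - Φ 1)]

variable {m : ℕ}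

theorem ConvexOn.finset_sum {ι : Type*} {L : ι → (Fin m → ℝ) → ℝ}
    (hL : ∀ i, ConvexOn ℝ Set.univ (L i)) (S : Finset ι) :
    ConvexOn ℝ Set.univ (∑ i ∈ S, L i) := by
  classical
  induction S using Finset.induction_on with
  | empty => rw [Finset.sum_empty]; exact convexOn_const (𝕜 := ℝ) (0 : ℝ) convex_univ
  | insert i S hi ih => rw [Finset.sum_insert hi]; exact (hL i).add ih

variable {ι : Type*} [DecidableEq ι] [Fintype ι]

/-- Monotonicity of the polarized integral of the concave conjugate, for smooth data. -/
theorem sum_powerset_integral_concaveConj_sub_nonneg (T : Finset ι)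
    {φ k₀ k₁ : (Fin m → ℝ) → ℝ} {L : ι → (Fin m → ℝ) → ℝ}
    (hφ : StrictConvexOn ℝ Set.univ φ) (hk₀ : ConvexOn ℝ Set.univ k₀)
    (hk₁ : ConvexOn ℝ Set.univ k₁) (hL : ∀ i, ConvexOn ℝ Set.univ (L i))
    (hφ' : ContDiff ℝ 2 φ) (hk₀' : ContDiff ℝ 2 k₀) (hk₁' : ContDiff ℝ 2 k₁)
    (hL' : ∀ i, ContDiff ℝ 2 (L i)) (hle : ∀ p, k₀ p ≤ k₁ p) {M : ℝ}
    (hM : ∀ p, k₁ p - k₀ p ≤ M) {D : Finset ι → Set (Fin m → ℝ)}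
    (hconv : ∀ S, Convex ℝ (D S)) (hcomp : ∀ S, IsCompact (D S))
    (hD : ∀ S, HasConjDomain (D S) (φ + k₀ + ∑ i ∈ S, L i)) :
    0 ≤ ∑ S ∈ T.powerset, (-1 : ℝ) ^ (T \ S).card *
      ((∫ a in D S, concaveConj (φ + k₁ + ∑ i ∈ S, L i) a)
        - ∫ a in D S, concaveConj (φ + k₀ + ∑ i ∈ S, L i) a) := by
  let b : ℝ → (Fin m → ℝ) → ℝ := fun s => φ + ((1 - s) • k₀ + s • k₁)
  let h : Finset ι → ℝ → (Fin m → ℝ) → ℝ := fun S s => b s + ∑ i ∈ S, L i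
  let J : Finset ι → ℝ → ℝ := fun S s => ∫ a in D S, concaveConj (h S s) a
  let G : Finset ι → ℝ → ℝ := fun S s => ∫ p, (piHessian (h S s) p).det * (k₁ p - k₀ p)
  have hb' : ∀ s, ContDiff ℝ 2 (b s) := fun s =>
    hφ'.add ((contDiff_const.smul hk₀').add (contDiff_const.smul hk₁'))
  have hb : ∀ s ∈ Set.Icc (0 : ℝ) 1, StrictConvexOn ℝ Set.univ (b s) := fun s hs =>
    hφ.add_convexOn ((hk₀.smul (sub_nonneg.2 hs.2)).add (hk₁.smul hs.1))
  have hsum := ConvexOn.finset_sum hL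
  have hsum' : ∀ S : Finset ι, ContDiff ℝ 2 (∑ i ∈ S, L i) := by
    intro S
    rw [Finset.sum_fn]
    exact ContDiff.sum fun i _ => hL' i
  have hh : ∀ S, ∀ s ∈ Set.Icc (0 : ℝ) 1, StrictConvexOn ℝ Set.univ (h S s) := fun S s hs =>
    (hb s hs).add_convexOn (hsum S)
  have hh' : ∀ S s, ContDiff ℝ 2 (h S s) := fun S s => (hb' s).add (hsum' S)
  have hsub : ∀ S s t p, h S t p - h S s p = (t - s) * (k₁ p - k₀ p) := by
    intro S s t p
    simp only [h, b, Pi.add_apply, Pi.smul_apply, smul_eq_mul]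
    ring
  have hg : ∀ p, |k₁ p - k₀ p| ≤ M := fun p => by
    rw [abs_of_nonneg (sub_nonneg.2 (hle p))]; exact hM p
  have h0 : ∀ S, h S 0 = φ + k₀ + ∑ i ∈ S, L i := fun S => by simp [h, b]
  have h1 : ∀ S, h S 1 = φ + k₁ + ∑ i ∈ S, L i := fun S => by simp [h, b]
  have hbd : ∀ S, ∀ s ∈ Set.Icc (0 : ℝ) 1, ∀ t ∈ Set.Icc (0 : ℝ) 1, ∀ p,
      |h S t p - h S s p| ≤ M := by
    intro S s hs t ht p
    rw [hsub, abs_mul]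
    have : |t - s| ≤ 1 := abs_le.2 ⟨by linarith [hs.2, ht.1], by linarith [hs.1, ht.2]⟩
    calc _ ≤ 1 * M := mul_le_mul this (hg p) (abs_nonneg _) zero_le_one
      _ = M := one_mul M
  have hdom : ∀ S, ∀ s ∈ Set.Icc (0 : ℝ) 1, HasConjDomain (D S) (h S s) := fun S s hs =>
    HasConjDomain.of_abs_sub_le (h0 S ▸ hD S) (hh S s hs).convexOn
      (hbd S 0 ⟨le_rfl, zero_le_one⟩ s hs)
  have hinj : ∀ S, ∀ s ∈ Set.Icc (0 : ℝ) 1, Function.Injective (piGradient (h S s)) :=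
    fun S s hs => (hh S s hs).injective_piGradient ((hh' S s).differentiable (by norm_num))
  have hJ : ∀ S, ∀ s ∈ Set.Icc (0 : ℝ) 1, ∀ t ∈ Set.Icc (0 : ℝ) 1,
      J S t - J S s ≤ (t - s) * G S s := by
    intro S s hs t ht
    have := (hdom S s hs).integral_concaveConj_sub_le (hdom S t ht) (hconv S) (hcomp S) (hh' S s)
      (hh' S t).continuous (hinj S s hs) (hbd S s hs t ht)
    refine this.trans_eq ?_
    rw [← integral_const_mul]
    exact integral_congr_ae (Filter.Eventually.of_forall fun p => by simp only [hsub]; ring)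
  have hG : ∀ s ∈ Set.Icc (0 : ℝ) 1,
      0 ≤ ∑ S ∈ T.powerset, (-1 : ℝ) ^ (T \ S).card * G S s := by
    intro s hs
    have h_int : ∀ S, Integrable fun p => (piHessian (h S s) p).det * (k₁ p - k₀ p) := fun S =>
      ((hdom S s hs).integrable_and_integral_comp_piGradient (hconv S) (hcomp S) (hh' S s)
        (hinj S s hs) (hk₁'.continuous.sub hk₀'.continuous) hg).1
    simp only [G, ← integral_const_mul]
    rw [← integral_finsetSum _ fun S _ => (h_int S).const_mul _]
    refine integral_nonneg fun p => ?_
    simp only [Pi.zero_apply, ← mul_assoc]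
    rw [← Finset.sum_mul]
    refine mul_nonneg ?_ (sub_nonneg.2 (hle p))
    have := Matrix.PosSemidef.sum_powerset_det_nonneg T
      ((hb s hs).convexOn.posSemidef_piHessian (hb' s) p)
      fun i => (hL i).posSemidef_piHessian (hL' i) p
    simpa only [h, piHessian_add (hb' s) (hsum' _), piHessian_sum _ hL'] using this
  have main := le_of_sub_ge_neg_mul_sub
    (Φ := fun s => ∑ S ∈ T.powerset, (-1 : ℝ) ^ (T \ S).card * J S s)
    (B := fun s => ∑ S ∈ T.powerset, G S s) ?_
  · simp only [J, h0, h1] at main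
    simp only [mul_sub, Finset.sum_sub_distrib]
    exact sub_nonneg.2 main
  intro s hs t ht hst
  have h2 : ∀ S ∈ T.powerset, (t - s) * ((-1 : ℝ) ^ (T \ S).card * G S s) - (t - s) *
      (G S s - G S t) ≤ (-1 : ℝ) ^ (T \ S).card * J S t - (-1 : ℝ) ^ (T \ S).card * J S s := by
    intro S _
    have h3 := hJ S s hs t ht
    have h4 := hJ S t ht s hs
    rcases neg_one_pow_eq_or ℝ (T \ S).card with h5 | h5 <;> rw [h5] <;> linarith
  have h6 := Finset.sum_le_sum h2
  simp only [Finset.sum_sub_distrib, ← Finset.mul_sum] at h6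
  have h7 := mul_nonneg (sub_nonneg.2 hst) (hG s hs)
  linarith

end Variation

section Smoothing

open scoped Convolution in
theorem exists_smoothing (m : ℕ) {ε : ℝ} (hε : 0 < ε) :
    ∃ Φ : ((Fin m → ℝ) → ℝ) → (Fin m → ℝ) → ℝ,
      (∀ h, Continuous h → ContDiff ℝ 2 (Φ h)) ∧
      (∀ h, Continuous h → ConvexOn ℝ Set.univ h → ConvexOn ℝ Set.univ (Φ h)) ∧
      (∀ h k, Continuous h → Continuous k → (∀ p, h p ≤ k p) → ∀ p, Φ h p ≤ Φ k p) ∧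
      (∀ h c, (∀ p q, |h p - h q| ≤ c * ‖p - q‖) → 0 ≤ c → Continuous h →
        ∀ p, |Φ h p - h p| ≤ c * ε) := by
  let w : ContDiffBump (0 : Fin m → ℝ) := ⟨ε / 2, ε, by linarith, by linarith⟩
  have h_int : ∀ h : (Fin m → ℝ) → ℝ, Continuous h → ∀ p,
      Integrable fun t => w.normed volume t * h (p - t) := fun h hh p =>
    w.hasCompactSupport_normed.convolutionExists_left (ContinuousLinearMap.lsmul ℝ ℝ)
      w.continuous_normed hh.locallyIntegrable p
  have hval : ∀ h p, (w.normed volume ⋆[ContinuousLinearMap.lsmul ℝ ℝ, volume] h) p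
      = ∫ t, w.normed volume t * h (p - t) := fun h p => rfl
  refine ⟨fun h => w.normed volume ⋆[ContinuousLinearMap.lsmul ℝ ℝ, volume] h, ?_, ?_, ?_, ?_⟩
  · intro h hh
    exact w.hasCompactSupport_normed.contDiff_convolution_left (n := 2) _ w.contDiff_normed
      hh.locallyIntegrable
  · intro h hh hc
    refine ⟨convex_univ, fun p _ q _ a b ha hb hab => ?_⟩
    simp only [hval, smul_eq_mul, ← integral_const_mul]
    rw [← integral_add ((h_int h hh p).const_mul a) ((h_int h hh q).const_mul b)]
    refine integral_mono (h_int h hh _) (((h_int h hh p).const_mul a).add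
      ((h_int h hh q).const_mul b)) fun t => ?_
    have h1 := hc.2 (Set.mem_univ (p - t)) (Set.mem_univ (q - t)) ha hb hab
    have h2 : a • p + b • q - t = a • (p - t) + b • (q - t) := by
      rw [smul_sub, smul_sub, sub_add_sub_comm, ← add_smul, hab, one_smul]
    have h3 := mul_le_mul_of_nonneg_left h1 (w.nonneg_normed (μ := volume) t)
    simp only [smul_eq_mul] at h3
    rw [← h2] at h3
    simp only
    linarith
  · intro h k hh hk hle p
    simp only [hval]
    exact integral_mono (h_int h hh _) (h_int k hk _) fun t =>
      mul_le_mul_of_nonneg_left (hle _) (w.nonneg_normed t)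
  · intro h c hc hc0 hh p
    rw [← Real.dist_eq]
    refine w.dist_normed_convolution_le hh.aestronglyMeasurable fun q hq => ?_
    rw [Real.dist_eq]
    refine (hc q p).trans (mul_le_mul_of_nonneg_left ?_ hc0)
    rw [← dist_eq_norm]
    exact (Metric.mem_ball.1 hq).le

end Smoothing

section NonsmoothVariation

variable {m : ℕ}

theorem HasConjDomain.abs_integral_concaveConj_sub_le {D : Set (Fin m → ℝ)}
    {h k : (Fin m → ℝ) → ℝ} (hD : HasConjDomain D h) (hk : HasConjDomain D k)
    (hconv : Convex ℝ D) (hcomp : IsCompact D) {c : ℝ} (hc : ∀ p, |k p - h p| ≤ c) :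
    |(∫ a in D, concaveConj k a) - ∫ a in D, concaveConj h a| ≤ c * volume.real D := by
  rw [← integral_sub (hk.integrableOn_concaveConj hconv hcomp)
    (hD.integrableOn_concaveConj hconv hcomp), ← Real.norm_eq_abs]
  exact norm_setIntegral_le_of_norm_le_const hcomp.measure_lt_top fun a ha =>
    hD.abs_concaveConj_sub_le hk hc ha

theorem continuous_of_abs_sub_le {h : (Fin m → ℝ) → ℝ} {c : ℝ}
    (hc : ∀ p q, |h p - h q| ≤ c * ‖p - q‖) : Continuous h := by
  refine (LipschitzWith.of_dist_le_mul (K := c.toNNReal) fun p q => ?_).continuous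
  rw [Real.dist_eq, dist_eq_norm]
  exact (hc p q).trans (mul_le_mul_of_nonneg_right (Real.le_coe_toNNReal c) (norm_nonneg _))

variable {ι : Type*} [DecidableEq ι] [Fintype ι]

/-- Monotonicity of the polarized integral of the concave conjugate, for Lipschitz data. -/
theorem sum_powerset_integral_concaveConj_sub_nonneg_of_lipschitz (T : Finset ι)
    {φ k₀ k₁ : (Fin m → ℝ) → ℝ} {L : ι → (Fin m → ℝ) → ℝ}
    (hφ : StrictConvexOn ℝ Set.univ φ) (hk₀ : ConvexOn ℝ Set.univ k₀)
    (hk₁ : ConvexOn ℝ Set.univ k₁) (hL : ∀ i, ConvexOn ℝ Set.univ (L i))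
    (hφ' : ContDiff ℝ 2 φ) {c : ℝ} (hc : 0 ≤ c) (hk₀' : ∀ p q, |k₀ p - k₀ q| ≤ c * ‖p - q‖)
    (hk₁' : ∀ p q, |k₁ p - k₁ q| ≤ c * ‖p - q‖)
    (hL' : ∀ i, ∀ p q, |L i p - L i q| ≤ c * ‖p - q‖) (hle : ∀ p, k₀ p ≤ k₁ p) {M : ℝ}
    (hM : ∀ p, k₁ p - k₀ p ≤ M) {D : Finset ι → Set (Fin m → ℝ)}
    (hconv : ∀ S, Convex ℝ (D S)) (hcomp : ∀ S, IsCompact (D S))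
    (hD : ∀ S, HasConjDomain (D S) (φ + k₀ + ∑ i ∈ S, L i)) :
    0 ≤ ∑ S ∈ T.powerset, (-1 : ℝ) ^ (T \ S).card *
      ((∫ a in D S, concaveConj (φ + k₁ + ∑ i ∈ S, L i) a)
        - ∫ a in D S, concaveConj (φ + k₀ + ∑ i ∈ S, L i) a) := by
  have hk₀c := continuous_of_abs_sub_le hk₀'
  have hk₁c := continuous_of_abs_sub_le hk₁'
  have hLc := fun i => continuous_of_abs_sub_le (hL' i)
  have hD₁ : ∀ S, HasConjDomain (D S) (φ + k₁ + ∑ i ∈ S, L i) := fun S => by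
    refine (hD S).of_abs_sub_le (c := M) ((hφ.convexOn.add hk₁).add (ConvexOn.finset_sum hL S))
      fun p => ?_
    have : (φ + k₁ + ∑ i ∈ S, L i) p - (φ + k₀ + ∑ i ∈ S, L i) p = k₁ p - k₀ p := by
      simp only [Pi.add_apply]; ring
    rw [this, abs_of_nonneg (sub_nonneg.2 (hle p))]
    exact hM p
  set C : ℝ := ∑ S ∈ T.powerset, 2 * (c * (1 + S.card) * volume.real (D S)) with hC
  have hC0 : 0 ≤ C := Finset.sum_nonneg fun S _ => by positivity
  have key : ∀ ε > 0, -(C * ε) ≤ ∑ S ∈ T.powerset, (-1 : ℝ) ^ (T \ S).card *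
      ((∫ a in D S, concaveConj (φ + k₁ + ∑ i ∈ S, L i) a)
        - ∫ a in D S, concaveConj (φ + k₀ + ∑ i ∈ S, L i) a) := by
    intro ε hε
    obtain ⟨Φ, hΦs, hΦc, hΦm, hΦa⟩ := exists_smoothing m hε
    have hclose : ∀ k : (Fin m → ℝ) → ℝ, (∀ p q, |k p - k q| ≤ c * ‖p - q‖) → Continuous k →
        ∀ (S : Finset ι) p, |(φ + Φ k + ∑ i ∈ S, Φ (L i)) p - (φ + k + ∑ i ∈ S, L i) p|
          ≤ c * ε * (1 + S.card) := by
      intro k hk hkc S p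
      have h1 : (φ + Φ k + ∑ i ∈ S, Φ (L i)) p - (φ + k + ∑ i ∈ S, L i) p
          = (Φ k p - k p) + ∑ i ∈ S, (Φ (L i) p - L i p) := by
        simp only [Pi.add_apply, Finset.sum_apply, Finset.sum_sub_distrib]; ring
      have h2 : |∑ i ∈ S, (Φ (L i) p - L i p)| ≤ S.card * (c * ε) := by
        refine (Finset.abs_sum_le_sum_abs _ _).trans ?_
        rw [← nsmul_eq_mul]
        exact Finset.sum_le_card_nsmul _ _ _ fun i _ => hΦa _ c (hL' i) hc (hLc i) p
      rw [h1]
      refine (abs_add_le _ _).trans ?_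
      linarith [hΦa k c hk hc hkc p]
    have hdom₀ : ∀ S : Finset ι, HasConjDomain (D S) (φ + Φ k₀ + ∑ i ∈ S, Φ (L i)) := fun S =>
      (hD S).of_abs_sub_le ((hφ.convexOn.add (hΦc _ hk₀c hk₀)).add
        (ConvexOn.finset_sum (fun i => hΦc _ (hLc i) (hL i)) S)) (hclose k₀ hk₀' hk₀c S)
    have hdom₁ : ∀ S : Finset ι, HasConjDomain (D S) (φ + Φ k₁ + ∑ i ∈ S, Φ (L i)) := fun S =>
      (hD₁ S).of_abs_sub_le ((hφ.convexOn.add (hΦc _ hk₁c hk₁)).add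
        (ConvexOn.finset_sum (fun i => hΦc _ (hLc i) (hL i)) S)) (hclose k₁ hk₁' hk₁c S)
    have main := sum_powerset_integral_concaveConj_sub_nonneg T hφ (hΦc _ hk₀c hk₀)
      (hΦc _ hk₁c hk₁) (fun i => hΦc _ (hLc i) (hL i)) hφ' (hΦs _ hk₀c) (hΦs _ hk₁c)
      (fun i => hΦs _ (hLc i)) (hΦm _ _ hk₀c hk₁c hle) (M := M + 2 * (c * ε))
      (fun p => by
        linarith [hM p, (abs_le.1 (hΦa k₀ c hk₀' hc hk₀c p)).1,
          (abs_le.1 (hΦa k₁ c hk₁' hc hk₁c p)).2]) hconv hcomp hdom₀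
    have hdiff : ∀ S ∈ T.powerset, (-1 : ℝ) ^ (T \ S).card *
        ((∫ a in D S, concaveConj (φ + Φ k₁ + ∑ i ∈ S, Φ (L i)) a)
          - ∫ a in D S, concaveConj (φ + Φ k₀ + ∑ i ∈ S, Φ (L i)) a)
        - 2 * (c * (1 + S.card) * volume.real (D S)) * ε
        ≤ (-1 : ℝ) ^ (T \ S).card *
        ((∫ a in D S, concaveConj (φ + k₁ + ∑ i ∈ S, L i) a)
          - ∫ a in D S, concaveConj (φ + k₀ + ∑ i ∈ S, L i) a) := by
      intro S _
      have h1 := abs_le.1 ((hD S).abs_integral_concaveConj_sub_le (hdom₀ S) (hconv S) (hcomp S)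
        (hclose k₀ hk₀' hk₀c S))
      have h2 := abs_le.1 ((hD₁ S).abs_integral_concaveConj_sub_le (hdom₁ S) (hconv S) (hcomp S)
        (hclose k₁ hk₁' hk₁c S))
      rcases neg_one_pow_eq_or ℝ (T \ S).card with h5 | h5 <;> rw [h5] <;>
        linarith [h1.1, h1.2, h2.1, h2.2]
    have h6 := Finset.sum_le_sum hdiff
    rw [Finset.sum_sub_distrib, ← Finset.sum_mul, ← hC] at h6
    linarith
  by_contra! hneg
  have := key _ (div_pos (neg_pos.2 hneg) (show 0 < C + 1 by linarith))
  rw [mul_div_assoc', ← neg_div, div_le_iff₀ (by linarith)] at this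
  nlinarith

end NonsmoothVariation

section Support

namespace ConvexBody

variable {V : Type*} [NormedAddCommGroup V] [NormedSpace ℝ V] [FiniteDimensional ℝ V]

/-- The support function of a convex body. -/
noncomputable def support (K : ConvexBody V) (f : V →ₗ[ℝ] ℝ) : ℝ :=
  sSup ((fun x => f x) '' (K : Set V))

theorem exists_isGreatest_support (K : ConvexBody V) (f : V →ₗ[ℝ] ℝ) :
    ∃ x ∈ K, f x = K.support f ∧ ∀ y ∈ K, f y ≤ f x := by
  obtain ⟨x, hx, hmax⟩ := K.isCompact.exists_isMaxOn K.nonempty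
    f.continuous_of_finiteDimensional.continuousOn
  refine ⟨x, hx, ?_, fun y hy => hmax hy⟩
  have : IsGreatest ((fun x => f x) '' (K : Set V)) (f x) := ⟨⟨x, hx, rfl⟩, ?_⟩
  · exact this.csSup_eq.symm
  rintro _ ⟨y, hy, rfl⟩
  exact hmax hy

theorem le_support (K : ConvexBody V) (f : V →ₗ[ℝ] ℝ) {x : V} (hx : x ∈ K) :
    f x ≤ K.support f := by
  obtain ⟨y, -, hy, hmax⟩ := K.exists_isGreatest_support f
  exact hy ▸ hmax x hx

theorem support_le (K : ConvexBody V) (f : V →ₗ[ℝ] ℝ) {c : ℝ} (hc : ∀ x ∈ K, f x ≤ c) :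
    K.support f ≤ c := by
  obtain ⟨y, hyK, hy, -⟩ := K.exists_isGreatest_support f
  exact hy ▸ hc y hyK

theorem support_add (K L : ConvexBody V) (f : V →ₗ[ℝ] ℝ) :
    (K + L).support f = K.support f + L.support f := by
  refine le_antisymm (support_le _ _ ?_) ?_
  · rintro _ ⟨x, hx, y, hy, rfl⟩
    rw [map_add]
    exact add_le_add (K.le_support f hx) (L.le_support f hy)
  · obtain ⟨x, hx, hxf, -⟩ := K.exists_isGreatest_support f
    obtain ⟨y, hy, hyf, -⟩ := L.exists_isGreatest_support f
    rw [← hxf, ← hyf, ← map_add]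
    exact le_support _ _ ⟨x, hx, y, hy, rfl⟩

theorem support_zero (f : V →ₗ[ℝ] ℝ) : (0 : ConvexBody V).support f = 0 := by
  have := support_add 0 0 f
  rw [add_zero] at this
  linarith

theorem support_sum {ι : Type*} (S : Finset ι) (K : ι → ConvexBody V) (f : V →ₗ[ℝ] ℝ) :
    (∑ i ∈ S, K i).support f = ∑ i ∈ S, (K i).support f := by
  classical
  induction S using Finset.induction_on with
  | empty => exact support_zero f
  | insert i S hi ih => rw [Finset.sum_insert hi, Finset.sum_insert hi, support_add, ih]

theorem support_mono {K L : ConvexBody V} (h : (K : Set V) ⊆ L) (f : V →ₗ[ℝ] ℝ) :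
    K.support f ≤ L.support f :=
  support_le _ _ fun _ hx => L.le_support f (h hx)

theorem subset_of_support_le {K L : ConvexBody V} (h : ∀ f, K.support f ≤ L.support f) :
    (K : Set V) ⊆ L := by
  intro x hx
  by_contra hxL
  obtain ⟨f, u, hu, hux⟩ := geometric_hahn_banach_closed_point L.convex L.isClosed hxL
  have h1 := L.support_le (f : V →ₗ[ℝ] ℝ) fun y hy => (hu y hy).le
  exact absurd ((K.le_support (f : V →ₗ[ℝ] ℝ) hx).trans ((h _).trans h1)) (not_le.2 hux)

end ConvexBody

variable {l m : ℕ}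

/-- The support function of `K` restricted to the functionals `(x, a) ↦ γ x + ⟨p, a⟩`. -/
noncomputable def fiberSupport (γ : (Fin l → ℝ) →ₗ[ℝ] ℝ)
    (K : ConvexBody ((Fin l → ℝ) × (Fin m → ℝ))) (p : Fin m → ℝ) : ℝ :=
  K.support (γ.coprod (dotProductBilin ℝ ℝ p))

variable (γ : (Fin l → ℝ) →ₗ[ℝ] ℝ) (K K' : ConvexBody ((Fin l → ℝ) × (Fin m → ℝ)))

theorem le_fiberSupport (p : Fin m → ℝ) {z : (Fin l → ℝ) × (Fin m → ℝ)} (hz : z ∈ K) :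
    γ z.1 + p ⬝ᵥ z.2 ≤ fiberSupport γ K p :=
  K.le_support (γ.coprod (dotProductBilin ℝ ℝ p)) hz

theorem fiberSupport_le (p : Fin m → ℝ) {c : ℝ} (hc : ∀ z ∈ K, γ z.1 + p ⬝ᵥ z.2 ≤ c) :
    fiberSupport γ K p ≤ c :=
  K.support_le (γ.coprod (dotProductBilin ℝ ℝ p)) hc

theorem exists_bound_apply_fst : ∃ R, ∀ z ∈ K, |γ z.1| ≤ R :=
  K.isCompact.exists_bound_of_continuousOn
    (γ.continuous_of_finiteDimensional.comp continuous_fst).continuousOn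

theorem convexOn_fiberSupport : ConvexOn ℝ Set.univ (fiberSupport γ K) := by
  refine ⟨convex_univ, fun p _ q _ a b ha hb hab => fiberSupport_le γ K _ fun z hz => ?_⟩
  have h1 := mul_le_mul_of_nonneg_left (le_fiberSupport γ K p hz) ha
  have h2 := mul_le_mul_of_nonneg_left (le_fiberSupport γ K q hz) hb
  rw [add_dotProduct, smul_dotProduct, smul_dotProduct]
  simp only [smul_eq_mul]
  have h3 : γ z.1 = a * γ z.1 + b * γ z.1 := by rw [← add_mul, hab, one_mul]
  linarith

theorem exists_lipschitz_fiberSupport :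
    ∃ c, 0 ≤ c ∧ ∀ p q, |fiberSupport γ K p - fiberSupport γ K q| ≤ c * ‖p - q‖ := by
  obtain ⟨R, hR0, hR⟩ := K.isBounded.exists_pos_norm_le
  have key : ∀ p q, fiberSupport γ K p - fiberSupport γ K q ≤ m * R * ‖p - q‖ := by
    intro p q
    rw [sub_le_iff_le_add]
    refine fiberSupport_le γ K p fun z hz => ?_
    have h1 := le_fiberSupport γ K q hz
    have h2 : (p - q) ⬝ᵥ z.2 ≤ m * R * ‖p - q‖ := by
      have h3 : ∀ i ∈ Finset.univ, (p - q) i * z.2 i ≤ ‖p - q‖ * R := fun i _ => by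
        refine (le_abs_self _).trans ?_
        rw [abs_mul]
        exact mul_le_mul (norm_le_pi_norm (p - q) i)
          ((norm_le_pi_norm z.2 i).trans ((norm_snd_le z).trans (hR z hz))) (abs_nonneg _)
          (norm_nonneg _)
      refine (Finset.sum_le_card_nsmul _ _ _ h3).trans_eq ?_
      rw [Finset.card_univ, Fintype.card_fin, nsmul_eq_mul]
      ring
    rw [sub_dotProduct] at h2
    linarith
  refine ⟨m * R, by positivity, fun p q => abs_le.2 ⟨?_, key p q⟩⟩
  have := key q p
  rw [norm_sub_rev] at this
  linarith

variable {K K'} in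
theorem exists_fiberSupport_sub_le
    (hproj : Prod.snd '' (K : Set ((Fin l → ℝ) × (Fin m → ℝ)))
      = Prod.snd '' (K' : Set ((Fin l → ℝ) × (Fin m → ℝ)))) :
    ∃ M, ∀ p, fiberSupport γ K' p - fiberSupport γ K p ≤ M := by
  obtain ⟨R, hR⟩ := exists_bound_apply_fst γ K
  obtain ⟨R', hR'⟩ := exists_bound_apply_fst γ K'
  refine ⟨R' + R, fun p => ?_⟩
  rw [sub_le_iff_le_add]
  refine fiberSupport_le γ K' p fun z hz => ?_
  obtain ⟨w, hw, hwz⟩ := hproj.ge ⟨z, hz, rfl⟩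
  have h1 := le_fiberSupport γ K p hw
  rw [hwz] at h1
  linarith [(abs_le.1 (hR w hw)).1, (abs_le.1 (hR' z hz)).2]

theorem isCompact_image_snd : IsCompact (Prod.snd '' (K : Set ((Fin l → ℝ) × (Fin m → ℝ)))) :=
  K.isCompact.image continuous_snd

theorem convex_image_snd : Convex ℝ (Prod.snd '' (K : Set ((Fin l → ℝ) × (Fin m → ℝ)))) :=
  K.convex.linear_image (LinearMap.snd ℝ _ _)

theorem hasConjDomain_fiberSupport :
    HasConjDomain (Prod.snd '' (K : Set ((Fin l → ℝ) × (Fin m → ℝ)))) (fiberSupport γ K) where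
  convexOn := convexOn_fiberSupport γ K
  exists_le := by
    obtain ⟨R, hR⟩ := exists_bound_apply_fst γ K
    refine ⟨R, ?_⟩
    rintro _ ⟨z, hz, rfl⟩ p
    linarith [le_fiberSupport γ K p hz, (abs_le.1 (hR z hz)).1]
  mem_of_le a M hM := by
    by_contra ha
    obtain ⟨R, hR⟩ := exists_bound_apply_fst γ K
    obtain ⟨f, u, hu, hua⟩ := geometric_hahn_banach_closed_point (convex_image_snd K)
      (isCompact_image_snd K).isClosed ha
    let p : Fin m → ℝ := fun i => f (Pi.single i 1)
    have hp : ∀ b, f b = p ⬝ᵥ b := fun b => by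
      rw [f.apply_eq_dotProduct b, dotProduct_comm]
    have key : ∀ n : ℕ, n * (f a - u) ≤ R + M := by
      intro n
      have h1 := hM ((n : ℝ) • p)
      have h2 : fiberSupport γ K ((n : ℝ) • p) ≤ R + n * u := by
        refine fiberSupport_le γ K _ fun z hz => ?_
        rw [smul_dotProduct, ← hp, smul_eq_mul]
        have := mul_le_mul_of_nonneg_left (hu z.2 ⟨z, hz, rfl⟩).le n.cast_nonneg
        linarith [(abs_le.1 (hR z hz)).2]
      rw [smul_dotProduct, ← hp, smul_eq_mul] at h1
      linarith
    obtain ⟨n, hn⟩ := exists_nat_gt ((R + M) / (f a - u))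
    rw [div_lt_iff₀ (sub_pos.2 hua)] at hn
    exact absurd (key n) (not_le.2 hn)

theorem sSup_fiber_eq_concaveConj {a : Fin m → ℝ}
    (ha : a ∈ Prod.snd '' (K : Set ((Fin l → ℝ) × (Fin m → ℝ)))) :
    sSup ((fun x => γ x) '' {x : Fin l → ℝ | (x, a) ∈ (K : Set ((Fin l → ℝ) × (Fin m → ℝ)))})
      = concaveConj (fiberSupport γ K) a := by
  obtain ⟨R, hR⟩ := exists_bound_apply_fst γ K
  obtain ⟨x₀, hx₀⟩ : ∃ x₀, (x₀, a) ∈ K := by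
    obtain ⟨⟨x₀, b⟩, hx₀, rfl⟩ := ha
    exact ⟨x₀, hx₀⟩
  refine le_antisymm (csSup_le ⟨_, x₀, hx₀, rfl⟩ ?_) ?_
  · rintro _ ⟨x, hx, rfl⟩
    exact le_ciInf fun p => by linarith [le_fiberSupport γ K p hx]
  by_contra! hlt
  set t := concaveConj (fiberSupport γ K) a with ht
  have hbdd : BddAbove ((fun x => γ x) ''
      {x : Fin l → ℝ | (x, a) ∈ (K : Set ((Fin l → ℝ) × (Fin m → ℝ)))}) := by
    refine ⟨R, ?_⟩
    rintro _ ⟨x, hx, rfl⟩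
    exact (abs_le.1 (hR _ hx)).2
  have hγ : ∀ x, (x, a) ∈ K → γ x < t := fun x hx => (le_csSup hbdd ⟨x, hx, rfl⟩).trans_lt hlt
  let A : ((Fin l → ℝ) × (Fin m → ℝ)) →ₗ[ℝ] ℝ × (Fin m → ℝ) := γ.prodMap LinearMap.id
  obtain ⟨f, u, v, hu, huv, hv⟩ := geometric_hahn_banach_compact_closed
    (K.convex.linear_image A) (K.isCompact.image A.continuous_of_finiteDimensional)
    (t := Set.Ici t ×ˢ {a}) ((convex_Ici t).prod (convex_singleton a))
    (isClosed_Ici.prod isClosed_singleton) (by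
      rw [Set.disjoint_left]
      rintro _ ⟨⟨x, b⟩, hz, rfl⟩ ⟨h1, h2⟩
      obtain rfl : b = a := h2
      exact absurd (hγ x hz) (not_lt.2 h1))
  let α : ℝ := f (1, 0)
  let p : Fin m → ℝ := fun i => f (0, Pi.single i 1)
  have hf : ∀ s b, f (s, b) = α * s + p ⬝ᵥ b := by
    intro s b
    have h1 : (s, b) = s • ((1 : ℝ), (0 : Fin m → ℝ)) + (0, b) := by simp
    have h2 := (f.comp (ContinuousLinearMap.inr ℝ ℝ (Fin m → ℝ))).apply_eq_dotProduct b
    simp only [ContinuousLinearMap.comp_apply, ContinuousLinearMap.inr_apply] at h2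
    rw [h1, map_add, map_smul, h2, dotProduct_comm, smul_eq_mul, mul_comm]
  have hu' : ∀ z ∈ K, α * γ z.1 + p ⬝ᵥ z.2 < u := fun z hz => by
    rw [← hf]; exact hu _ ⟨z, hz, rfl⟩
  have hv' : ∀ s, t ≤ s → v < α * s + p ⬝ᵥ a := fun s hs => by
    rw [← hf]; exact hv _ ⟨hs, rfl⟩
  have hα : 0 < α := by
    have h1 := hu' _ hx₀
    have h2 := hv' t le_rfl
    have h3 := hγ _ hx₀
    simp only at h1
    by_contra! hneg
    nlinarith
  have hq : fiberSupport γ K (α⁻¹ • p) ≤ α⁻¹ * u := by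
    refine fiberSupport_le γ K _ fun z hz => ?_
    have h1 := mul_le_mul_of_nonneg_left (hu' z hz).le (inv_nonneg.2 hα.le)
    rw [mul_add, inv_mul_cancel_left₀ hα.ne'] at h1
    rwa [smul_dotProduct, smul_eq_mul]
  have h1 := (hasConjDomain_fiberSupport γ K).concaveConj_le ha (α⁻¹ • p)
  have h2 := mul_lt_mul_of_pos_left (huv.trans (hv' t le_rfl)) (inv_pos.2 hα)
  rw [mul_add, inv_mul_cancel_left₀ hα.ne'] at h2
  rw [smul_dotProduct, smul_eq_mul] at h1
  linarith

theorem minkowskiIntegralSupport_eq_integral_concaveConj :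
    minkowskiIntegralSupport l m K γ
      = ∫ a in Prod.snd '' (K : Set ((Fin l → ℝ) × (Fin m → ℝ))),
        concaveConj (fiberSupport γ K) a :=
  setIntegral_congr_fun (isCompact_image_snd K).measurableSet fun _ ha =>
    sSup_fiber_eq_concaveConj γ K ha

theorem fiberSupport_add : fiberSupport γ (K + K') = fiberSupport γ K + fiberSupport γ K' :=
  funext fun _ => ConvexBody.support_add _ _ _

theorem fiberSupport_sum {ι : Type*} (S : Finset ι)
    (L : ι → ConvexBody ((Fin l → ℝ) × (Fin m → ℝ))) :
    fiberSupport γ (∑ i ∈ S, L i) = ∑ i ∈ S, fiberSupport γ (L i) := by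
  funext p
  rw [Finset.sum_apply]
  exact ConvexBody.support_sum _ _ _

end Support

section RoundBody

variable {l m : ℕ}

/-- The vector `(1, p)`, in Euclidean space. -/
noncomputable def consOne (p : Fin m → ℝ) : EuclideanSpace ℝ (Option (Fin m)) :=
  WithLp.toLp 2 fun o => o.elim 1 p

theorem consOne_ne_zero (p : Fin m → ℝ) : consOne p ≠ 0 := fun h => by
  simpa [consOne] using congrArg (fun u => u none) h

theorem contDiff_norm_consOne : ContDiff ℝ 2 fun p : Fin m → ℝ => ‖consOne p‖ := by
  refine ContDiff.norm ℝ ?_ consOne_ne_zero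
  rw [contDiff_euclidean]
  rintro (_ | i)
  · exact contDiff_const
  · exact contDiff_apply ℝ ℝ i

theorem strictConvexOn_norm_consOne :
    StrictConvexOn ℝ Set.univ fun p : Fin m → ℝ => ‖consOne p‖ := by
  refine ⟨convex_univ, fun p _ q _ hpq a b ha hb hab => ?_⟩
  have h1 : consOne (a • p + b • q) = a • consOne p + b • consOne q := by
    ext (_ | i)
    · simp [consOne, hab]
    · simp [consOne]
  have h2 : ¬SameRay ℝ (a • consOne p) (b • consOne q) := by
    intro h
    obtain ⟨r, s, hr, hs, hrs⟩ := h.exists_pos (smul_ne_zero ha.ne' (consOne_ne_zero p))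
      (smul_ne_zero hb.ne' (consOne_ne_zero q))
    have h3 : r * a = s * b := by simpa [consOne] using congrArg (fun u => u none) hrs
    refine hpq (funext fun i => ?_)
    have h4 : r * (a * p i) = s * (b * q i) := by
      simpa [consOne] using congrArg (fun u => u (some i)) hrs
    rw [← mul_assoc, ← mul_assoc, ← h3] at h4
    exact mul_left_cancel₀ (mul_pos hr ha).ne' h4
  simp only [h1]
  refine (norm_add_lt_of_not_sameRay h2).trans_eq ?_
  rw [norm_smul, norm_smul, Real.norm_of_nonneg ha.le, Real.norm_of_nonneg hb.le]
  rfl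

theorem exists_fiberSupport_eq_norm_consOne {γ : (Fin l → ℝ) →ₗ[ℝ] ℝ} (hγ : γ ≠ 0) :
    ∃ C : ConvexBody ((Fin l → ℝ) × (Fin m → ℝ)), fiberSupport γ C = fun p => ‖consOne p‖ := by
  obtain ⟨x, hx⟩ : ∃ x, γ x = 1 := LinearMap.surjective hγ 1
  let A : EuclideanSpace ℝ (Option (Fin m)) →ₗ[ℝ] (Fin l → ℝ) × (Fin m → ℝ) :=
    { toFun := fun u => (u none • x, fun i => u (some i))
      map_add' := fun u v => by ext <;> simp [add_mul]
      map_smul' := fun c u => by ext <;> simp [mul_assoc] }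
  refine ⟨⟨A '' Metric.closedBall 0 1, (convex_closedBall 0 1).linear_image A,
    (isCompact_closedBall 0 1).image A.continuous_of_finiteDimensional,
    (Metric.nonempty_closedBall.2 zero_le_one).image A⟩, funext fun p => ?_⟩
  have hA : ∀ u, γ (A u).1 + p ⬝ᵥ (A u).2 = inner ℝ u (consOne p) := fun u => by
    simp [A, hx, consOne, PiLp.inner_apply, Fintype.sum_option, dotProduct]
  refine le_antisymm (fiberSupport_le γ _ p ?_) ?_
  · rintro _ ⟨u, hu, rfl⟩
    rw [hA]
    refine (real_inner_le_norm _ _).trans (mul_le_of_le_one_left (norm_nonneg _) ?_)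
    simpa using hu
  · have hpos := norm_pos_iff.2 (consOne_ne_zero p)
    refine le_trans (le_of_eq ?_) (le_fiberSupport γ _ p
      ⟨‖consOne p‖⁻¹ • consOne p, ?_, rfl⟩)
    · rw [hA, real_inner_smul_left, real_inner_self_eq_norm_sq, pow_two,
        inv_mul_cancel_left₀ hpos.ne']
    · simp [norm_smul, hpos.ne']

end RoundBody

section Assembly

variable {l m : ℕ}

theorem sum_neg_one_pow_mul_update {ι V : Type*} [Fintype ι] [DecidableEq ι] [AddCommMonoid V]
    (f : V → ℝ) (x : ι → V) (i : ι) (y : V) :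
    ∑ S : Finset ι, (-1 : ℝ) ^ (Finset.univ \ S).card * f (∑ j ∈ S, Function.update x i y j)
      = ∑ S ∈ (Finset.univ.erase i).powerset,
          (-1 : ℝ) ^ (Finset.univ \ S).card * f (∑ j ∈ S, x j)
        + ∑ S ∈ (Finset.univ.erase i).powerset,
          (-1 : ℝ) ^ (Finset.univ.erase i \ S).card * f (y + ∑ j ∈ S, x j) := by
  have hi : i ∉ (Finset.univ : Finset ι).erase i := Finset.notMem_erase i _
  have hupd : ∀ S ∈ ((Finset.univ : Finset ι).erase i).powerset,
      ∑ j ∈ S, Function.update x i y j = ∑ j ∈ S, x j := fun S hS =>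
    Finset.sum_congr rfl fun j hj => Function.update_of_ne
      (Finset.ne_of_mem_erase (Finset.mem_powerset.1 hS hj)) _ _
  rw [← Finset.powerset_univ, ← Finset.insert_erase (Finset.mem_univ i),
    Finset.sum_powerset_insert hi, Finset.insert_erase (Finset.mem_univ i)]
  congr 1
  · exact Finset.sum_congr rfl fun S hS => by rw [hupd S hS]
  · refine Finset.sum_congr rfl fun S hS => ?_
    rw [Finset.sum_insert fun h => hi (Finset.mem_powerset.1 hS h), hupd S hS,
      Function.update_self, Finset.sdiff_insert, Finset.erase_sdiff_comm]

open scoped Pointwise in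
theorem image_snd_add (K L : ConvexBody ((Fin l → ℝ) × (Fin m → ℝ))) :
    Prod.snd '' ((K + L : ConvexBody ((Fin l → ℝ) × (Fin m → ℝ))) :
        Set ((Fin l → ℝ) × (Fin m → ℝ)))
      = Prod.snd '' (K : Set ((Fin l → ℝ) × (Fin m → ℝ)))
        + Prod.snd '' (L : Set ((Fin l → ℝ) × (Fin m → ℝ))) :=
  Set.image_add (LinearMap.snd ℝ (Fin l → ℝ) (Fin m → ℝ))

/-- Polarized Minkowski integrals are monotone in one argument, as long as the projection of that
argument does not change. -/
theorem sum_powerset_minkowskiIntegralSupport_le {ι : Type*} [Fintype ι] [DecidableEq ι]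
    (T : Finset ι) (γ : (Fin l → ℝ) →ₗ[ℝ] ℝ)
    {C K K' : ConvexBody ((Fin l → ℝ) × (Fin m → ℝ))}
    (L : ι → ConvexBody ((Fin l → ℝ) × (Fin m → ℝ)))
    (hC : fiberSupport γ C = fun p => ‖consOne p‖)
    (hsub : (K : Set ((Fin l → ℝ) × (Fin m → ℝ))) ⊆ K')
    (hproj : Prod.snd '' (K : Set ((Fin l → ℝ) × (Fin m → ℝ)))
      = Prod.snd '' (K' : Set ((Fin l → ℝ) × (Fin m → ℝ)))) :
    ∑ S ∈ T.powerset, (-1 : ℝ) ^ (T \ S).card *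
        minkowskiIntegralSupport l m (C + (K + ∑ j ∈ S, L j)) γ
      ≤ ∑ S ∈ T.powerset, (-1 : ℝ) ^ (T \ S).card *
        minkowskiIntegralSupport l m (C + (K' + ∑ j ∈ S, L j)) γ := by
  choose c hc0 hc using fun B : ConvexBody ((Fin l → ℝ) × (Fin m → ℝ)) =>
    exists_lipschitz_fiberSupport γ B
  obtain ⟨M, hM⟩ := exists_fiberSupport_sub_le γ hproj
  let c' := c K + c K' + ∑ i, c (L i)
  have hsum0 : 0 ≤ ∑ i, c (L i) := Finset.sum_nonneg fun i _ => hc0 _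
  have hlip : ∀ B, c B ≤ c' → ∀ p q, |fiberSupport γ B p - fiberSupport γ B q| ≤ c' * ‖p - q‖ :=
    fun B hB p q => (hc B p q).trans (mul_le_mul_of_nonneg_right hB (norm_nonneg _))
  have hsupp : ∀ B S, fiberSupport γ (C + (B + ∑ j ∈ S, L j))
      = fiberSupport γ C + fiberSupport γ B + ∑ j ∈ S, fiberSupport γ (L j) := fun B S => by
    rw [fiberSupport_add, fiberSupport_add, fiberSupport_sum, add_assoc]
  have hdom : ∀ S : Finset ι, Prod.snd '' ((C + (K' + ∑ j ∈ S, L j) :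
      ConvexBody ((Fin l → ℝ) × (Fin m → ℝ))) : Set ((Fin l → ℝ) × (Fin m → ℝ)))
      = Prod.snd '' ((C + (K + ∑ j ∈ S, L j) :
      ConvexBody ((Fin l → ℝ) × (Fin m → ℝ))) : Set ((Fin l → ℝ) × (Fin m → ℝ))) := fun S => by
    rw [image_snd_add, image_snd_add K', ← hproj, ← image_snd_add K, ← image_snd_add]
  have main := sum_powerset_integral_concaveConj_sub_nonneg_of_lipschitz T
    (φ := fiberSupport γ C) (k₀ := fiberSupport γ K) (k₁ := fiberSupport γ K')
    (L := fun i => fiberSupport γ (L i))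
    (hC ▸ strictConvexOn_norm_consOne) (convexOn_fiberSupport γ K) (convexOn_fiberSupport γ K')
    (fun i => convexOn_fiberSupport γ (L i)) (hC ▸ contDiff_norm_consOne)
    (add_nonneg (add_nonneg (hc0 K) (hc0 K')) hsum0)
    (hlip K (by linarith [hc0 K'])) (hlip K' (by linarith [hc0 K]))
    (fun i => hlip (L i) (by
      linarith [hc0 K, hc0 K', Finset.single_le_sum (f := fun i => c (L i))
        (fun i _ => hc0 (L i)) (Finset.mem_univ i)]))
    (fun p => ConvexBody.support_mono hsub _) hM
    (fun S => convex_image_snd (C + (K + ∑ j ∈ S, L j)))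
    (fun S => isCompact_image_snd (C + (K + ∑ j ∈ S, L j)))
    (fun S => hsupp K S ▸ hasConjDomain_fiberSupport γ (C + (K + ∑ j ∈ S, L j)))
  simp only [minkowskiIntegralSupport_eq_integral_concaveConj, hsupp, hdom]
  simp only [mul_sub, Finset.sum_sub_distrib] at main
  exact sub_nonneg.1 main

end Assembly

/-- Monotonicity of mixed fiber bodies: if `Δᵢ ⊆ Δ'ᵢ` and `v(Δᵢ) = v(Δ'ᵢ)` for all `i`,
where `v` is the projection to `ℝ^m`, then `MF(Δ₀,…,Δ_m) ⊆ MF(Δ'₀,…,Δ'_m)`. -/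
theorem mixed_fiber_body_monotone (l m : ℕ)
    (MF : (Fin (m + 1) → ConvexBody ((Fin l → ℝ) × (Fin m → ℝ))) → ConvexBody (Fin l → ℝ))
    (MF_symm : ∀ (Δ : Fin (m + 1) → ConvexBody ((Fin l → ℝ) × (Fin m → ℝ)))
      (σ : Equiv.Perm (Fin (m + 1))), MF (Δ ∘ σ) = MF Δ)
    (MF_add : ∀ (Δ : Fin (m + 1) → ConvexBody ((Fin l → ℝ) × (Fin m → ℝ))) (i : Fin (m + 1))
      (K K' : ConvexBody ((Fin l → ℝ) × (Fin m → ℝ))),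
      MF (Function.update Δ i (K + K'))
        = MF (Function.update Δ i K) + MF (Function.update Δ i K'))
    (MF_diag : ∀ (Δ : ConvexBody ((Fin l → ℝ) × (Fin m → ℝ))) (γ : (Fin l → ℝ) →ₗ[ℝ] ℝ),
      sSup ((fun x => γ x) '' ((MF fun _ => Δ) : Set (Fin l → ℝ)))
        = minkowskiIntegralSupport l m Δ γ)
    (Δ Δ' : Fin (m + 1) → ConvexBody ((Fin l → ℝ) × (Fin m → ℝ)))
    (hsub : ∀ i, (Δ i : Set ((Fin l → ℝ) × (Fin m → ℝ))) ⊆ (Δ' i : Set ((Fin l → ℝ) × (Fin m → ℝ))))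
    (hproj : ∀ i, Prod.snd '' (Δ i : Set ((Fin l → ℝ) × (Fin m → ℝ)))
      = Prod.snd '' (Δ' i : Set ((Fin l → ℝ) × (Fin m → ℝ)))) :
    (MF Δ : Set (Fin l → ℝ)) ⊆ (MF Δ' : Set (Fin l → ℝ)) := by
  refine ConvexBody.subset_of_support_le fun γ => ?_
  by_cases hγ : γ = 0
  · have h0 : ∀ K : ConvexBody (Fin l → ℝ), K.support γ = 0 := fun K => by
      obtain ⟨x, -, hx, -⟩ := K.exists_isGreatest_support γ
      rw [← hx, hγ, LinearMap.zero_apply]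
    rw [h0, h0]
  obtain ⟨C, hC⟩ := exists_fiberSupport_eq_norm_consOne (m := m) hγ
  obtain ⟨N, hN, hpol⟩ := exists_polarization_of_symmetric
    (V := ConvexBody ((Fin l → ℝ) × (Fin m → ℝ))) (m + 1)
  have hdiag : ∀ K, (MF fun _ => K).support γ = minkowskiIntegralSupport l m K γ :=
    fun K => MF_diag K γ
  have hval : ∀ x, N * (MF x).support γ = ∑ S : Finset (Fin (m + 1)),
      (-1 : ℝ) ^ (Finset.univ \ S).card
        * minkowskiIntegralSupport l m (C + ∑ j ∈ S, x j) γ := fun x => by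
    rw [← hpol (fun y => (MF y).support γ) (fun y σ => by rw [MF_symm])
      (fun y i K K' => by rw [MF_add, ConvexBody.support_add]) C x]
    simp only [hdiag]
  have hstep : ∀ (x : Fin (m + 1) → ConvexBody ((Fin l → ℝ) × (Fin m → ℝ))) i,
      (MF (Function.update x i (Δ i))).support γ
        ≤ (MF (Function.update x i (Δ' i))).support γ := by
    intro x i
    refine le_of_mul_le_mul_left ?_ hN
    rw [hval, hval,
      sum_neg_one_pow_mul_update (fun B => minkowskiIntegralSupport l m (C + B) γ) x i,
      sum_neg_one_pow_mul_update (fun B => minkowskiIntegralSupport l m (C + B) γ) x i]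
    exact add_le_add_right
      (sum_powerset_minkowskiIntegralSupport_le _ γ x hC (hsub i) (hproj i)) _
  have hall : ∀ s : Finset (Fin (m + 1)),
      (MF Δ).support γ ≤ (MF (s.piecewise Δ' Δ)).support γ := by
    intro s
    induction s using Finset.induction_on with
    | empty => rw [Finset.piecewise_empty]
    | insert j s hj ih =>
      have h1 := hstep (s.piecewise Δ' Δ) j
      rw [← Finset.piecewise_insert, ← Finset.piecewise_eq_of_notMem s Δ' Δ hj,
        Function.update_eq_self] at h1
      exact ih.trans h1
  simpa using hall Finset.univ
end

section
/- Let p : ℝ^n → ℝ^k be a surjective linear map. There exists a unique map MF^BS assigning to every (k+1)-tuple of convex bodies in ℝ^n a convex body in ℝ^n such that MF^BS is symmetric, Minkowski-multilinear, and for every convex body Δ ⊂ ℝ^n and every linear functional γ on ℝ^n, the support function of MF^BS(Δ, …, Δ) at γ equals ∫_{p(Δ)} (sup{γ(x) : x ∈ Δ, p(x) = a}) da (Lebesgue measure on ℝ^k); i.e. MF^BS(Δ, …, Δ) is the Billera–Sturmfels fiber body of Δ. (Billera–Sturmfels version of the existence and uniqueness of mixed fiber bodies.) -/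
open MeasureTheory

/-- The value at `γ` of the support function of the Billera–Sturmfels fiber body of `Δ ⊂ ℝ^n`
with respect to a surjective linear map `p : ℝ^n → ℝ^k`: the integral over `p(Δ)` of the
supremum of `γ` over the fibers (Lebesgue measure on `ℝ^k`). -/
noncomputable def bsFiberBodySupport (n k : ℕ) (p : (Fin n → ℝ) →ₗ[ℝ] (Fin k → ℝ))
    (Δ : ConvexBody (Fin n → ℝ)) (γ : (Fin n → ℝ) →ₗ[ℝ] ℝ) : ℝ :=
  ∫ a in p '' (Δ : Set (Fin n → ℝ)),
    sSup ((fun x => γ x) '' {x : Fin n → ℝ | x ∈ (Δ : Set (Fin n → ℝ)) ∧ p x = a})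

open Finset in
/-- The alternating sum over subsets computing the (unnormalised) polarization of `q`. -/
noncomputable def polarSum {ι X : Type*} [Fintype ι] [DecidableEq ι] [AddCommMonoid X]
    (q : X → ℝ) (x : ι → X) : ℝ :=
  ∑ S : Finset ι, (-1 : ℝ) ^ (#Sᶜ) * q (∑ i ∈ S, x i)

section Polarization

variable {ι X : Type*} [Fintype ι] [DecidableEq ι] [AddCommMonoid X]

open Finset in
theorem polarSum_diag_eq_sum_perm (m : MultilinearMap ℕ (fun _ : ι => X) ℝ) (x : ι → X) :
    polarSum (fun y => m fun _ => y) x = ∑ σ : Equiv.Perm ι, m (x ∘ σ) := by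
  have h1 : ∀ S : Finset ι, (m fun _ => ∑ i ∈ S, x i)
      = ∑ r : ι → ι, if univ.image r ⊆ S then m (x ∘ r) else 0 := by
    intro S
    rw [m.map_sum_finset (fun _ j => x j) (fun _ => S), ← Finset.sum_filter]
    refine Finset.sum_congr ?_ fun _ _ => rfl
    ext r
    simp [Finset.image_subset_iff]
  have h2 : ∀ r : ι → ι, (∑ S : Finset ι, if univ.image r ⊆ S then (-1 : ℝ) ^ (#Sᶜ) else 0)
      = if Function.Bijective r then 1 else 0 := by
    intro r
    have h3 := Finset.sum_powerset_neg_one_pow_card (x := (univ.image r)ᶜ)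
    have h4 : (∑ S : Finset ι, if univ.image r ⊆ S then (-1 : ℝ) ^ (#Sᶜ) else 0)
        = ∑ T ∈ ((univ.image r)ᶜ).powerset, (-1 : ℝ) ^ (#T) := by
      rw [← Finset.sum_filter]
      refine Finset.sum_bij' (fun S _ => Sᶜ) (fun T _ => Tᶜ) ?_ ?_ ?_ ?_ ?_
      · intro S hS
        simpa using hS
      · intro T hT
        simp only [mem_powerset] at hT
        simp only [mem_filter, mem_univ, true_and]
        exact Finset.subset_compl_comm.mp hT
      · simp
      · simp
      · simp
    rw [h4]
    have h5 : (∑ T ∈ ((univ.image r)ᶜ).powerset, (-1 : ℝ) ^ (#T))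
        = ((∑ T ∈ ((univ.image r)ᶜ).powerset, (-1 : ℤ) ^ (#T) : ℤ) : ℝ) := by push_cast; rfl
    rw [h5, h3]
    have h6 : (univ.image r)ᶜ = ∅ ↔ Function.Bijective r := by
      rw [Finset.compl_eq_empty_iff, Finset.eq_univ_iff_forall, ← Finite.surjective_iff_bijective]
      simp [Function.Surjective]
    simp [h6]
  calc polarSum (fun y => m fun _ => y) x
      = ∑ r : ι → ι, (∑ S : Finset ι, if univ.image r ⊆ S then (-1 : ℝ) ^ (#Sᶜ) else 0)
          * m (x ∘ r) := by
        unfold polarSum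
        simp_rw [h1, Finset.mul_sum, Finset.sum_mul]
        rw [Finset.sum_comm]
        refine Finset.sum_congr rfl fun r _ => Finset.sum_congr rfl fun S _ => ?_
        split_ifs <;> simp
    _ = ∑ r : ι → ι with Function.Bijective r, m (x ∘ r) := by
        simp_rw [h2, Finset.sum_filter]
        refine Finset.sum_congr rfl fun r _ => ?_
        split_ifs <;> simp
    _ = ∑ σ : Equiv.Perm ι, m (x ∘ σ) := by
        refine (Finset.sum_bij' (fun (σ : Equiv.Perm ι) _ => (σ : ι → ι))
          (fun r hr => Equiv.ofBijective r (by simpa using hr)) ?_ ?_ ?_ ?_ ?_).symm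
        · intro σ _
          simp
        · simp
        · intro σ _
          ext
          simp
        · intro r _
          ext
          simp
        · simp

/-- `q` is the restriction to the diagonal of a multiadditive form indexed by `ι`. -/
def IsDiagonal (ι : Type*) {X : Type*} [AddCommMonoid X] (q : X → ℝ) : Prop :=
  ∃ m : MultilinearMap ℕ (fun _ : ι => X) ℝ, ∀ x, q x = m fun _ => x

theorem IsDiagonal.polarSum_update_add {q : X → ℝ} (hq : IsDiagonal ι q) (x : ι → X) (i : ι)
    (a b : X) :
    polarSum q (Function.update x i (a + b))
      = polarSum q (Function.update x i a) + polarSum q (Function.update x i b) := by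
  obtain ⟨m, hm⟩ := hq
  obtain rfl : q = fun y => m fun _ => y := funext hm
  simp_rw [polarSum_diag_eq_sum_perm, ← Finset.sum_add_distrib]
  refine Finset.sum_congr rfl fun σ _ => ?_
  have h : ∀ c, Function.update x i c ∘ σ = Function.update (x ∘ σ) (σ.symm i) c := by
    intro c
    ext j
    simp [Function.update_apply, Equiv.eq_symm_apply]
  simp_rw [h]
  exact m.map_update_add _ _ _ _

theorem IsDiagonal.polarSum_const {q : X → ℝ} (hq : IsDiagonal ι q) (x : X) :
    polarSum q (fun _ : ι => x) = (Fintype.card ι).factorial * q x := by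
  obtain ⟨m, hm⟩ := hq
  obtain rfl : q = fun y => m fun _ => y := funext hm
  rw [polarSum_diag_eq_sum_perm]
  simp [Function.comp_def, Fintype.card_perm]

theorem polarSum_comp_perm (q : X → ℝ) (x : ι → X) (σ : Equiv.Perm ι) :
    polarSum q (x ∘ σ) = polarSum q x := by
  unfold polarSum
  refine Fintype.sum_equiv (Equiv.finsetCongr σ) _ _ fun S => ?_
  simp only [Equiv.finsetCongr_apply, Finset.sum_map, Finset.card_compl, Finset.card_map,
    Equiv.coe_toEmbedding, Function.comp_apply]

theorem polarSum_congr {q q' : X → ℝ} (h : ∀ x, q x = q' x) (x : ι → X) :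
    polarSum q x = polarSum q' x := by
  rw [funext h]

end Polarization

section Determinant

variable {ι X : Type*} [Fintype ι] [DecidableEq ι] [AddCommMonoid X]

theorem isDiagonal_det (A : X →+ Matrix ι ι ℝ) : IsDiagonal ι fun x => (A x).det := by
  refine ⟨((Matrix.detRowAlternating (n := ι) (R := ℝ)).toMultilinearMap.restrictScalars
    ℕ).compLinearMap (fun i => (LinearMap.proj i : (ι → ι → ℝ) →ₗ[ℕ] (ι → ℝ)) ∘ₗ
      (A.toNatLinearMap : X →ₗ[ℕ] (ι → ι → ℝ))), fun x => ?_⟩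
  rfl

theorem isDiagonal_mul_det {k : ℕ} (c : X →+ ℝ) (A : X →+ Matrix (Fin k) (Fin k) ℝ) :
    IsDiagonal (Fin (k + 1)) fun x => c x * (A x).det := by
  let B : X →+ Matrix (Fin (k + 1)) (Fin (k + 1)) ℝ :=
    { toFun := fun x => Matrix.of (Fin.cons (Fin.cons (c x) 0) fun i => Fin.cons 0 (A x i))
      map_zero' := by
        ext i j
        refine Fin.cases ?_ (fun i => ?_) i <;> refine Fin.cases ?_ (fun j => ?_) j <;> simp
      map_add' := fun x y => by
        ext i j
        refine Fin.cases ?_ (fun i => ?_) i <;> refine Fin.cases ?_ (fun j => ?_) j <;> simp }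
  obtain ⟨m, hm⟩ := isDiagonal_det B
  refine ⟨m, fun x => ?_⟩
  rw [← hm]
  simp only [Matrix.det_succ_row_zero (B x), Fin.sum_univ_succ]
  have h : (B x).submatrix Fin.succ (Fin.succAbove 0) = A x := by
    ext i j
    simp [B]
  simp only [h]
  simp [B]

/-- The polarization of the determinant is nonnegative on positive semidefinite matrices. -/
theorem polarSum_det_nonneg (A : ι → Matrix ι ι ℝ) (hA : ∀ i, (A i).PosSemidef) :
    0 ≤ polarSum Matrix.det A := by
  obtain ⟨m, hm⟩ := isDiagonal_det (AddMonoidHom.id (Matrix ι ι ℝ))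
  have hm' : ∀ B : Matrix ι ι ℝ, B.det = m fun _ => B := hm
  have hrank : ∀ v : ι → ι → ℝ,
      polarSum Matrix.det (fun i => Matrix.vecMulVec (v i) (v i)) = (Matrix.of v).det ^ 2 := by
    intro v
    have hS : ∀ S : Finset ι, (∑ i ∈ S, Matrix.vecMulVec (v i) (v i))
        = (Matrix.of v).transpose * Matrix.diagonal (fun i => if i ∈ S then 1 else 0) * Matrix.of v := by
      intro S
      ext a b
      simp [Matrix.mul_apply, Matrix.sum_apply, Matrix.vecMulVec_apply, Matrix.diagonal_apply,
        Finset.sum_ite_mem]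
    unfold polarSum
    rw [Finset.sum_eq_single Finset.univ]
    · simp only [hS, Matrix.det_mul, Matrix.det_transpose, Matrix.det_diagonal]
      simp
      ring
    · intro S _ hne
      obtain ⟨i, hi⟩ : ∃ i, i ∉ S := by
        by_contra! h
        exact hne (Finset.eq_univ_iff_forall.mpr h)
      rw [hS]
      simp only [Matrix.det_mul, Matrix.det_diagonal]
      rw [Finset.prod_eq_zero (Finset.mem_univ i) (by simp [hi])]
      simp
    · simp
  have key : polarSum Matrix.det A = ∑ σ : Equiv.Perm ι, m (A ∘ σ) := by
    rw [← polarSum_diag_eq_sum_perm]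
    exact polarSum_congr hm' A
  have hex : ∀ i, ∃ (l : ℕ) (v : Fin l → ι → ℝ),
      A i = ∑ j, Matrix.vecMulVec (v j) (star (v j)) := fun i => by
    obtain ⟨l, v, h⟩ := Matrix.posSemidef_iff_eq_sum_vecMulVec.mp (hA i)
    exact ⟨l, v, h⟩
  choose l v hv using hex
  let w : (i : ι) → Fin (l i) → Matrix ι ι ℝ := fun i j => Matrix.vecMulVec (v i j) (v i j)
  have hA' : ∀ i, A i = ∑ j, w i j := fun i => by rw [hv i]; simp [w]
  have hσ : ∀ σ : Equiv.Perm ι, m (A ∘ σ)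
      = ∑ r : (i : ι) → Fin (l i), m ((fun i => w i (r i)) ∘ σ) := by
    intro σ
    have h := (m.domDomCongr σ).map_sum w
    simp only [MultilinearMap.domDomCongr_apply, ← hA'] at h
    exact h
  rw [key]
  simp_rw [hσ]
  rw [Finset.sum_comm]
  refine Finset.sum_nonneg fun r _ => ?_
  rw [← polarSum_diag_eq_sum_perm, polarSum_congr fun x => (hm' x).symm, hrank]
  positivity

end Determinant

section ConvexGradient

variable {ι : Type*} [Fintype ι] [DecidableEq ι]

/-- The gradient of a function on `ι → ℝ` in coordinates. -/
noncomputable def coordGrad (F : (ι → ℝ) → ℝ) (x : ι → ℝ) : ι → ℝ :=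
  fun i => fderiv ℝ F x (Pi.single i 1)

/-- The Hessian matrix of a function on `ι → ℝ`. -/
noncomputable def coordHess (F : (ι → ℝ) → ℝ) (x : ι → ℝ) : Matrix ι ι ℝ :=
  Matrix.of fun i j => fderiv ℝ (coordGrad F) x (Pi.single j 1) i

theorem fderiv_eq_coordGrad_dotProduct (F : (ι → ℝ) → ℝ) (x v : ι → ℝ) :
    fderiv ℝ F x v = coordGrad F x ⬝ᵥ v := by
  conv_lhs => rw [← Finset.univ_sum_single v]
  rw [map_sum, dotProduct]
  refine Finset.sum_congr rfl fun i _ => ?_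
  rw [coordGrad, mul_comm, ← smul_eq_mul, ← map_smul, ← Pi.single_smul, smul_eq_mul, mul_one]

theorem fderiv_coordGrad_eq_mulVec (F : (ι → ℝ) → ℝ) (x v : ι → ℝ) :
    fderiv ℝ (coordGrad F) x v = (coordHess F x).mulVec v := by
  conv_lhs => rw [← Finset.univ_sum_single v]
  rw [map_sum]
  ext i
  rw [Finset.sum_apply, Matrix.mulVec, dotProduct]
  refine Finset.sum_congr rfl fun j _ => ?_
  have h : (Pi.single j (v j) : ι → ℝ) = v j • Pi.single j (1 : ℝ) := by
    rw [← Pi.single_smul, smul_eq_mul, mul_one]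
  rw [h, map_smul, Pi.smul_apply, smul_eq_mul, mul_comm, coordHess, Matrix.of_apply]

theorem det_fderiv_coordGrad (F : (ι → ℝ) → ℝ) (x : ι → ℝ) :
    (fderiv ℝ (coordGrad F) x).det = (coordHess F x).det := by
  have h : ((fderiv ℝ (coordGrad F) x : (ι → ℝ) →L[ℝ] (ι → ℝ)) : (ι → ℝ) →ₗ[ℝ] (ι → ℝ))
      = Matrix.toLin' (coordHess F x) := by
    ext1 i
    ext1
    simp [fderiv_coordGrad_eq_mulVec]
  rw [ContinuousLinearMap.det, h, LinearMap.det_toLin']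

variable {F : (ι → ℝ) → ℝ}

theorem contDiff_coordGrad (hF : ContDiff ℝ 2 F) : ContDiff ℝ 1 (coordGrad F) := by
  refine contDiff_pi.mpr fun i => ?_
  exact (hF.fderiv_right (m := 1) (by norm_num)).clm_apply contDiff_const

theorem hasDerivAt_comp_line (hF : Differentiable ℝ F) (x v : ι → ℝ) (t : ℝ) :
    HasDerivAt (fun s : ℝ => F (x + s • v)) (coordGrad F (x + t • v) ⬝ᵥ v) t := by
  have h1 : HasDerivAt (fun s : ℝ => x + s • v) v t := by
    simpa using ((hasDerivAt_id t).smul_const v).const_add x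
  have h2 := (hF (x + t • v)).hasFDerivAt.comp_hasDerivAt t h1
  rwa [fderiv_eq_coordGrad_dotProduct] at h2

omit [Fintype ι] [DecidableEq ι] in
theorem ConvexOn.comp_line (hc : ConvexOn ℝ Set.univ F) (x v : ι → ℝ) :
    ConvexOn ℝ Set.univ (fun s : ℝ => F (x + s • v)) := by
  refine ⟨convex_univ, fun s _ t _ a b ha hb hab => ?_⟩
  have h := hc.2 (Set.mem_univ (x + s • v)) (Set.mem_univ (x + t • v)) ha hb hab
  convert h using 2
  calc x + (a • s + b • t) • v = (a + b) • x + (a • s + b • t) • v := by rw [hab, one_smul]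
    _ = _ := by module

theorem ConvexOn.add_coordGrad_le (hc : ConvexOn ℝ Set.univ F) (hF : Differentiable ℝ F)
    (x y : ι → ℝ) : F x + coordGrad F x ⬝ᵥ (y - x) ≤ F y := by
  have h1 := (hc.comp_line x (y - x)).le_slope_of_hasDerivAt (Set.mem_univ 0) (Set.mem_univ 1)
    one_pos (hasDerivAt_comp_line hF x (y - x) 0)
  simp [slope_def_field] at h1
  rw [dotProduct_sub]
  linarith

theorem ConvexOn.coordGrad_monotone (hc : ConvexOn ℝ Set.univ F) (hF : Differentiable ℝ F)
    (x y : ι → ℝ) : coordGrad F x ⬝ᵥ (y - x) ≤ coordGrad F y ⬝ᵥ (y - x) := by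
  have h1 := hc.add_coordGrad_le hF x y
  have h2 := hc.add_coordGrad_le hF y x
  rw [← neg_sub y x, dotProduct_neg] at h2
  linarith

theorem hasDerivAt_coordGrad_line (hF : ContDiff ℝ 2 F) (x v : ι → ℝ) :
    HasDerivAt (fun s : ℝ => coordGrad F (x + s • v) ⬝ᵥ v)
      (v ⬝ᵥ (coordHess F x).mulVec v) 0 := by
  have h1 : HasDerivAt (fun s : ℝ => x + s • v) v 0 := by
    simpa using ((hasDerivAt_id (0 : ℝ)).smul_const v).const_add x
  have h3 : DifferentiableAt ℝ (coordGrad F) (x + (0 : ℝ) • v) :=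
    (contDiff_coordGrad hF).differentiable one_ne_zero _
  have h2 := h3.hasFDerivAt.comp_hasDerivAt (0 : ℝ) h1
  rw [fderiv_coordGrad_eq_mulVec, zero_smul, add_zero] at h2
  have h4 := fun i => (hasDerivAt_pi.mp h2 i).mul_const (v i)
  have h5 := HasDerivAt.fun_sum (u := Finset.univ) fun i _ => h4 i
  rw [dotProduct_comm]
  exact h5

theorem ConvexOn.posSemidef_coordHess (hc : ConvexOn ℝ Set.univ F) (hF : ContDiff ℝ 2 F)
    (x : ι → ℝ) : (coordHess F x).PosSemidef := by
  have hd : Differentiable ℝ F := hF.differentiable (by norm_num)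
  have hd2 : Differentiable ℝ (fderiv ℝ F) :=
    (hF.fderiv_right (m := 1) (by norm_num)).differentiable one_ne_zero
  have hentry : ∀ i j, coordHess F x i j
      = fderiv ℝ (fderiv ℝ F) x (Pi.single j 1) (Pi.single i 1) := by
    intro i j
    rw [coordHess, Matrix.of_apply]
    have h1 : HasFDerivAt (coordGrad F) (ContinuousLinearMap.pi fun i =>
        (fderiv ℝ (fderiv ℝ F) x).flip (Pi.single i 1)) x := by
      refine hasFDerivAt_pi.mpr fun i => ?_
      have := (hd2 x).hasFDerivAt.clm_apply (hasFDerivAt_const (Pi.single i (1 : ℝ)) x)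
      rw [ContinuousLinearMap.comp_zero, zero_add] at this
      exact this
    rw [h1.fderiv]
    rfl
  have hsymm : IsSymmSndFDerivAt ℝ F x :=
    hF.contDiffAt.isSymmSndFDerivAt (by simp)
  refine Matrix.PosSemidef.of_dotProduct_mulVec_nonneg ?_ fun v => ?_
  · ext i j
    simp only [Matrix.conjTranspose_apply, star_trivial, hentry]
    exact hsymm _ _
  · simp only [star_trivial]
    refine ge_of_tendsto ((hasDerivWithinAt_iff_tendsto_slope' Set.self_notMem_Ioi).mp
      ((hasDerivAt_coordGrad_line hF x v).hasDerivWithinAt (s := Set.Ioi 0))) ?_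
    filter_upwards [self_mem_nhdsWithin] with s hs
    have hs' : (0 : ℝ) < s := hs
    have h := hc.coordGrad_monotone hd x (x + s • v)
    simp only [add_sub_cancel_left, dotProduct_smul, smul_eq_mul] at h
    have h' := le_of_mul_le_mul_left h hs'
    rw [slope_def_field]
    simp only [zero_smul, add_zero, sub_zero]
    exact div_nonneg (by linarith) hs'.le

theorem ConvexOn.injOn_coordGrad (hc : ConvexOn ℝ Set.univ F) (hF : ContDiff ℝ 2 F) :
    Set.InjOn (coordGrad F) {x | (coordHess F x).det ≠ 0} := by
  intro x hx y _ hxy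
  by_contra hne
  have hd : Differentiable ℝ F := hF.differentiable (by norm_num)
  set v := y - x with hv
  have hconst : ∀ s ∈ Set.Ioo (0 : ℝ) 1,
      coordGrad F (x + s • v) ⬝ᵥ v = coordGrad F x ⬝ᵥ v := by
    intro s hs
    have h1 := hc.coordGrad_monotone hd x (x + s • v)
    have h2 := hc.coordGrad_monotone hd (x + s • v) y
    have h3 : y - (x + s • v) = (1 - s) • v := by rw [hv]; module
    rw [h3] at h2
    simp only [add_sub_cancel_left, dotProduct_smul, smul_eq_mul] at h1 h2
    have h1' := le_of_mul_le_mul_left h1 hs.1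
    have h2' := le_of_mul_le_mul_left h2 (by linarith [hs.2] : (0 : ℝ) < 1 - s)
    rw [← hxy] at h2'
    linarith
  have hzero : v ⬝ᵥ (coordHess F x).mulVec v = 0 := by
    have h1 := (hasDerivWithinAt_iff_tendsto_slope' Set.self_notMem_Ioi).mp
      ((hasDerivAt_coordGrad_line hF x v).hasDerivWithinAt (s := Set.Ioi 0))
    refine tendsto_nhds_unique h1 (tendsto_const_nhds.congr' ?_)
    filter_upwards [Ioo_mem_nhdsGT (zero_lt_one' ℝ)] with s hs
    rw [slope_def_field, hconst s hs]
    simp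
  have h0 := ((hc.posSemidef_coordHess hF x).dotProduct_mulVec_zero_iff v).mp (by simpa using hzero)
  apply hx
  exact Matrix.exists_mulVec_eq_zero_iff.mp ⟨v, sub_ne_zero.mpr (Ne.symm hne), h0⟩

theorem coordGrad_image_ae_eq (hF : ContDiff ℝ 2 F) (W : Set (ι → ℝ)) :
    coordGrad F '' (W ∩ {x | (coordHess F x).det ≠ 0}) =ᵐ[volume] coordGrad F '' W := by
  refine (Filter.EventuallyLE.antisymm ?_ ?_)
  · exact (Set.image_mono Set.inter_subset_left).eventuallyLE
  · rw [ae_le_set]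
    refine measure_mono_null ?_ (addHaar_image_eq_zero_of_det_fderivWithin_eq_zero volume
      (s := {x | (coordHess F x).det = 0})
      (fun x _ => ((contDiff_coordGrad hF).differentiable one_ne_zero
        x).hasFDerivAt.hasFDerivWithinAt) fun x hx => ?_)
    · rintro _ ⟨⟨x, hx, rfl⟩, hx'⟩
      refine ⟨x, ?_, rfl⟩
      by_contra hne
      exact hx' ⟨x, ⟨hx, hne⟩, rfl⟩
    · rw [det_fderiv_coordGrad]
      exact hx

theorem continuous_coordHess (hF : ContDiff ℝ 2 F) : Continuous (coordHess F) := by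
  have h := (contDiff_coordGrad hF).continuous_fderiv one_ne_zero
  refine continuous_matrix fun i j => ?_
  simp only [coordHess, Matrix.of_apply]
  fun_prop

theorem measurableSet_det_coordHess_ne_zero (hF : ContDiff ℝ 2 F) :
    MeasurableSet {x | (coordHess F x).det ≠ 0} :=
  (isOpen_ne_fun (continuous_coordHess hF).matrix_det continuous_const).measurableSet

theorem ConvexOn.integrableOn_coordGrad_image_iff (hc : ConvexOn ℝ Set.univ F)
    (hF : ContDiff ℝ 2 F) {W : Set (ι → ℝ)} (hW : MeasurableSet W) (ψ : (ι → ℝ) → ℝ) :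
    IntegrableOn ψ (coordGrad F '' W)
      ↔ IntegrableOn (fun x => (coordHess F x).det * ψ (coordGrad F x)) W := by
  have hm := hW.inter (measurableSet_det_coordHess_ne_zero hF)
  rw [← integrableOn_congr_set_ae (coordGrad_image_ae_eq hF W),
    integrableOn_image_iff_integrableOn_abs_det_fderiv_smul volume hm
    (fun x _ => ((contDiff_coordGrad hF).differentiable one_ne_zero
        x).hasFDerivAt.hasFDerivWithinAt)
    ((hc.injOn_coordGrad hF).mono Set.inter_subset_right)]
  simp_rw [det_fderiv_coordGrad, abs_of_nonneg (hc.posSemidef_coordHess hF _).det_nonneg,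
    smul_eq_mul]
  refine ⟨fun h => h.of_forall_sdiff_eq_zero hW ?_, fun h => h.mono_set Set.inter_subset_left⟩
  rintro x ⟨hx, hx'⟩
  have : (coordHess F x).det = 0 := by
    by_contra hne
    exact hx' ⟨hx, hne⟩
  simp [this]

theorem ConvexOn.setIntegral_coordGrad_image (hc : ConvexOn ℝ Set.univ F)
    (hF : ContDiff ℝ 2 F) {W : Set (ι → ℝ)} (hW : MeasurableSet W) (ψ : (ι → ℝ) → ℝ) :
    ∫ a in coordGrad F '' W, ψ a = ∫ x in W, (coordHess F x).det * ψ (coordGrad F x) := by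
  have hm := hW.inter (measurableSet_det_coordHess_ne_zero hF)
  rw [← setIntegral_congr_set (coordGrad_image_ae_eq hF W),
    integral_image_eq_integral_abs_det_fderiv_smul volume hm
    (fun x _ => ((contDiff_coordGrad hF).differentiable one_ne_zero
        x).hasFDerivAt.hasFDerivWithinAt)
    ((hc.injOn_coordGrad hF).mono Set.inter_subset_right)]
  simp_rw [det_fderiv_coordGrad, abs_of_nonneg (hc.posSemidef_coordHess hF _).det_nonneg,
    smul_eq_mul]
  refine (setIntegral_eq_of_subset_of_forall_sdiff_eq_zero hW Set.inter_subset_left ?_).symm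
  rintro x ⟨hx, hx'⟩
  have : (coordHess F x).det = 0 := by
    by_contra hne
    exact hx' ⟨hx, hne⟩
  simp [this]

theorem coordGrad_add {G : (ι → ℝ) → ℝ} (hF : Differentiable ℝ F) (hG : Differentiable ℝ G) :
    coordGrad (F + G) = coordGrad F + coordGrad G := by
  ext x i
  simp [coordGrad, fderiv_add (hF x) (hG x)]

theorem coordHess_add {G : (ι → ℝ) → ℝ} (hF : ContDiff ℝ 2 F) (hG : ContDiff ℝ 2 G)
    (x : ι → ℝ) : coordHess (F + G) x = coordHess F x + coordHess G x := by
  ext i j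
  have h1 := (contDiff_coordGrad hF).differentiable one_ne_zero
  have h2 := (contDiff_coordGrad hG).differentiable one_ne_zero
  simp [coordHess, coordGrad_add (hF.differentiable (by norm_num))
    (hG.differentiable (by norm_num)), fderiv_add (h1 x) (h2 x)]

end ConvexGradient

section LegendreTransform

variable {ι : Type*} [Fintype ι]

/-- `F` stays within bounded distance of the support function of `P`. -/
def NearSupport (P : Set (ι → ℝ)) (F : (ι → ℝ) → ℝ) : Prop :=
  ∃ C, (∀ u, ∀ a ∈ P, u ⬝ᵥ a - C ≤ F u) ∧ ∀ u, ∃ a ∈ P, F u ≤ u ⬝ᵥ a + C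

/-- The concave conjugate of `F`. -/
noncomputable def legendreInf (F : (ι → ℝ) → ℝ) (a : ι → ℝ) : ℝ := ⨅ u, (F u - u ⬝ᵥ a)

theorem LinearMap.apply_eq_dotProduct [DecidableEq ι] (f : (ι → ℝ) →ₗ[ℝ] ℝ) (x : ι → ℝ) :
    f x = (fun i => f (Pi.single i 1)) ⬝ᵥ x := by
  conv_lhs => rw [← Finset.univ_sum_single x]
  rw [map_sum, dotProduct]
  refine Finset.sum_congr rfl fun i _ => ?_
  rw [mul_comm, ← smul_eq_mul, ← map_smul, ← Pi.single_smul, smul_eq_mul, mul_one]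

theorem continuous_dotProduct_left (a : ι → ℝ) : Continuous fun u : ι → ℝ => u ⬝ᵥ a :=
  continuous_finsetSum _ fun i _ => (continuous_apply i).mul continuous_const

theorem continuous_dotProduct_right (a : ι → ℝ) : Continuous fun u : ι → ℝ => a ⬝ᵥ u :=
  continuous_finsetSum _ fun i _ => continuous_const.mul (continuous_apply i)

variable {P : Set (ι → ℝ)} {F : (ι → ℝ) → ℝ}

theorem NearSupport.bddBelow (h : NearSupport P F) {a : ι → ℝ} (ha : a ∈ P) :
    BddBelow (Set.range fun u => F u - u ⬝ᵥ a) := by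
  obtain ⟨C, h1, _⟩ := h
  refine ⟨-C, ?_⟩
  rintro _ ⟨u, rfl⟩
  have := h1 u a ha
  simp only
  linarith

theorem NearSupport.exists_forall_le [DecidableEq ι] (h : NearSupport P F) (hF : Continuous F)
    {a : ι → ℝ} (ha : a ∈ interior P) : ∃ u, ∀ v, F u - u ⬝ᵥ a ≤ F v - v ⬝ᵥ a := by
  obtain ⟨C, h1, _⟩ := h
  obtain ⟨r, hr, hball⟩ := Metric.mem_nhds_iff.mp (mem_interior_iff_mem_nhds.mp ha)
  have hP : ∀ i, ∀ s : ℝ, |s| < r → a + Pi.single i s ∈ P := by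
    intro i s hs
    apply hball
    rw [mem_ball_iff_norm, add_sub_cancel_left, Pi.norm_single]
    exact hs
  have hbound : ∀ u, r / 2 * ‖u‖ - C ≤ F u - u ⬝ᵥ a := by
    intro u
    have h0 := h1 u a (interior_subset ha)
    have : ‖u‖ ≤ 2 / r * (F u - u ⬝ᵥ a + C) := by
      refine (pi_norm_le_iff_of_nonneg (by have : 0 ≤ F u - u ⬝ᵥ a + C := by linarith
                                           positivity)).mpr fun i => ?_
      have h2 := h1 u _ (hP i (r / 2) (by rw [abs_of_pos (by linarith)]; linarith))
      have h3 := h1 u _ (hP i (-(r / 2)) (by rw [abs_neg, abs_of_pos (by linarith)]; linarith))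
      rw [dotProduct_add, dotProduct_single] at h2 h3
      rw [Real.norm_eq_abs, div_mul_eq_mul_div, le_div_iff₀ hr]
      rcases abs_cases (u i) with ⟨h4, _⟩ | ⟨h4, _⟩ <;> rw [h4] <;> nlinarith
    rw [div_mul_eq_mul_div, le_div_iff₀ hr] at this
    linarith
  refine (hF.sub (continuous_dotProduct_left a)).exists_forall_le ?_
  refine Filter.tendsto_atTop_mono hbound ?_
  exact Filter.tendsto_atTop_add_const_right _ _
    ((tendsto_norm_cocompact_atTop).const_mul_atTop (by positivity))

theorem legendreInf_concaveOn (hP : Convex ℝ P)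
    (hb : ∀ a ∈ P, BddBelow (Set.range fun u => F u - u ⬝ᵥ a)) :
    ConcaveOn ℝ P (legendreInf F) := by
  refine ⟨hP, fun a ha b hb' s t hs ht hst => ?_⟩
  refine le_ciInf fun u => ?_
  have h1 := mul_le_mul_of_nonneg_left (ciInf_le (hb a ha) u) hs
  have h2 := mul_le_mul_of_nonneg_left (ciInf_le (hb b hb') u) ht
  simp only [smul_eq_mul, legendreInf]
  rw [dotProduct_add, dotProduct_smul, dotProduct_smul, smul_eq_mul, smul_eq_mul]
  have h3 : F u = s * F u + t * F u := by rw [← add_mul, hst, one_mul]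
  linarith

theorem NearSupport.legendreInf_bound (h : NearSupport P F) :
    ∃ B, ∀ a ∈ P, |legendreInf F a| ≤ B := by
  obtain ⟨C, h1, h2⟩ := id h
  refine ⟨max C (F 0), fun a ha => abs_le.mpr ⟨?_, ?_⟩⟩
  · refine (neg_le_neg (le_max_left _ _)).trans (le_ciInf fun u => ?_)
    have := h1 u a ha
    linarith
  · refine (ciInf_le (h.bddBelow ha) 0).trans ?_
    rw [zero_dotProduct, sub_zero]
    exact le_max_right _ _

theorem abs_legendreInf_sub_le {F H : (ι → ℝ) → ℝ} {a : ι → ℝ} {ε : ℝ}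
    (hF : BddBelow (Set.range fun u => F u - u ⬝ᵥ a))
    (hH : BddBelow (Set.range fun u => H u - u ⬝ᵥ a)) (hFH : ∀ u, |F u - H u| ≤ ε) :
    |legendreInf F a - legendreInf H a| ≤ ε := by
  rw [abs_sub_le_iff]
  constructor
  · rw [sub_le_comm]
    refine le_ciInf fun u => ?_
    have h1 := ciInf_le hF u
    have h2 := (abs_sub_le_iff.mp (hFH u)).1
    simp only [legendreInf]
    linarith
  · rw [sub_le_comm]
    refine le_ciInf fun u => ?_
    have h1 := ciInf_le hH u
    have h2 := (abs_sub_le_iff.mp (hFH u)).2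
    simp only [legendreInf]
    linarith

theorem legendreInf_eq_of_forall_le {a u : ι → ℝ}
    (hu : ∀ v, F u - u ⬝ᵥ a ≤ F v - v ⬝ᵥ a) : legendreInf F a = F u - u ⬝ᵥ a := by
  refine le_antisymm (ciInf_le ⟨F u - u ⬝ᵥ a, ?_⟩ u) (le_ciInf hu)
  rintro _ ⟨v, rfl⟩
  exact hu v

theorem Convex.interior_ae_eq (hP : Convex ℝ P) (hPc : IsClosed P) :
    interior P =ᵐ[volume] P := by
  refine interior_subset.eventuallyLE.antisymm ?_
  rw [ae_le_set, ← hPc.frontier_eq]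
  exact hP.addHaar_frontier volume

theorem ConcaveOn.integrableOn_of_bounded {f : (ι → ℝ) → ℝ} (hf : ConcaveOn ℝ P f)
    (hPc : IsCompact P) {B : ℝ} (hB : ∀ a ∈ P, |f a| ≤ B) : IntegrableOn f P := by
  rw [← integrableOn_congr_set_ae (hf.1.interior_ae_eq hPc.isClosed)]
  have hfin : volume (interior P) < ⊤ := (measure_mono interior_subset).trans_lt hPc.measure_lt_top
  have : IsFiniteMeasure (volume.restrict (interior P)) := ⟨by simpa using hfin⟩
  refine Integrable.of_bound
    (hf.continuousOn_interior.aestronglyMeasurable isOpen_interior.measurableSet) B ?_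
  · filter_upwards [ae_restrict_mem isOpen_interior.measurableSet] with a ha
    exact hB a (interior_subset ha)

variable [DecidableEq ι]

theorem coordGrad_eq_of_forall_le (hF : Differentiable ℝ F) {a u : ι → ℝ}
    (hu : ∀ v, F u - u ⬝ᵥ a ≤ F v - v ⬝ᵥ a) : coordGrad F u = a := by
  ext i
  have h1 := hasDerivAt_comp_line hF u (Pi.single i 1) 0
  have h2 : HasDerivAt (fun s : ℝ => (u + s • Pi.single i (1 : ℝ)) ⬝ᵥ a) (a i) 0 := by
    have : (fun s : ℝ => (u + s • Pi.single i (1 : ℝ)) ⬝ᵥ a) = fun s => u ⬝ᵥ a + s * a i := by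
      ext s
      rw [add_dotProduct, smul_dotProduct, single_dotProduct, one_mul, smul_eq_mul]
    rw [this]
    simpa using ((hasDerivAt_id (0 : ℝ)).mul_const (a i)).const_add (u ⬝ᵥ a)
  have h3 : IsLocalMin (fun s : ℝ => F (u + s • Pi.single i (1 : ℝ))
      - (u + s • Pi.single i (1 : ℝ)) ⬝ᵥ a) 0 := by
    refine Filter.Eventually.of_forall fun s => ?_
    simpa only [zero_smul, add_zero] using hu (u + s • Pi.single i (1 : ℝ))
  have h4 := h3.hasDerivAt_eq_zero (h1.sub h2)
  rw [zero_smul, add_zero, dotProduct_single, mul_one] at h4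
  linarith

theorem ConvexOn.sub_dotProduct_coordGrad_le (hc : ConvexOn ℝ Set.univ F)
    (hF : Differentiable ℝ F) (u v : ι → ℝ) :
    F u - u ⬝ᵥ coordGrad F u ≤ F v - v ⬝ᵥ coordGrad F u := by
  have h := hc.add_coordGrad_le hF u v
  rw [dotProduct_sub, dotProduct_comm, dotProduct_comm _ u] at h
  linarith

theorem NearSupport.coordGrad_mem (h : NearSupport P F) (hc : ConvexOn ℝ Set.univ F)
    (hF : Differentiable ℝ F) (hP : Convex ℝ P) (hPc : IsCompact P) (u : ι → ℝ) :
    coordGrad F u ∈ P := by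
  by_contra hu
  obtain ⟨f, s, hf1, hf2⟩ := geometric_hahn_banach_closed_point hP hPc.isClosed hu
  obtain ⟨C, _, h2⟩ := h
  obtain ⟨B, hB⟩ := (hPc.image (continuous_dotProduct_right u)).bddAbove
  set v : ι → ℝ := fun i => f (Pi.single i 1) with hv
  have hfv : ∀ x, f x = v ⬝ᵥ x := fun x => LinearMap.apply_eq_dotProduct (f : (ι → ℝ) →ₗ[ℝ] ℝ) x
  set δ := coordGrad F u ⬝ᵥ v - s with hδ
  have hδ0 : 0 < δ := by rw [hδ, dotProduct_comm, ← hfv]; linarith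
  have key : ∀ r : ℝ, 0 ≤ r → r * δ ≤ B + C - F u := by
    intro r hr
    have h3 := hc.add_coordGrad_le hF u (u + r • v)
    obtain ⟨a, ha, h4⟩ := h2 (u + r • v)
    have h5 : u ⬝ᵥ a ≤ B := hB ⟨a, ha, rfl⟩
    have h6 := mul_le_mul_of_nonneg_left (hf1 a ha).le hr
    rw [hfv] at h6
    rw [add_sub_cancel_left, dotProduct_smul, smul_eq_mul] at h3
    rw [add_dotProduct, smul_dotProduct, smul_eq_mul] at h4
    rw [hδ, mul_sub]
    linarith
  have h7 := key ((|B + C - F u| + 1) / δ) (by positivity)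
  rw [div_mul_cancel₀ _ hδ0.ne'] at h7
  linarith [le_abs_self (B + C - F u)]

theorem NearSupport.interior_subset_range_coordGrad (h : NearSupport P F)
    (hF : Differentiable ℝ F) : interior P ⊆ coordGrad F '' Set.univ := by
  intro a ha
  obtain ⟨u, hu⟩ := h.exists_forall_le hF.continuous ha
  exact ⟨u, trivial, coordGrad_eq_of_forall_le hF hu⟩

theorem NearSupport.integral_legendreInf (h : NearSupport P F) (hc : ConvexOn ℝ Set.univ F)
    (hF : ContDiff ℝ 2 F) (hP : Convex ℝ P) (hPc : IsCompact P) :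
    Integrable (fun u => (F u - u ⬝ᵥ coordGrad F u) * (coordHess F u).det) ∧
    ∫ a in P, legendreInf F a
      = ∫ u, (F u - u ⬝ᵥ coordGrad F u) * (coordHess F u).det := by
  have hd : Differentiable ℝ F := hF.differentiable (by norm_num)
  have hae : P =ᵐ[volume] coordGrad F '' Set.univ := by
    refine Filter.EventuallyLE.antisymm ?_ ?_
    · exact (hP.interior_ae_eq hPc.isClosed).symm.le.trans
        (h.interior_subset_range_coordGrad hd).eventuallyLE
    · exact (Set.image_subset_iff.mpr fun u _ =>
        h.coordGrad_mem hc hd hP hPc u : coordGrad F '' Set.univ ⊆ P).eventuallyLE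
  have heq : ∀ u, (F u - u ⬝ᵥ coordGrad F u) * (coordHess F u).det
      = (coordHess F u).det * legendreInf F (coordGrad F u) := by
    intro u
    rw [legendreInf_eq_of_forall_le (hc.sub_dotProduct_coordGrad_le hd u), mul_comm]
  simp_rw [heq]
  constructor
  · rw [← integrableOn_univ, ← hc.integrableOn_coordGrad_image_iff hF MeasurableSet.univ,
      ← integrableOn_congr_set_ae hae]
    obtain ⟨B, hB⟩ := h.legendreInf_bound
    exact (legendreInf_concaveOn hP fun a ha => h.bddBelow ha).integrableOn_of_bounded hPc hB
  · rw [setIntegral_congr_set hae, hc.setIntegral_coordGrad_image hF MeasurableSet.univ,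
      setIntegral_univ]

end LegendreTransform

section SlicedConjugate

open Matrix (vecCons vecTail)

variable {k : ℕ}

/-- A `C²` convex function of `(t, u) ∈ ℝ × ℝ^k` which is Lipschitz in `t` and whose slices at
fixed `t` are close to the support function of `P`. -/
structure IsSlicedNearSupport (P : Set (Fin k → ℝ)) (G : (Fin (k + 1) → ℝ) → ℝ) : Prop where
  contDiff : ContDiff ℝ 2 G
  convexOn : ConvexOn ℝ Set.univ G
  nearSupport : ∀ t, NearSupport P fun u => G (vecCons t u)
  lipschitz : ∃ L : NNReal, ∀ t t' u, |G (vecCons t u) - G (vecCons t' u)| ≤ L * |t - t'|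

/-- The concave conjugate of the slice of `G` at height `t`. -/
noncomputable def sliceConj (G : (Fin (k + 1) → ℝ) → ℝ) (t : ℝ) (a : Fin k → ℝ) : ℝ :=
  legendreInf (fun u => G (vecCons t u)) a

theorem contDiff_vecCons (t : ℝ) : ContDiff ℝ 2 fun u : Fin k → ℝ => vecCons t u := by
  refine contDiff_pi.mpr fun i => ?_
  refine Fin.cases ?_ (fun j => ?_) i
  · simp only [Matrix.cons_val_zero]
    exact contDiff_const
  · simp only [Matrix.cons_val_succ]
    exact contDiff_apply ℝ ℝ j

theorem vecCons_add_smul_vecCons_zero (t s : ℝ) (u : Fin k → ℝ) :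
    vecCons t u + s • vecCons 1 (0 : Fin k → ℝ) = vecCons (t + s) u := by
  simp

theorem vecCons_combo (t t' : ℝ) (u u' : Fin k → ℝ) (a b : ℝ) :
    a • vecCons t u + b • vecCons t' u' = vecCons (a * t + b * t') (a • u + b • u') := by
  simp

theorem vecCons_sub_vecCons (t t' : ℝ) (u u' : Fin k → ℝ) :
    vecCons t u - vecCons t' u' = vecCons (t - t') (u - u') := by
  simp

variable {P : Set (Fin k → ℝ)} {G : (Fin (k + 1) → ℝ) → ℝ}

theorem convexOn_slice (hc : ConvexOn ℝ Set.univ G) (t : ℝ) :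
    ConvexOn ℝ Set.univ fun u => G (vecCons t u) := by
  refine ⟨convex_univ, fun u _ v _ a b ha hb hab => ?_⟩
  have h := hc.2 (Set.mem_univ (vecCons t u)) (Set.mem_univ (vecCons t v)) ha hb hab
  rwa [vecCons_combo, ← add_mul, hab, one_mul] at h

theorem hasDerivAt_vecCons_left (hG : Differentiable ℝ G) (t : ℝ) (u : Fin k → ℝ) :
    HasDerivAt (fun s => G (vecCons s u)) (coordGrad G (vecCons t u) 0) t := by
  have h1 := hasDerivAt_comp_line hG (vecCons 0 u) (vecCons 1 0) t
  simp only [vecCons_add_smul_vecCons_zero, zero_add] at h1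
  rwa [Matrix.dotProduct_cons, dotProduct_zero, mul_one, add_zero] at h1

theorem coordGrad_slice (hG : Differentiable ℝ G) (t : ℝ) (u : Fin k → ℝ) :
    coordGrad (fun v => G (vecCons t v)) u = vecTail (coordGrad G (vecCons t u)) := by
  have hd : Differentiable ℝ fun v => G (vecCons t v) :=
    hG.comp ((contDiff_vecCons t).differentiable (by norm_num))
  ext i
  have h1 := hasDerivAt_comp_line hd u (Pi.single i 1) 0
  have h2 := hasDerivAt_comp_line hG (vecCons t u) (vecCons 0 (Pi.single i 1)) 0
  have h3 : ∀ s : ℝ, vecCons t u + s • vecCons 0 (Pi.single i 1)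
      = vecCons t (u + s • Pi.single i (1 : ℝ)) := by
    intro s
    simp
  simp only [h3] at h2
  have h4 := h1.unique h2
  rw [zero_smul, add_zero, dotProduct_single, mul_one, Matrix.dotProduct_cons, mul_zero,
    zero_add, dotProduct_single, mul_one] at h4
  exact h4

namespace IsSlicedNearSupport

theorem differentiable (h : IsSlicedNearSupport P G) : Differentiable ℝ G :=
  h.contDiff.differentiable (by norm_num)

theorem contDiff_slice (h : IsSlicedNearSupport P G) (t : ℝ) :
    ContDiff ℝ 2 fun u => G (vecCons t u) :=
  h.contDiff.comp (contDiff_vecCons t)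

theorem coordGrad_eq_of_forall_le (h : IsSlicedNearSupport P G) {t : ℝ} {a u : Fin k → ℝ}
    (hu : ∀ v, G (vecCons t u) - u ⬝ᵥ a ≤ G (vecCons t v) - v ⬝ᵥ a) :
    coordGrad G (vecCons t u) = vecCons (coordGrad G (vecCons t u) 0) a := by
  have h1 := _root_.coordGrad_eq_of_forall_le ((h.contDiff_slice t).differentiable (by norm_num)) hu
  rw [coordGrad_slice h.differentiable] at h1
  conv_rhs => rw [← h1]
  exact (Matrix.cons_head_tail _).symm

theorem le_sliceConj (h : IsSlicedNearSupport P G) {t : ℝ} {a u : Fin k → ℝ}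
    (hu : ∀ v, G (vecCons t u) - u ⬝ᵥ a ≤ G (vecCons t v) - v ⬝ᵥ a) (t' : ℝ) :
    sliceConj G t a + coordGrad G (vecCons t u) 0 * (t' - t) ≤ sliceConj G t' a := by
  refine le_ciInf fun v => ?_
  have h1 := h.convexOn.add_coordGrad_le h.differentiable (vecCons t u) (vecCons t' v)
  rw [h.coordGrad_eq_of_forall_le hu, vecCons_sub_vecCons, Matrix.cons_dotProduct_cons,
    dotProduct_sub, dotProduct_comm a v, dotProduct_comm a u] at h1
  rw [sliceConj, legendreInf_eq_of_forall_le hu]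
  linarith

theorem sliceConj_le (h : IsSlicedNearSupport P G) {a : Fin k → ℝ} (ha : a ∈ P) (t : ℝ)
    (u : Fin k → ℝ) : sliceConj G t a ≤ G (vecCons t u) - u ⬝ᵥ a :=
  ciInf_le ((h.nearSupport t).bddBelow ha) u

theorem hasDerivAt_sliceConj (h : IsSlicedNearSupport P G) {t : ℝ} {a u : Fin k → ℝ}
    (ha : a ∈ P) (hu : ∀ v, G (vecCons t u) - u ⬝ᵥ a ≤ G (vecCons t v) - v ⬝ᵥ a) :
    HasDerivAt (fun s => sliceConj G s a) (coordGrad G (vecCons t u) 0) t := by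
  have h1 := hasDerivAt_iff_isLittleO.mp (hasDerivAt_vecCons_left h.differentiable t u)
  refine hasDerivAt_iff_isLittleO.mpr (Asymptotics.IsBigO.trans_isLittleO
    (Asymptotics.IsBigO.of_norm_le fun s => ?_) h1)
  have h2 := h.le_sliceConj hu s
  have h3 := h.sliceConj_le ha s u
  have h4 : sliceConj G t a = G (vecCons t u) - u ⬝ᵥ a := legendreInf_eq_of_forall_le hu
  rw [smul_eq_mul, Real.norm_eq_abs, abs_of_nonneg (by linarith)]
  linarith

theorem exists_forall_le (h : IsSlicedNearSupport P G) {a : Fin k → ℝ} (ha : a ∈ interior P)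
    (t : ℝ) : ∃ u, ∀ v, G (vecCons t u) - u ⬝ᵥ a ≤ G (vecCons t v) - v ⬝ᵥ a :=
  (h.nearSupport t).exists_forall_le (h.contDiff_slice t).continuous ha

theorem differentiableAt_sliceConj (h : IsSlicedNearSupport P G) {a : Fin k → ℝ}
    (ha : a ∈ interior P) (t : ℝ) : DifferentiableAt ℝ (fun s => sliceConj G s a) t := by
  obtain ⟨u, hu⟩ := h.exists_forall_le ha t
  exact (h.hasDerivAt_sliceConj (interior_subset ha) hu).differentiableAt

theorem deriv_sliceConj_mono (h : IsSlicedNearSupport P G) {a : Fin k → ℝ}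
    (ha : a ∈ interior P) : Monotone fun t => deriv (fun s => sliceConj G s a) t := by
  intro t t' htt'
  rcases htt'.eq_or_lt with rfl | hlt
  · exact le_rfl
  obtain ⟨u, hu⟩ := h.exists_forall_le ha t
  obtain ⟨u', hu'⟩ := h.exists_forall_le ha t'
  simp only [(h.hasDerivAt_sliceConj (interior_subset ha) hu).deriv,
    (h.hasDerivAt_sliceConj (interior_subset ha) hu').deriv]
  have h1 := h.le_sliceConj hu t'
  have h2 := h.le_sliceConj hu' t
  nlinarith

theorem exists_lipschitzWith_sliceConj (h : IsSlicedNearSupport P G) :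
    ∃ L : NNReal, ∀ a ∈ P, LipschitzWith L fun s => sliceConj G s a := by
  obtain ⟨L, hL⟩ := h.lipschitz
  refine ⟨L, fun a ha => LipschitzWith.of_dist_le_mul fun s t => ?_⟩
  exact abs_legendreInf_sub_le ((h.nearSupport s).bddBelow ha) ((h.nearSupport t).bddBelow ha)
    fun u => hL s t u

variable (hP : Convex ℝ P) (hPc : IsCompact P)

include hP hPc

theorem integrableOn_sliceConj (h : IsSlicedNearSupport P G) (t : ℝ) :
    IntegrableOn (sliceConj G t) P := by
  obtain ⟨B, hB⟩ := (h.nearSupport t).legendreInf_bound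
  exact (legendreInf_concaveOn hP fun a ha =>
    (h.nearSupport t).bddBelow ha).integrableOn_of_bounded hPc hB

theorem integrableOn_deriv_and_hasDerivAt (h : IsSlicedNearSupport P G) (t : ℝ) :
    IntegrableOn (fun a => deriv (fun s => sliceConj G s a) t) P ∧
    HasDerivAt (fun s => ∫ a in P, sliceConj G s a)
      (∫ a in P, deriv (fun s => sliceConj G s a) t) t := by
  have hint : ∀ᵐ a ∂volume.restrict P, a ∈ interior P := by
    rw [← Measure.restrict_congr_set (hP.interior_ae_eq hPc.isClosed)]
    exact ae_restrict_mem isOpen_interior.measurableSet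
  have hderiv : ∀ᵐ a ∂volume.restrict P, HasDerivAt (fun s => sliceConj G s a)
      (deriv (fun s => sliceConj G s a) t) t := by
    filter_upwards [hint] with a ha
    exact (h.differentiableAt_sliceConj ha t).hasDerivAt
  obtain ⟨L, hL⟩ := h.exists_lipschitzWith_sliceConj
  refine hasDerivAt_integral_of_dominated_loc_of_lip (bound := fun _ => L) Filter.univ_mem
    (Filter.Eventually.of_forall fun s => (h.integrableOn_sliceConj hP hPc s).1)
    (h.integrableOn_sliceConj hP hPc t) ?_ ?_ ?_ hderiv
  · refine aestronglyMeasurable_of_tendsto_ae (nhdsWithin (0 : ℝ) {0}ᶜ)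
      (f := fun s a => s⁻¹ • (sliceConj G (t + s) a - sliceConj G t a)) (fun s => ?_) ?_
    · exact (((h.integrableOn_sliceConj hP hPc (t + s)).1.sub
        (h.integrableOn_sliceConj hP hPc t).1).const_smul s⁻¹)
    · filter_upwards [hderiv] with a ha
      exact ha.tendsto_slope_zero
  · filter_upwards [hint] with a ha
    simpa using (hL a (interior_subset ha)).lipschitzOnWith (s := Set.univ)
  · exact integrableOn_const hPc.measure_lt_top.ne

omit hPc in
theorem coordGrad_image_slab_subset (h : IsSlicedNearSupport P G) (hPc : IsCompact P)
    (t₀ t₁ : ℝ) {y : Fin (k + 1) → ℝ}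
    (hy : y ∈ coordGrad G '' {x | x 0 ∈ Set.Ioo t₀ t₁}) :
    vecTail y ∈ P ∧ (vecTail y ∈ interior P → y 0 ∈ Set.Icc
      (deriv (fun s => sliceConj G s (vecTail y)) t₀)
      (deriv (fun s => sliceConj G s (vecTail y)) t₁)) := by
  obtain ⟨x, hx, rfl⟩ := hy
  obtain ⟨t, u, rfl⟩ : ∃ t u, x = vecCons t u := ⟨_, _, (Matrix.cons_head_tail x).symm⟩
  rw [Set.mem_ofPred_eq, Matrix.cons_val_zero] at hx
  have hd : Differentiable ℝ fun v => G (vecCons t v) :=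
    (h.contDiff_slice t).differentiable (by norm_num)
  have hmem := (h.nearSupport t).coordGrad_mem (convexOn_slice h.convexOn t) hd hP hPc u
  have hmin := (convexOn_slice h.convexOn t).sub_dotProduct_coordGrad_le hd u
  rw [coordGrad_slice h.differentiable] at hmem hmin
  refine ⟨hmem, fun hint => ?_⟩
  rw [← (h.hasDerivAt_sliceConj hmem hmin).deriv]
  exact ⟨h.deriv_sliceConj_mono hint hx.1.le, h.deriv_sliceConj_mono hint hx.2.le⟩

omit hP hPc in
theorem mem_coordGrad_image_slab (h : IsSlicedNearSupport P G) {t₀ t₁ : ℝ} (ht : t₀ ≤ t₁)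
    {y : Fin (k + 1) → ℝ} (hy : vecTail y ∈ interior P)
    (hy0 : y 0 ∈ Set.Ioo (deriv (fun s => sliceConj G s (vecTail y)) t₀)
      (deriv (fun s => sliceConj G s (vecTail y)) t₁)) :
    y ∈ coordGrad G '' {x | x 0 ∈ Set.Ioo t₀ t₁} := by
  obtain ⟨t, ht', hyt⟩ := exists_hasDerivWithinAt_eq_of_gt_of_lt ht (fun t _ =>
    (h.differentiableAt_sliceConj hy t).hasDerivAt.hasDerivWithinAt) hy0.1 hy0.2
  obtain ⟨u, hu⟩ := h.exists_forall_le hy t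
  refine ⟨vecCons t u, ht', ?_⟩
  rw [h.coordGrad_eq_of_forall_le hu,
    ← (h.hasDerivAt_sliceConj (interior_subset hy) hu).deriv, hyt]
  exact Matrix.cons_head_tail y

end IsSlicedNearSupport

/-- The measurable equivalence splitting off the first coordinate, as `(tail, head)`. -/
noncomputable def tailHeadEquiv (k : ℕ) : (Fin (k + 1) → ℝ) ≃ᵐ (Fin k → ℝ) × ℝ :=
  (MeasurableEquiv.piFinSuccAbove (fun _ => ℝ) 0).trans MeasurableEquiv.prodComm

theorem tailHeadEquiv_apply (y : Fin (k + 1) → ℝ) : tailHeadEquiv k y = (vecTail y, y 0) := rfl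

theorem measurePreserving_tailHeadEquiv (k : ℕ) :
    MeasurePreserving (tailHeadEquiv k) volume (volume.prod volume) :=
  (volume_preserving_piFinSuccAbove (fun _ => ℝ) 0).trans Measure.measurePreserving_swap

theorem IsSlicedNearSupport.volume_coordGrad_image_slab (h : IsSlicedNearSupport P G)
    (hP : Convex ℝ P) (hPc : IsCompact P) {t₀ t₁ : ℝ} (ht : t₀ ≤ t₁) :
    volume (coordGrad G '' {x | x 0 ∈ Set.Ioo t₀ t₁}) = ENNReal.ofReal
      ((∫ a in P, deriv (fun s => sliceConj G s a) t₁)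
        - ∫ a in P, deriv (fun s => sliceConj G s a) t₀) := by
  set D : ℝ → (Fin k → ℝ) → ℝ := fun t a => deriv (fun s => sliceConj G s a) t with hD
  have hi : ∀ t, IntegrableOn (D t) P := fun t => (h.integrableOn_deriv_and_hasDerivAt hP hPc t).1
  have hi' : ∀ t, IntegrableOn (D t) (interior P) := fun t => (hi t).mono_set interior_subset
  have hm := measurePreserving_tailHeadEquiv k
  have hmono : ∀ a ∈ interior P, D t₀ a ≤ D t₁ a := fun a ha => h.deriv_sliceConj_mono ha ht
  have heq : (∫ a in P, D t₁ a) - (∫ a in P, D t₀ a) = ∫ a in interior P, (D t₁ - D t₀) a := by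
    rw [← integral_sub (hi t₁) (hi t₀), ← setIntegral_congr_set (hP.interior_ae_eq hPc.isClosed)]
    rfl
  rw [heq]
  refine le_antisymm ?_ ?_
  · refine ENNReal.le_of_forall_pos_le_add fun δ hδ _ => ?_
    set V := volume.real (interior P) with hV
    have hfin : volume (interior P) ≠ ⊤ :=
      ((measure_mono interior_subset).trans_lt hPc.measure_lt_top).ne
    have hV0 : 0 ≤ V := measureReal_nonneg
    set ε : ℝ := δ / (2 * (V + 1)) with hε
    have hε0 : 0 < ε := by positivity
    have hεV : 2 * ε * V ≤ δ := by
      rw [hε]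
      field_simp
      nlinarith [NNReal.coe_pos.mpr hδ]
    have hsub : coordGrad G '' {x | x 0 ∈ Set.Ioo t₀ t₁} ⊆ tailHeadEquiv k ⁻¹'
        (regionBetween (fun a => D t₀ a - ε) (fun a => D t₁ a + ε) (interior P)
          ∪ frontier P ×ˢ Set.univ) := by
      intro y hy
      obtain ⟨h1, h2⟩ := h.coordGrad_image_slab_subset hP hPc t₀ t₁ hy
      rw [Set.mem_preimage, tailHeadEquiv_apply]
      by_cases hint : vecTail y ∈ interior P
      · left
        exact ⟨hint, (sub_lt_self _ hε0).trans_le (h2 hint).1,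
          (h2 hint).2.trans_lt (lt_add_of_pos_right _ hε0)⟩
      · right
        exact ⟨⟨subset_closure h1, hint⟩, trivial⟩
    refine (measure_mono hsub).trans ?_
    rw [hm.measure_preimage_equiv]
    refine (measure_union_le _ _).trans ?_
    rw [Measure.prod_prod, hP.addHaar_frontier volume, zero_mul, add_zero]
    have hc : IntegrableOn (fun _ : Fin k → ℝ => ε) (interior P) := integrableOn_const hfin
    rw [volume_regionBetween_eq_integral (f := fun a => D t₀ a - ε) (g := fun a => D t₁ a + ε)
      ((hi' t₀).sub hc) ((hi' t₁).add hc)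
      isOpen_interior.measurableSet fun a ha => by linarith [hmono a ha]]
    have h3 : ∫ a in interior P, ((fun a => D t₁ a + ε) - fun a => D t₀ a - ε) a
        = (∫ a in interior P, (D t₁ - D t₀) a) + 2 * ε * V := by
      have : ∀ a, ((fun a => D t₁ a + ε) - fun a => D t₀ a - ε) a
          = (D t₁ - D t₀) a + 2 * ε := by
        intro a
        simp only [Pi.sub_apply]
        ring
      simp_rw [this]
      rw [integral_add ((hi' t₁).sub (hi' t₀)) (integrableOn_const hfin), setIntegral_const,
        smul_eq_mul, mul_comm _ (2 * ε)]
    rw [h3]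
    refine ENNReal.ofReal_add_le.trans (add_le_add le_rfl ?_)
    exact ENNReal.ofReal_le_of_le_toReal hεV
  · rw [← volume_regionBetween_eq_integral (hi' t₀) (hi' t₁) isOpen_interior.measurableSet hmono,
      ← hm.measure_preimage_equiv]
    refine measure_mono fun y hy => ?_
    rw [Set.mem_preimage, tailHeadEquiv_apply] at hy
    exact h.mem_coordGrad_image_slab ht hy.1 hy.2

theorem IsSlicedNearSupport.integral_det_coordHess_slab (h : IsSlicedNearSupport P G)
    (hP : Convex ℝ P) (hPc : IsCompact P) {t₀ t₁ : ℝ} (ht : t₀ ≤ t₁) :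
    IntegrableOn (fun x => (coordHess G x).det) {x | x 0 ∈ Set.Ioo t₀ t₁} ∧
    ∫ x in {x | x 0 ∈ Set.Ioo t₀ t₁}, (coordHess G x).det
      = (∫ a in P, deriv (fun s => sliceConj G s a) t₁)
        - ∫ a in P, deriv (fun s => sliceConj G s a) t₀ := by
  have hW : MeasurableSet {x : Fin (k + 1) → ℝ | x 0 ∈ Set.Ioo t₀ t₁} :=
    measurableSet_Ioo.preimage (measurable_pi_apply 0)
  have hvol := h.volume_coordGrad_image_slab hP hPc ht
  have h1 := h.convexOn.integrableOn_coordGrad_image_iff h.contDiff hW fun _ => 1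
  have h2 := h.convexOn.setIntegral_coordGrad_image h.contDiff hW fun _ => 1
  simp only [mul_one] at h1 h2
  refine ⟨h1.mp (integrableOn_const (by rw [hvol]; exact ENNReal.ofReal_ne_top)), ?_⟩
  rw [← h2, setIntegral_const, smul_eq_mul, mul_one, measureReal_def, hvol, ENNReal.toReal_ofReal]
  rw [← integral_sub (h.integrableOn_deriv_and_hasDerivAt hP hPc t₁).1
    (h.integrableOn_deriv_and_hasDerivAt hP hPc t₀).1,
    ← setIntegral_congr_set (hP.interior_ae_eq hPc.isClosed)]
  refine setIntegral_nonneg isOpen_interior.measurableSet fun a ha => ?_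
  exact sub_nonneg.mpr (h.deriv_sliceConj_mono ha ht)

end SlicedConjugate

section SupportFunction

variable {ι κ : Type*} [Fintype ι] [Fintype κ]

/-- The support function of a convex body. -/
noncomputable def suppFn (K : ConvexBody (ι → ℝ)) (γ : (ι → ℝ) →ₗ[ℝ] ℝ) : ℝ :=
  sSup ((fun x => γ x) '' (K : Set (ι → ℝ)))

theorem exists_mem_eq_suppFn (K : ConvexBody (ι → ℝ)) (γ : (ι → ℝ) →ₗ[ℝ] ℝ) :
    ∃ x ∈ K, γ x = suppFn K γ := by
  obtain ⟨x, hx, h⟩ := K.isCompact.exists_sSup_image_eq K.nonempty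
    (LinearMap.continuous_of_finiteDimensional γ).continuousOn
  exact ⟨x, hx, h.symm⟩

theorem le_suppFn {K : ConvexBody (ι → ℝ)} (γ : (ι → ℝ) →ₗ[ℝ] ℝ) {x : ι → ℝ} (hx : x ∈ K) :
    γ x ≤ suppFn K γ :=
  le_csSup (K.isCompact.image (LinearMap.continuous_of_finiteDimensional γ)).bddAbove ⟨x, hx, rfl⟩

theorem suppFn_le {K : ConvexBody (ι → ℝ)} {γ : (ι → ℝ) →ₗ[ℝ] ℝ} {c : ℝ}
    (h : ∀ x ∈ K, γ x ≤ c) : suppFn K γ ≤ c := by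
  obtain ⟨x, hx, h'⟩ := exists_mem_eq_suppFn K γ
  exact h' ▸ h x hx

theorem suppFn_add (K K' : ConvexBody (ι → ℝ)) (γ : (ι → ℝ) →ₗ[ℝ] ℝ) :
    suppFn (K + K') γ = suppFn K γ + suppFn K' γ := by
  refine le_antisymm (suppFn_le fun x hx => ?_) ?_
  · rw [← SetLike.mem_coe, ConvexBody.coe_add] at hx
    obtain ⟨y, hy, z, hz, rfl⟩ := hx
    rw [map_add]
    exact add_le_add (le_suppFn γ hy) (le_suppFn γ hz)
  · obtain ⟨y, hy, h⟩ := exists_mem_eq_suppFn K γ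
    obtain ⟨z, hz, h'⟩ := exists_mem_eq_suppFn K' γ
    rw [← h, ← h', ← map_add]
    refine le_suppFn γ ?_
    rw [← SetLike.mem_coe, ConvexBody.coe_add]
    exact Set.add_mem_add hy hz

theorem ConvexBody.subset_of_suppFn_le {K K' : ConvexBody (ι → ℝ)}
    (h : ∀ γ, suppFn K γ ≤ suppFn K' γ) : (K : Set (ι → ℝ)) ⊆ K' := by
  intro x hx
  by_contra hx'
  obtain ⟨f, c, h1, h2⟩ := geometric_hahn_banach_closed_point K'.convex K'.isClosed hx'
  have h3 : suppFn K' (f : (ι → ℝ) →ₗ[ℝ] ℝ) ≤ c := suppFn_le fun y hy => (h1 y hy).le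
  have h4 := le_suppFn (f : (ι → ℝ) →ₗ[ℝ] ℝ) hx
  have h5 := h (f : (ι → ℝ) →ₗ[ℝ] ℝ)
  have h6 : (f : (ι → ℝ) →ₗ[ℝ] ℝ) x = f x := rfl
  linarith

theorem ConvexBody.ext_suppFn {K K' : ConvexBody (ι → ℝ)}
    (h : ∀ γ, suppFn K γ = suppFn K' γ) : K = K' :=
  ConvexBody.ext ((ConvexBody.subset_of_suppFn_le fun γ => (h γ).le).antisymm
    (ConvexBody.subset_of_suppFn_le fun γ => (h γ).ge))

/-- The linear functional `y ↦ u ⬝ᵥ q y`. -/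
noncomputable def dotComp (q : (ι → ℝ) →ₗ[ℝ] (κ → ℝ)) (u : κ → ℝ) : (ι → ℝ) →ₗ[ℝ] ℝ :=
  (dotProductBilin ℝ ℝ u).comp q

omit [Fintype ι] in
theorem dotComp_apply (q : (ι → ℝ) →ₗ[ℝ] (κ → ℝ)) (u : κ → ℝ) (y : ι → ℝ) :
    dotComp q u y = u ⬝ᵥ q y := rfl

theorem convexOn_suppFn_dotComp (K : ConvexBody (ι → ℝ)) (γ : (ι → ℝ) →ₗ[ℝ] ℝ)
    (q : (ι → ℝ) →ₗ[ℝ] (κ → ℝ)) :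
    ConvexOn ℝ Set.univ fun u => suppFn K (γ + dotComp q u) := by
  refine ⟨convex_univ, fun u _ v _ a b ha hb hab => suppFn_le fun y hy => ?_⟩
  have h1 := mul_le_mul_of_nonneg_left (le_suppFn (γ + dotComp q u) hy) ha
  have h2 := mul_le_mul_of_nonneg_left (le_suppFn (γ + dotComp q v) hy) hb
  simp only [smul_eq_mul]
  refine le_trans (le_of_eq ?_) (add_le_add h1 h2)
  simp only [LinearMap.add_apply, dotComp_apply, add_dotProduct, smul_dotProduct, smul_eq_mul]
  linear_combination (-γ y) * hab

theorem exists_lipschitzWith_suppFn_dotComp (K : ConvexBody (ι → ℝ)) (γ : (ι → ℝ) →ₗ[ℝ] ℝ)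
    (q : (ι → ℝ) →ₗ[ℝ] (κ → ℝ)) :
    ∃ L, LipschitzWith L fun u => suppFn K (γ + dotComp q u) := by
  obtain ⟨B, hB⟩ := (K.isCompact.image (f := fun y => ∑ i, |q y i|) (by
    have := LinearMap.continuous_of_finiteDimensional q
    fun_prop)).bddAbove
  have hB' : ∀ y ∈ K, ∑ i, |q y i| ≤ B := fun y hy => hB ⟨y, hy, rfl⟩
  have hB0 : 0 ≤ B := by
    obtain ⟨y, hy⟩ := K.nonempty
    exact (Finset.sum_nonneg fun i _ => abs_nonneg (q y i)).trans (hB' y hy)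
  have key : ∀ u v, suppFn K (γ + dotComp q u) ≤ suppFn K (γ + dotComp q v) + B * ‖u - v‖ := by
    refine fun u v => suppFn_le fun y hy => ?_
    have h1 := le_suppFn (γ + dotComp q v) hy
    have h2 : (u - v) ⬝ᵥ q y ≤ B * ‖u - v‖ := by
      calc (u - v) ⬝ᵥ q y ≤ ∑ i, ‖u - v‖ * |q y i| := by
            refine Finset.sum_le_sum fun i _ => (le_abs_self _).trans ?_
            rw [abs_mul]
            exact mul_le_mul_of_nonneg_right (norm_le_pi_norm (u - v) i) (abs_nonneg _)
        _ = ‖u - v‖ * ∑ i, |q y i| := (Finset.mul_sum _ _ _).symm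
        _ ≤ ‖u - v‖ * B := mul_le_mul_of_nonneg_left (hB' y hy) (norm_nonneg _)
        _ = B * ‖u - v‖ := mul_comm _ _
    rw [sub_dotProduct] at h2
    simp only [LinearMap.add_apply, dotComp_apply] at h1 ⊢
    linarith
  refine ⟨⟨B, hB0⟩, LipschitzWith.of_dist_le_mul fun u v => ?_⟩
  rw [Real.dist_eq, abs_sub_le_iff, dist_eq_norm]
  have h1 := key u v
  have h2 := key v u
  rw [norm_sub_rev] at h2
  exact ⟨sub_le_iff_le_add'.mpr h1, sub_le_iff_le_add'.mpr h2⟩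

theorem exists_abs_le_convexBody (K : ConvexBody (ι → ℝ)) (γ : (ι → ℝ) →ₗ[ℝ] ℝ) :
    ∃ B, ∀ y ∈ K, |γ y| ≤ B := by
  obtain ⟨B, hB⟩ := (K.isCompact.image (f := fun y => |γ y|) (by
    have := LinearMap.continuous_of_finiteDimensional γ
    fun_prop)).bddAbove
  exact ⟨B, fun y hy => hB ⟨y, hy, rfl⟩⟩

theorem nearSupport_of_abs_sub_suppFn_le (K : ConvexBody (ι → ℝ)) (γ : (ι → ℝ) →ₗ[ℝ] ℝ)
    (q : (ι → ℝ) →ₗ[ℝ] (κ → ℝ)) {F : (κ → ℝ) → ℝ} {δ : ℝ}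
    (hF : ∀ u, |F u - suppFn K (γ + dotComp q u)| ≤ δ) :
    NearSupport (q '' (K : Set (ι → ℝ))) F := by
  obtain ⟨B, hB⟩ := exists_abs_le_convexBody K γ
  refine ⟨B + δ, fun u a ha => ?_, fun u => ?_⟩
  · obtain ⟨y, hy, rfl⟩ := ha
    have h1 := le_suppFn (γ + dotComp q u) hy
    have h2 := (abs_le.mp (hB y hy)).1
    have h3 := (abs_le.mp (hF u)).1
    simp only [LinearMap.add_apply, dotComp_apply] at h1
    linarith
  · obtain ⟨y, hy, h1⟩ := exists_mem_eq_suppFn K (γ + dotComp q u)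
    refine ⟨q y, ⟨y, hy, rfl⟩, ?_⟩
    have h2 := (abs_le.mp (hB y hy)).2
    have h3 := (abs_le.mp (hF u)).2
    simp only [LinearMap.add_apply, dotComp_apply] at h1
    linarith

theorem nearSupport_suppFn (K : ConvexBody (ι → ℝ)) (γ : (ι → ℝ) →ₗ[ℝ] ℝ)
    (q : (ι → ℝ) →ₗ[ℝ] (κ → ℝ)) :
    NearSupport (q '' (K : Set (ι → ℝ))) fun u => suppFn K (γ + dotComp q u) :=
  nearSupport_of_abs_sub_suppFn_le K γ q (δ := 0) fun u => by simp

theorem legendreInf_suppFn (K : ConvexBody (ι → ℝ)) (γ : (ι → ℝ) →ₗ[ℝ] ℝ)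
    (q : (ι → ℝ) →ₗ[ℝ] (κ → ℝ)) {a : κ → ℝ} (ha : a ∈ q '' (K : Set (ι → ℝ))) :
    legendreInf (fun u => suppFn K (γ + dotComp q u)) a
      = sSup ((fun x => γ x) '' {x | x ∈ (K : Set (ι → ℝ)) ∧ q x = a}) := by
  classical
  have hbdd : BddAbove ((fun x => γ x) '' {x | x ∈ (K : Set (ι → ℝ)) ∧ q x = a}) :=
    (K.isCompact.image (LinearMap.continuous_of_finiteDimensional γ)).bddAbove.mono
      (Set.image_mono fun x hx => hx.1)
  obtain ⟨x₀, hx₀, hqx₀⟩ := id ha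
  refine le_antisymm (le_of_forall_pos_le_add fun δ hδ => ?_) ?_
  · set φ := sSup ((fun x => γ x) '' {x | x ∈ (K : Set (ι → ℝ)) ∧ q x = a}) with hφ
    have hle : ∀ x ∈ K, q x = a → γ x ≤ φ := fun x hx hxa => le_csSup hbdd ⟨x, ⟨hx, hxa⟩, rfl⟩
    have hcomp : IsCompact ((q.prod γ) '' (K : Set (ι → ℝ))) :=
      K.isCompact.image (LinearMap.continuous_of_finiteDimensional _)
    have hnot : (a, φ + δ) ∉ (q.prod γ) '' (K : Set (ι → ℝ)) := by
      rintro ⟨x, hx, hxa⟩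
      have h1 : q x = a := congrArg Prod.fst hxa
      have h2 : γ x = φ + δ := congrArg Prod.snd hxa
      linarith [hle x hx h1]
    obtain ⟨f, c, h1, h2⟩ := geometric_hahn_banach_closed_point
      (K.convex.linear_image (q.prod γ)) hcomp.isClosed hnot
    set β := f (0, 1) with hβ
    set w : κ → ℝ := fun i => f (Pi.single i 1, 0) with hw
    have hf : ∀ v r, f (v, r) = w ⬝ᵥ v + r * β := by
      intro v r
      have h3 : ((v, r) : (κ → ℝ) × ℝ) = (v, 0) + r • (0, 1) := by simp
      have h4 := LinearMap.apply_eq_dotProduct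
        ((f : ((κ → ℝ) × ℝ) →ₗ[ℝ] ℝ).comp (LinearMap.inl ℝ (κ → ℝ) ℝ)) v
      rw [h3, map_add, map_smul, smul_eq_mul]
      exact congrArg (· + r * β) h4
    have h3 : ∀ x ∈ K, w ⬝ᵥ q x + γ x * β < w ⬝ᵥ a + (φ + δ) * β := by
      intro x hx
      rw [← hf, ← hf]
      exact (h1 _ ⟨x, hx, rfl⟩).trans h2
    have hβ0 : 0 < β := by
      have h4 := h3 x₀ hx₀
      rw [hqx₀] at h4
      by_contra hneg
      nlinarith [hle x₀ hx₀ hqx₀]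
    refine (ciInf_le ((nearSupport_suppFn K γ q).bddBelow ha) (β⁻¹ • w)).trans ?_
    rw [sub_le_iff_le_add]
    refine suppFn_le fun x hx => ?_
    have h4 := h3 x hx
    simp only [LinearMap.add_apply, dotComp_apply, smul_dotProduct, smul_eq_mul]
    have h5 : β⁻¹ * (w ⬝ᵥ q x + γ x * β) ≤ β⁻¹ * (w ⬝ᵥ a + (φ + δ) * β) :=
      mul_le_mul_of_nonneg_left h4.le (inv_nonneg.mpr hβ0.le)
    rw [mul_add, mul_add, mul_comm (γ x), mul_comm (φ + δ), inv_mul_cancel_left₀ hβ0.ne',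
      inv_mul_cancel_left₀ hβ0.ne'] at h5
    linarith
  · refine le_ciInf fun u => csSup_le ⟨γ x₀, x₀, ⟨hx₀, hqx₀⟩, rfl⟩ ?_
    rintro _ ⟨x, ⟨hx, hxa⟩, rfl⟩
    have h1 := le_suppFn (γ + dotComp q u) hx
    simp only [LinearMap.add_apply, dotComp_apply, hxa] at h1 ⊢
    linarith

end SupportFunction

section Mollify

variable {ι : Type*} [Fintype ι]

/-- The convolution of `H` with a normalized bump function. -/
noncomputable def mollify (φ : ContDiffBump (0 : ι → ℝ)) (H : (ι → ℝ) → ℝ) (x : ι → ℝ) : ℝ :=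
  ∫ z, φ.normed volume z * H (x - z)

variable (φ : ContDiffBump (0 : ι → ℝ)) {H : (ι → ℝ) → ℝ}

theorem integrable_mollify (hH : Continuous H) (x : ι → ℝ) :
    Integrable fun z => φ.normed volume z * H (x - z) :=
  (φ.continuous_normed.mul
    (hH.comp (continuous_const.sub continuous_id))).integrable_of_hasCompactSupport
    φ.hasCompactSupport_normed.mul_right

theorem contDiff_mollify (hH : Continuous H) : ContDiff ℝ 2 (mollify φ H) :=
  φ.hasCompactSupport_normed.contDiff_convolution_left (n := 2)
    (ContinuousLinearMap.lsmul ℝ ℝ) φ.contDiff_normed hH.locallyIntegrable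

theorem mollify_add {H' : (ι → ℝ) → ℝ} (hH : Continuous H) (hH' : Continuous H') :
    mollify φ (fun x => H x + H' x) = mollify φ H + mollify φ H' := by
  ext x
  rw [Pi.add_apply, mollify, mollify, mollify,
    ← integral_add (integrable_mollify φ hH x) (integrable_mollify φ hH' x)]
  simp_rw [mul_add]

theorem abs_mollify_sub_le {L : NNReal} (hH : LipschitzWith L H) (x : ι → ℝ) :
    |mollify φ H x - H x| ≤ L * φ.rOut := by
  refine φ.dist_normed_convolution_le hH.continuous.aestronglyMeasurable fun y hy => ?_
  exact (hH.dist_le_mul y x).trans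
    (mul_le_mul_of_nonneg_left (Metric.mem_ball.mp hy).le L.2)

theorem convexOn_mollify (hc : ConvexOn ℝ Set.univ H) (hH : Continuous H) :
    ConvexOn ℝ Set.univ (mollify φ H) := by
  refine ⟨convex_univ, fun x _ y _ a b ha hb hab => ?_⟩
  have hx : Integrable fun z => a • (φ.normed volume z * H (x - z)) :=
    (integrable_mollify φ hH x).smul a
  have hy : Integrable fun z => b • (φ.normed volume z * H (y - z)) :=
    (integrable_mollify φ hH y).smul b
  rw [mollify, mollify, mollify, ← integral_smul, ← integral_smul, ← integral_add hx hy]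
  refine integral_mono (integrable_mollify φ hH _) (hx.add hy) fun z => ?_
  have h1 := hc.2 (Set.mem_univ (x - z)) (Set.mem_univ (y - z)) ha hb hab
  have h2 : a • (x - z) + b • (y - z) = a • x + b • y - z := by
    calc a • (x - z) + b • (y - z) = a • x + b • y - (a + b) • z := by module
      _ = _ := by rw [hab, one_smul]
  rw [h2] at h1
  have h3 := mul_le_mul_of_nonneg_left h1 (φ.nonneg_normed (μ := volume) z)
  simp only [smul_eq_mul] at h3 ⊢
  linarith

theorem abs_mollify_sub_mollify_le {L : NNReal} (hH : LipschitzWith L H) (x y : ι → ℝ) :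
    |mollify φ H x - mollify φ H y| ≤ L * ‖x - y‖ := by
  rw [mollify, mollify, ← integral_sub (integrable_mollify φ hH.continuous x)
    (integrable_mollify φ hH.continuous y), ← Real.norm_eq_abs]
  refine (norm_integral_le_integral_norm _).trans ?_
  calc ∫ z, ‖φ.normed volume z * H (x - z) - φ.normed volume z * H (y - z)‖
      ≤ ∫ z, φ.normed volume z * (L * ‖x - y‖) := by
        refine integral_mono ((integrable_mollify φ hH.continuous x).sub
          (integrable_mollify φ hH.continuous y)).norm
          (φ.integrable_normed.mul_const _) fun z => ?_
        simp only
        rw [← mul_sub, norm_mul, Real.norm_of_nonneg (φ.nonneg_normed z)]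
        refine mul_le_mul_of_nonneg_left ?_ (φ.nonneg_normed z)
        simpa [dist_eq_norm] using hH.dist_le_mul (x - z) (y - z)
    _ = L * ‖x - y‖ := by
        rw [integral_mul_const, φ.integral_normed, one_mul]

end Mollify

section MollifiedSupport

open Matrix (vecCons vecTail)

variable {n k : ℕ}

theorem add_dotComp_vecCons (p : (Fin n → ℝ) →ₗ[ℝ] (Fin k → ℝ)) (γ₀ γ₁ : (Fin n → ℝ) →ₗ[ℝ] ℝ)
    (t : ℝ) (u : Fin k → ℝ) :
    γ₀ + dotComp (γ₁.vecCons p) (vecCons t u) = (γ₀ + t • γ₁) + dotComp p u := by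
  ext y
  simp [dotComp_apply, add_assoc]

/-- The mollification of `(t, u) ↦ h_K(γ₀ + t γ₁ + u ∘ p)`. -/
noncomputable def mollSupp (p : (Fin n → ℝ) →ₗ[ℝ] (Fin k → ℝ)) (γ₀ γ₁ : (Fin n → ℝ) →ₗ[ℝ] ℝ)
    (φ : ContDiffBump (0 : Fin (k + 1) → ℝ)) (K : ConvexBody (Fin n → ℝ)) :
    (Fin (k + 1) → ℝ) → ℝ :=
  mollify φ fun x => suppFn K (γ₀ + dotComp (γ₁.vecCons p) x)

variable (p : (Fin n → ℝ) →ₗ[ℝ] (Fin k → ℝ)) (γ₀ γ₁ : (Fin n → ℝ) →ₗ[ℝ] ℝ)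
  (φ : ContDiffBump (0 : Fin (k + 1) → ℝ)) (K K' : ConvexBody (Fin n → ℝ))

theorem ConvexBody.convex_image : Convex ℝ (p '' (K : Set (Fin n → ℝ))) :=
  K.convex.linear_image p

theorem ConvexBody.isCompact_image : IsCompact (p '' (K : Set (Fin n → ℝ))) :=
  K.isCompact.image (LinearMap.continuous_of_finiteDimensional p)

theorem continuous_suppFn_dotComp {ι κ : Type*} [Fintype ι] [Fintype κ]
    (K : ConvexBody (ι → ℝ)) (γ : (ι → ℝ) →ₗ[ℝ] ℝ) (q : (ι → ℝ) →ₗ[ℝ] (κ → ℝ)) :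
    Continuous fun u => suppFn K (γ + dotComp q u) :=
  (exists_lipschitzWith_suppFn_dotComp K γ q).choose_spec.continuous

theorem mollSupp_add :
    mollSupp p γ₀ γ₁ φ (K + K') = mollSupp p γ₀ γ₁ φ K + mollSupp p γ₀ γ₁ φ K' := by
  rw [mollSupp, mollSupp, mollSupp, ← mollify_add φ (continuous_suppFn_dotComp _ _ _)
    (continuous_suppFn_dotComp _ _ _)]
  simp_rw [suppFn_add]

theorem isSlicedNearSupport_mollSupp :
    IsSlicedNearSupport (p '' (K : Set (Fin n → ℝ))) (mollSupp p γ₀ γ₁ φ K) := by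
  obtain ⟨L, hL⟩ := exists_lipschitzWith_suppFn_dotComp K γ₀ (γ₁.vecCons p)
  refine ⟨contDiff_mollify φ hL.continuous,
    convexOn_mollify φ (convexOn_suppFn_dotComp K γ₀ (γ₁.vecCons p)) hL.continuous, fun t => ?_,
    L, fun t t' u => ?_⟩
  · refine nearSupport_of_abs_sub_suppFn_le (δ := L * φ.rOut) K (γ₀ + t • γ₁) p fun u => ?_
    rw [← add_dotComp_vecCons]
    exact abs_mollify_sub_le φ hL _
  · refine (abs_mollify_sub_mollify_le φ hL _ _).trans_eq ?_
    congr 1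
    rw [vecCons_sub_vecCons, sub_self]
    refine le_antisymm ((pi_norm_le_iff_of_nonneg (abs_nonneg _)).mpr fun i => ?_) ?_
    · refine Fin.cases ?_ (fun j => ?_) i
      · simp
      · simp
    · exact norm_le_pi_norm (vecCons (t - t') (0 : Fin k → ℝ)) 0

theorem bsFiberBodySupport_eq_integral_legendreInf (γ : (Fin n → ℝ) →ₗ[ℝ] ℝ) :
    bsFiberBodySupport n k p K γ
      = ∫ a in p '' (K : Set (Fin n → ℝ)), legendreInf (fun u => suppFn K (γ + dotComp p u)) a :=
  setIntegral_congr_fun (K.isCompact_image p).measurableSet fun _ ha =>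
    (legendreInf_suppFn K γ p ha).symm

theorem exists_abs_integral_sliceConj_sub_le (t : ℝ) :
    ∃ C, ∀ φ : ContDiffBump (0 : Fin (k + 1) → ℝ),
      |(∫ a in p '' (K : Set (Fin n → ℝ)), sliceConj (mollSupp p γ₀ γ₁ φ K) t a)
        - bsFiberBodySupport n k p K (γ₀ + t • γ₁)| ≤ C * φ.rOut := by
  obtain ⟨L, hL⟩ := exists_lipschitzWith_suppFn_dotComp K γ₀ (γ₁.vecCons p)
  have hPc := K.isCompact_image p
  have hP := K.convex_image p
  refine ⟨L * volume.real (p '' (K : Set (Fin n → ℝ))), fun φ => ?_⟩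
  have hS := nearSupport_suppFn K (γ₀ + t • γ₁) p
  have hG := isSlicedNearSupport_mollSupp p γ₀ γ₁ φ K
  obtain ⟨B, hB⟩ := hS.legendreInf_bound
  have hi := (legendreInf_concaveOn hP fun a ha => hS.bddBelow ha).integrableOn_of_bounded hPc hB
  rw [bsFiberBodySupport_eq_integral_legendreInf,
    ← integral_sub (hG.integrableOn_sliceConj hP hPc t) hi, ← Real.norm_eq_abs]
  refine (norm_setIntegral_le_of_norm_le_const hPc.measure_lt_top
    fun a ha => ?_).trans_eq (mul_right_comm _ _ _)
  refine abs_legendreInf_sub_le ((hG.nearSupport t).bddBelow ha) (hS.bddBelow ha) fun u => ?_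
  rw [← add_dotComp_vecCons]
  exact abs_mollify_sub_le φ hL _

theorem exists_seq_contDiffBump (κ : Type*) [Fintype κ] :
    ∃ φ : ℕ → ContDiffBump (0 : κ → ℝ),
      Filter.Tendsto (fun m => (φ m).rOut) Filter.atTop (nhds 0) := by
  refine ⟨fun m => ⟨1 / (m + 1) / 2, 1 / (m + 1), by positivity, half_lt_self (by positivity)⟩, ?_⟩
  exact tendsto_one_div_add_atTop_nhds_zero_nat

theorem tendsto_integral_sliceConj {φ : ℕ → ContDiffBump (0 : Fin (k + 1) → ℝ)}
    (hφ : Filter.Tendsto (fun m => (φ m).rOut) Filter.atTop (nhds 0)) (t : ℝ) :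
    Filter.Tendsto (fun m => ∫ a in p '' (K : Set (Fin n → ℝ)),
        sliceConj (mollSupp p γ₀ γ₁ (φ m) K) t a) Filter.atTop
      (nhds (bsFiberBodySupport n k p K (γ₀ + t • γ₁))) := by
  obtain ⟨C, hC⟩ := exists_abs_integral_sliceConj_sub_le p γ₀ γ₁ K t
  rw [tendsto_iff_norm_sub_tendsto_zero]
  refine squeeze_zero (fun m => norm_nonneg _) (fun m => hC (φ m)) ?_
  simpa using hφ.const_mul C

end MollifiedSupport

section Polarizable

open Filter

variable {ι X : Type*} [Fintype ι] [DecidableEq ι] [AddCommMonoid X]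

/-- The polarization of `q` is additive in each argument and recovers `q` on the diagonal. -/
def IsPolarizable (ι : Type*) {X : Type*} [Fintype ι] [DecidableEq ι] [AddCommMonoid X]
    (q : X → ℝ) : Prop :=
  (∀ (x : ι → X) (i : ι) (a b : X), polarSum q (Function.update x i (a + b))
      = polarSum q (Function.update x i a) + polarSum q (Function.update x i b)) ∧
    ∀ x : X, polarSum q (fun _ : ι => x) = (Fintype.card ι).factorial * q x

theorem IsDiagonal.isPolarizable {q : X → ℝ} (hq : IsDiagonal ι q) : IsPolarizable ι q :=
  ⟨hq.polarSum_update_add, hq.polarSum_const⟩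

theorem tendsto_polarSum {q : ℕ → X → ℝ} {q' : X → ℝ}
    (h : ∀ x, Tendsto (fun m => q m x) atTop (nhds (q' x))) (x : ι → X) :
    Tendsto (fun m => polarSum (q m) x) atTop (nhds (polarSum q' x)) :=
  tendsto_finsetSum _ fun _ _ => (h _).const_mul _

theorem IsPolarizable.of_tendsto {q : ℕ → X → ℝ} {q' : X → ℝ} (hq : ∀ m, IsPolarizable ι (q m))
    (h : ∀ x, Tendsto (fun m => q m x) atTop (nhds (q' x))) : IsPolarizable ι q' := by
  refine ⟨fun x i a b => ?_, fun x => ?_⟩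
  · refine tendsto_nhds_unique (tendsto_polarSum h _) ?_
    simp_rw [(hq _).1]
    exact (tendsto_polarSum h _).add (tendsto_polarSum h _)
  · refine tendsto_nhds_unique (tendsto_polarSum h _) ?_
    simp_rw [(hq _).2]
    exact (h x).const_mul _

variable {α : Type*} [MeasurableSpace α] {μ : Measure α} {q : α → X → ℝ}

theorem integrable_polarSum (h : ∀ x, Integrable (fun u => q u x) μ) (x : ι → X) :
    Integrable (fun u => polarSum (q u) x) μ :=
  integrable_finsetSum _ fun _ _ => (h _).const_mul _

theorem polarSum_integral (h : ∀ x, Integrable (fun u => q u x) μ) (x : ι → X) :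
    polarSum (fun y => ∫ u, q u y ∂μ) x = ∫ u, polarSum (q u) x ∂μ := by
  unfold polarSum
  rw [integral_finsetSum _ fun _ _ => (h _).const_mul _]
  simp_rw [integral_const_mul]

theorem IsPolarizable.integral (hq : ∀ u, IsPolarizable ι (q u))
    (h : ∀ x, Integrable (fun u => q u x) μ) : IsPolarizable ι fun x => ∫ u, q u x ∂μ := by
  refine ⟨fun x i a b => ?_, fun x => ?_⟩
  · simp_rw [polarSum_integral h, (hq _).1]
    exact integral_add (integrable_polarSum h _) (integrable_polarSum h _)
  · simp_rw [polarSum_integral h, (hq _).2, integral_const_mul]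

theorem polarSum_sub (q q' : X → ℝ) (x : ι → X) :
    polarSum (fun y => q y - q' y) x = polarSum q x - polarSum q' x := by
  simp_rw [polarSum, mul_sub, Finset.sum_sub_distrib]

theorem hasDerivAt_polarSum {q : ℝ → X → ℝ} {q' : X → ℝ} {t : ℝ}
    (h : ∀ x, HasDerivAt (fun s => q s x) (q' x) t) (x : ι → X) :
    HasDerivAt (fun s => polarSum (q s) x) (polarSum q' x) t :=
  HasDerivAt.fun_sum fun _ _ => (h _).const_mul _

theorem polarSum_comp_addMonoidHom {Y : Type*} [AddCommMonoid Y] (q : Y → ℝ) (A : X →+ Y)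
    (x : ι → X) : polarSum (fun y => q (A y)) x = polarSum q (A ∘ x) := by
  simp [polarSum]

end Polarizable

section MollifiedPolarization

open Matrix (vecCons)

variable {n k : ℕ} (p : (Fin n → ℝ) →ₗ[ℝ] (Fin k → ℝ)) (γ₀ γ₁ : (Fin n → ℝ) →ₗ[ℝ] ℝ)
  (φ : ContDiffBump (0 : Fin (k + 1) → ℝ))

theorem isPolarizable_integral_sliceConj (t : ℝ) :
    IsPolarizable (Fin (k + 1)) fun K : ConvexBody (Fin n → ℝ) =>
      ∫ a in p '' (K : Set (Fin n → ℝ)), sliceConj (mollSupp p γ₀ γ₁ φ K) t a := by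
  have hG := isSlicedNearSupport_mollSupp p γ₀ γ₁ φ
  set F : ConvexBody (Fin n → ℝ) → (Fin k → ℝ) → ℝ :=
    fun K u => mollSupp p γ₀ γ₁ φ K (vecCons t u)
  have hF : ∀ K, ContDiff ℝ 2 (F K) := fun K => (hG K).contDiff_slice t
  have hFd : ∀ K, Differentiable ℝ (F K) := fun K => (hF K).differentiable (by norm_num)
  have hadd : ∀ K K', F (K + K') = F K + F K' := fun K K' => by
    ext u
    simp only [F, mollSupp_add, Pi.add_apply]
  have hint := fun K => ((hG K).nearSupport t).integral_legendreInf
    (convexOn_slice (hG K).convexOn t) (hF K) (K.convex_image p) (K.isCompact_image p)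
  rw [show (fun K : ConvexBody (Fin n → ℝ) => ∫ a in p '' (K : Set (Fin n → ℝ)),
    sliceConj (mollSupp p γ₀ γ₁ φ K) t a) = _ from funext fun K => (hint K).2]
  refine IsPolarizable.integral (fun u => ?_) fun K => (hint K).1
  let c : ConvexBody (Fin n → ℝ) →+ ℝ :=
    AddMonoidHom.mk' (fun K => F K u - u ⬝ᵥ coordGrad (F K) u) fun K K' => by
      simp only [hadd, coordGrad_add (hFd K) (hFd K'), Pi.add_apply, dotProduct_add]
      ring
  let A : ConvexBody (Fin n → ℝ) →+ Matrix (Fin k) (Fin k) ℝ :=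
    AddMonoidHom.mk' (fun K => coordHess (F K) u) fun K K' => by
      simp only [hadd, coordHess_add (hF K) (hF K')]
  exact (isDiagonal_mul_det c A).isPolarizable

theorem convexOn_polarSum_integral_sliceConj (Δ : Fin (k + 1) → ConvexBody (Fin n → ℝ)) :
    ConvexOn ℝ Set.univ fun t => polarSum (fun K : ConvexBody (Fin n → ℝ) =>
      ∫ a in p '' (K : Set (Fin n → ℝ)), sliceConj (mollSupp p γ₀ γ₁ φ K) t a) Δ := by
  have hG := isSlicedNearSupport_mollSupp p γ₀ γ₁ φ
  have hd := fun t => hasDerivAt_polarSum (fun K => ((hG K).integrableOn_deriv_and_hasDerivAt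
    (K.convex_image p) (K.isCompact_image p) t).2) Δ
  refine MonotoneOn.convexOn_of_deriv convex_univ
    (fun t _ => (hd t).continuousAt.continuousWithinAt)
    (fun t _ => (hd t).differentiableAt.differentiableWithinAt) ?_
  intro t₀ _ t₁ _ ht
  rw [(hd t₀).deriv, (hd t₁).deriv, ← sub_nonneg, ← polarSum_sub]
  have hint := fun K => (hG K).integral_det_coordHess_slab (K.convex_image p)
    (K.isCompact_image p) ht
  simp_rw [← fun K => (hint K).2]
  rw [polarSum_integral fun K => (hint K).1]
  refine integral_nonneg fun x => ?_
  let A : ConvexBody (Fin n → ℝ) →+ Matrix (Fin (k + 1)) (Fin (k + 1)) ℝ :=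
    AddMonoidHom.mk' (fun K => coordHess (mollSupp p γ₀ γ₁ φ K) x) fun K K' => by
      simp only [mollSupp_add, coordHess_add (hG K).contDiff (hG K').contDiff]
  refine (polarSum_det_nonneg _ fun i => ?_).trans_eq
    (polarSum_comp_addMonoidHom Matrix.det A Δ).symm
  exact (hG (Δ i)).convexOn.posSemidef_coordHess (hG (Δ i)).contDiff x

end MollifiedPolarization

section FiberBody

variable {n k : ℕ} (p : (Fin n → ℝ) →ₗ[ℝ] (Fin k → ℝ))

theorem isPolarizable_bsFiberBodySupport (γ : (Fin n → ℝ) →ₗ[ℝ] ℝ) :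
    IsPolarizable (Fin (k + 1)) fun K => bsFiberBodySupport n k p K γ := by
  obtain ⟨φ, hφ⟩ := exists_seq_contDiffBump (Fin (k + 1))
  have h := fun K => tendsto_integral_sliceConj p γ 0 K hφ 0
  simp only [smul_zero, add_zero] at h
  exact IsPolarizable.of_tendsto (fun m => isPolarizable_integral_sliceConj p γ 0 (φ m) 0) h

theorem convexOn_polarSum_bsFiberBodySupport (Δ : Fin (k + 1) → ConvexBody (Fin n → ℝ))
    (γ₀ γ₁ : (Fin n → ℝ) →ₗ[ℝ] ℝ) :
    ConvexOn ℝ Set.univ fun t : ℝ =>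
      polarSum (fun K => bsFiberBodySupport n k p K (γ₀ + t • γ₁)) Δ := by
  obtain ⟨φ, hφ⟩ := exists_seq_contDiffBump (Fin (k + 1))
  have h := fun t => tendsto_polarSum (fun K => tendsto_integral_sliceConj p γ₀ γ₁ K hφ t) Δ
  refine ⟨convex_univ, fun x _ y _ a b ha hb hab => ?_⟩
  refine le_of_tendsto_of_tendsto' (h _) (((h x).const_mul a).add ((h y).const_mul b)) fun m => ?_
  exact (convexOn_polarSum_integral_sliceConj p γ₀ γ₁ (φ m) Δ).2 (Set.mem_univ x)
    (Set.mem_univ y) ha hb hab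

theorem bsFiberBodySupport_smul (K : ConvexBody (Fin n → ℝ)) (γ : (Fin n → ℝ) →ₗ[ℝ] ℝ) {c : ℝ}
    (hc : 0 ≤ c) : bsFiberBodySupport n k p K (c • γ) = c * bsFiberBodySupport n k p K γ := by
  rw [bsFiberBodySupport, bsFiberBodySupport, ← integral_const_mul]
  congr 1 with a
  rw [← smul_eq_mul, ← Real.sSup_smul_of_nonneg hc, ← Set.image_smul, Set.image_image]
  rfl

/-- The support function of the mixed fiber body. -/
noncomputable def mixedFiberSupport (Δ : Fin (k + 1) → ConvexBody (Fin n → ℝ))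
    (γ : (Fin n → ℝ) →ₗ[ℝ] ℝ) : ℝ :=
  ((k + 1).factorial : ℝ)⁻¹ * polarSum (fun K => bsFiberBodySupport n k p K γ) Δ

theorem mixedFiberSupport_smul (Δ : Fin (k + 1) → ConvexBody (Fin n → ℝ))
    (γ : (Fin n → ℝ) →ₗ[ℝ] ℝ) {c : ℝ} (hc : 0 ≤ c) :
    mixedFiberSupport p Δ (c • γ) = c * mixedFiberSupport p Δ γ := by
  simp only [mixedFiberSupport, polarSum, bsFiberBodySupport_smul p _ γ hc, Finset.mul_sum]
  exact Finset.sum_congr rfl fun _ _ => by ring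

theorem mixedFiberSupport_add_le (Δ : Fin (k + 1) → ConvexBody (Fin n → ℝ))
    (γ γ' : (Fin n → ℝ) →ₗ[ℝ] ℝ) :
    mixedFiberSupport p Δ (γ + γ') ≤ mixedFiberSupport p Δ γ + mixedFiberSupport p Δ γ' := by
  have h := ((convexOn_polarSum_bsFiberBodySupport p Δ γ (γ' - γ)).smul
    (inv_nonneg.mpr (Nat.cast_nonneg (k + 1).factorial : (0 : ℝ) ≤ _))).2 (Set.mem_univ 0)
    (Set.mem_univ 1) (show (0 : ℝ) ≤ 1 / 2 by norm_num) (show (0 : ℝ) ≤ 1 / 2 by norm_num)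
    (by norm_num)
  have h1 : γ + (1 / 2 : ℝ) • (γ' - γ) = (1 / 2 : ℝ) • (γ + γ') := by module
  simp only [smul_eq_mul, mul_zero, mul_one, zero_add, zero_smul, add_zero, one_smul,
    add_sub_cancel, h1] at h
  change mixedFiberSupport p Δ ((1 / 2 : ℝ) • (γ + γ')) ≤ 1 / 2 * mixedFiberSupport p Δ γ
    + 1 / 2 * mixedFiberSupport p Δ γ' at h
  rw [mixedFiberSupport_smul p Δ _ (by norm_num)] at h
  linarith

end FiberBody

/-- Every sublinear function on the dual space is the support function of a convex body. -/
theorem exists_suppFn_eq {ι : Type*} [Fintype ι] (f : ((ι → ℝ) →ₗ[ℝ] ℝ) → ℝ)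
    (hsmul : ∀ (c : ℝ) γ, 0 ≤ c → f (c • γ) = c * f γ) (hadd : ∀ γ γ', f (γ + γ') ≤ f γ + f γ') :
    ∃ K : ConvexBody (ι → ℝ), ∀ γ, suppFn K γ = f γ := by
  classical
  have hf0 : f 0 = 0 := by simpa using hsmul 0 0 le_rfl
  set S : Set (ι → ℝ) := {x | ∀ γ : (ι → ℝ) →ₗ[ℝ] ℝ, γ x ≤ f γ}
  have hdual : ∀ g : ((ι → ℝ) →ₗ[ℝ] ℝ) →ₗ[ℝ] ℝ, ∀ γ : (ι → ℝ) →ₗ[ℝ] ℝ,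
      γ (fun i => g (LinearMap.proj i)) = g γ := by
    intro g γ
    have h : γ = ∑ i, γ (Pi.single i 1) • (LinearMap.proj i : (ι → ℝ) →ₗ[ℝ] ℝ) := by
      refine LinearMap.pi_ext' fun j => LinearMap.ext_ring ?_
      simp [Pi.single_apply]
    conv_rhs => rw [h, map_sum]
    rw [γ.pi_apply_eq_sum_univ]
    refine Finset.sum_congr rfl fun i _ => ?_
    rw [map_smul, smul_eq_mul, smul_eq_mul, mul_comm]
    congr 2
    ext j
    simp [Pi.single_apply, eq_comm]
  have hmax : ∀ γ, ∃ x ∈ S, γ x = f γ := by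
    intro γ
    obtain ⟨g, hgγ, hg⟩ : ∃ g : ((ι → ℝ) →ₗ[ℝ] ℝ) →ₗ[ℝ] ℝ, g γ = f γ ∧ ∀ γ', g γ' ≤ f γ' := by
      have H : ∀ c : ℝ, c • γ = 0 → (RingHom.id ℝ) c • f γ = 0 := by
        intro c hc
        rcases smul_eq_zero.mp hc with rfl | rfl
        · simp
        · simp [hf0]
      obtain ⟨g, hgx, hg⟩ := exists_extension_of_le_sublinear
        (LinearPMap.mkSpanSingleton' γ (f γ) H) f (fun c hc γ => hsmul c γ hc.le) hadd
        fun x => by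
          obtain ⟨x, hx⟩ := x
          obtain ⟨c, rfl⟩ := Submodule.mem_span_singleton.mp hx
          rw [LinearPMap.mkSpanSingleton'_apply, RingHom.id_apply, smul_eq_mul]
          rcases le_total 0 c with hc | hc
          · exact (hsmul c γ hc).ge
          · have h1 := hadd (c • γ) ((-c) • γ)
            rw [← add_smul, add_neg_cancel, zero_smul, hf0, hsmul (-c) γ (neg_nonneg.mpr hc)] at h1
            linarith
      exact ⟨g, (hgx ⟨γ, Submodule.mem_span_singleton_self γ⟩).trans
        (LinearPMap.mkSpanSingleton'_apply_self _ _ _ _), hg⟩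
    exact ⟨fun i => g (LinearMap.proj i), fun γ' => (hdual g γ').trans_le (hg γ'),
      (hdual g γ).trans hgγ⟩
  have hS : S = ⋂ γ : (ι → ℝ) →ₗ[ℝ] ℝ, {x | γ x ≤ f γ} := by
    ext x
    simp [S]
  have hclosed : IsClosed S := by
    rw [hS]
    exact isClosed_iInter fun γ =>
      isClosed_le (LinearMap.continuous_of_finiteDimensional γ) continuous_const
  have hconv : Convex ℝ S := by
    rw [hS]
    exact convex_iInter fun γ => convex_halfSpace_le γ.isLinear _
  have hbdd : Bornology.IsBounded S := by
    refine (Metric.isBounded_Icc (fun i => -f (-LinearMap.proj i))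
      fun i => f (LinearMap.proj i)).subset fun x hx => ⟨fun i => ?_, fun i => hx (LinearMap.proj i)⟩
    exact neg_le.mp (hx (-LinearMap.proj i))
  obtain ⟨x₀, hx₀, -⟩ := hmax 0
  refine ⟨⟨S, hconv, Metric.isCompact_of_isClosed_isBounded hclosed hbdd, x₀, hx₀⟩, fun γ => ?_⟩
  obtain ⟨x, hx, hxγ⟩ := hmax γ
  exact le_antisymm (suppFn_le fun y hy => hy γ) (hxγ ▸ le_suppFn γ hx)

section Uniqueness

variable {ι X : Type*} [Fintype ι] [DecidableEq ι] [AddCommMonoid X]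

theorem polarSum_diag_of_symmetric {M : (ι → X) → ℝ}
    (hsymm : ∀ (x : ι → X) (σ : Equiv.Perm ι), M (x ∘ σ) = M x)
    (hadd : ∀ (x : ι → X) (i : ι) (a b : X), M (Function.update x i (a + b))
      = M (Function.update x i a) + M (Function.update x i b)) (x : ι → X) :
    polarSum (fun y => M fun _ => y) x = (Fintype.card ι).factorial * M x := by
  have hsmul : ∀ (x : ι → X) (i : ι) (c : ℕ) (a : X),
      M (Function.update x i (c • a)) = c • M (Function.update x i a) := by
    intro x i c a
    induction c with
    | zero => simpa using hadd x i 0 0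
    | succ c ih => rw [succ_nsmul, hadd, ih, succ_nsmul]
  let m : MultilinearMap ℕ (fun _ : ι => X) ℝ :=
    { toFun := M
      map_update_add' := fun x i a b => by convert hadd x i a b
      map_update_smul' := fun x i c a => by convert hsmul x i c a }
  refine (polarSum_diag_eq_sum_perm m x).trans ?_
  rw [Fintype.sum_congr _ _ fun σ : Equiv.Perm ι => show m (x ∘ σ) = M x from hsymm x σ]
  simp [Fintype.card_perm]

end Uniqueness

/-- Billera–Sturmfels version of the existence and uniqueness of mixed fiber bodies: for a
surjective linear map `p : ℝ^n → ℝ^k`, there is a unique symmetric, Minkowski-multilinear map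
`MF^BS` from `(k+1)`-tuples of convex bodies in `ℝ^n` to convex bodies in `ℝ^n` whose diagonal
values are the Billera–Sturmfels fiber bodies (characterized by their support functions). -/
theorem bs_mixed_fiber_body_exists_unique (n k : ℕ)
    (p : (Fin n → ℝ) →ₗ[ℝ] (Fin k → ℝ)) (hp : Function.Surjective p) :
    ∃! MFBS : (Fin (k + 1) → ConvexBody (Fin n → ℝ)) → ConvexBody (Fin n → ℝ),
      (∀ (Δ : Fin (k + 1) → ConvexBody (Fin n → ℝ)) (σ : Equiv.Perm (Fin (k + 1))),
          MFBS (Δ ∘ σ) = MFBS Δ) ∧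
      (∀ (Δ : Fin (k + 1) → ConvexBody (Fin n → ℝ)) (i : Fin (k + 1))
          (K K' : ConvexBody (Fin n → ℝ)),
          MFBS (Function.update Δ i (K + K'))
            = MFBS (Function.update Δ i K) + MFBS (Function.update Δ i K')) ∧
      (∀ (Δ : ConvexBody (Fin n → ℝ)) (γ : (Fin n → ℝ) →ₗ[ℝ] ℝ),
          sSup ((fun x => γ x) '' ((MFBS fun _ => Δ) : Set (Fin n → ℝ)))
            = bsFiberBodySupport n k p Δ γ) := by
  have hfac : ((k + 1).factorial : ℝ) ≠ 0 := by positivity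
  choose MF hMF using fun Δ => exists_suppFn_eq (mixedFiberSupport (k := k) p Δ)
    (fun c γ hc => mixedFiberSupport_smul p Δ γ hc) (mixedFiberSupport_add_le p Δ)
  refine ⟨MF, ⟨fun Δ σ => ?_, fun Δ i K K' => ?_, fun Δ γ => ?_⟩, ?_⟩
  · refine ConvexBody.ext_suppFn fun γ => ?_
    simp_rw [hMF, mixedFiberSupport, polarSum_comp_perm]
  · refine ConvexBody.ext_suppFn fun γ => ?_
    rw [suppFn_add]
    simp_rw [hMF, mixedFiberSupport, (isPolarizable_bsFiberBodySupport p γ).1, mul_add]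
  · refine (hMF _ γ).trans ?_
    rw [mixedFiberSupport, (isPolarizable_bsFiberBodySupport p γ).2, Fintype.card_fin,
      inv_mul_cancel_left₀ hfac]
  · rintro M ⟨hsymm, hadd, hdiag⟩
    refine funext fun Δ => ConvexBody.ext_suppFn fun γ => ?_
    have h := polarSum_diag_of_symmetric (M := fun Δ => suppFn (M Δ) γ)
      (fun Δ σ => by rw [hsymm]) (fun Δ i K K' => by rw [hadd, suppFn_add]) Δ
    rw [polarSum_congr fun K => show suppFn (M fun _ => K) γ = _ from hdiag K γ, Fintype.card_fin] at h
    rw [hMF, mixedFiberSupport, h, inv_mul_cancel_left₀ hfac]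
end
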